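/- arXiv:2110.14631 — 2 statements merged into one kernel-verified Lean document; each statement's English description precedes it below -/
import Mathlib

section
/- Let P_Z be a probability distribution on ℝ defining a BMS channel in multiplicative-noise form with capacity C ∈ (0,1). Fix integers 0 ≤ r ≤ m with m ≥ 1 and set N = 2^m. Let X be uniform on the BPSK image of RM(r,m), let Z ∈ ℝ^N have i.i.d. components with law P_Z independent of X, and let Y = X ⊙ Z. If R(r,m) > C, then for every i ∈ {0,…,N−1}, mmse(X_i | Y_{∼i}) ≥ 1 − (1 − C)·ρ(m) / ( ψ(1−C)·Ψ(R(r,m) − C) ), where Y_{∼i} denotes the vector Y with the i-th coordinate removed, ρ(m) := (6 ln m + 34)/(5 √m), ψ(u) := 1 − (1 − 2·h_b^{−1}(u))², h_b^{−1} : [0,1] → [0,1/2] is the inverse of the binary entropy function restricted to [0,1/2], and Ψ(u) := ∫₀^u ψ(v) dv. -/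
open MeasureTheory ProbabilityTheory

noncomputable section

/-- The binary entropy function (base 2). -/
def hb (p : ℝ) : ℝ := -(p * Real.logb 2 p) - (1 - p) * Real.logb 2 (1 - p)

/-- Conditional expectation `E[X | W]` of `X` given the σ-algebra generated by `W`. -/
def condMean {Ω β E : Type*} [MeasurableSpace Ω] [MeasurableSpace β]
    [NormedAddCommGroup E] [NormedSpace ℝ E] [CompleteSpace E]
    (μ : Measure Ω) (X : Ω → E) (W : Ω → β) : Ω → E :=
  μ[X | MeasurableSpace.comap W inferInstance]

/-- Bit-error probability of the MAP decision rule for `X ∈ {±1}` given `W`. -/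
def BER {Ω β : Type*} [MeasurableSpace Ω] [MeasurableSpace β]
    (μ : Measure Ω) (X : Ω → ℝ) (W : Ω → β) : ℝ :=
  (1 - ∫ ω, |condMean μ X W ω| ∂μ) / 2

/-- Minimum mean squared error of estimating `X` from `W`. -/
def mmse {Ω β : Type*} [MeasurableSpace Ω] [MeasurableSpace β]
    (μ : Measure Ω) (X : Ω → ℝ) (W : Ω → β) : ℝ :=
  ∫ ω, (X ω - condMean μ X W ω) ^ 2 ∂μ

/-- Uniform distribution on `{-1, 1} ⊆ ℝ`. -/
def signMeasure : Measure ℝ := (2 : ENNReal)⁻¹ • (Measure.dirac (-1) + Measure.dirac 1)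

/-- Capacity of the BMS channel (in multiplicative-noise form) with noise law `PZ`:
`C = 1 - E[h_b((1 + E[X_u | Y_u])/2)]` where `X_u` is uniform on `{±1}`, independent of
`Z₀ ~ PZ`, and `Y_u = X_u · Z₀`. -/
def capacity (PZ : Measure ℝ) : ℝ :=
  1 - ∫ p, hb ((1 + condMean (signMeasure.prod PZ)
        (fun q : ℝ × ℝ => q.1) (fun q : ℝ × ℝ => q.1 * q.2) p) / 2) ∂(signMeasure.prod PZ)

/-- Evaluation vector of the multilinear polynomial whose coefficients on monomials
of degree at most `r` are given by `α` (higher-degree coefficients being ignored),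
evaluated at the point `v ∈ 𝔽₂^m` with index `i = Σ_j v_j 2^j`. -/
def RMword (r m : ℕ) (α : Finset (Fin m) → ZMod 2) : Fin (2 ^ m) → ZMod 2 :=
  fun i => ∑ S ∈ Finset.univ.filter (fun S : Finset (Fin m) => S.card ≤ r),
    α S * ∏ j ∈ S, ((((i : ℕ) / 2 ^ (j : ℕ)) % 2 : ℕ) : ZMod 2)

/-- The Reed–Muller code RM(r, m) ⊆ 𝔽₂^{2^m}. -/
def RMcode (r m : ℕ) : Finset (Fin (2 ^ m) → ZMod 2) :=
  Finset.image (RMword r m) Finset.univ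

/-- The rate `R(r,m)` of RM(r,m). -/
def RMrate (r m : ℕ) : ℝ := (2 ^ m : ℝ)⁻¹ * ∑ i ∈ Finset.range (r + 1), (m.choose i : ℝ)

/-- BPSK modulation map `c ↦ ((-1)^{c_0}, …, (-1)^{c_{N-1}})`. -/
def bpsk {N : ℕ} (c : Fin N → ZMod 2) : Fin N → ℝ := fun i => (-1 : ℝ) ^ ((c i).val)

/-- BPSK image of a binary code. -/
def bpskImage {N : ℕ} (C : Finset (Fin N → ZMod 2)) : Finset (Fin N → ℝ) :=
  letI := Classical.decEq (Fin N → ℝ)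
  C.image bpsk

/-- BPSK image of RM(r,m). -/
def bpskRM (r m : ℕ) : Finset (Fin (2 ^ m) → ℝ) := bpskImage (RMcode r m)

/-- Uniform probability measure on a finite set. -/
def uniformOnFinset {α : Type*} [MeasurableSpace α] (s : Finset α) : Measure α :=
  (s.card : ENNReal)⁻¹ • ∑ x ∈ s, Measure.dirac x

/-- `ρ(m) = (6 ln m + 34)/(5 √m)`. -/
def rho (m : ℕ) : ℝ := (6 * Real.log m + 34) / (5 * Real.sqrt m)

/-- Inverse of the binary entropy function restricted to `[0, 1/2]`. -/
def hbInv (u : ℝ) : ℝ := sSup {p : ℝ | p ∈ Set.Icc (0 : ℝ) (1 / 2) ∧ hb p ≤ u}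

/-- `ψ(u) = 1 - (1 - 2 h_b^{-1}(u))²`. -/
def psi (u : ℝ) : ℝ := 1 - (1 - 2 * hbInv u) ^ 2

/-- `Ψ(u) = ∫₀^u ψ(v) dv`. -/
def PsiInt (u : ℝ) : ℝ := ∫ v in (0 : ℝ)..u, psi v

/-- The coefficients `c_k = 1/(ln 2 · 2k (2k-1))`. -/
def ck (k : ℕ) : ℝ := 1 / (Real.log 2 * (2 * k) * (2 * k - 1))

/-- The channel moments `q_k = E[(E[X_u | Y_u])^{2k}]` for uniform input. -/
def qmom (PZ : Measure ℝ) (k : ℕ) : ℝ :=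
  ∫ p, (condMean (signMeasure.prod PZ)
      (fun q : ℝ × ℝ => q.1) (fun q : ℝ × ℝ => q.1 * q.2) p) ^ (2 * k) ∂(signMeasure.prod PZ)

end



lemma hb_eq_binEntropy (p : ℝ) : hb p = Real.binEntropy p / Real.log 2 := by
  unfold hb Real.binEntropy Real.logb
  rw [Real.log_inv, Real.log_inv]
  ring

lemma hb_strictMonoOn' : StrictMonoOn hb (Set.Icc 0 (1 / 2)) := by
  intro a ha b hb' hab
  rw [hb_eq_binEntropy, hb_eq_binEntropy]
  have h2 : (0:ℝ) < Real.log 2 := Real.log_pos (by norm_num)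
  have := Real.binEntropy_strictMonoOn (a := a) (b := b) (by simpa using ha) (by simpa using hb') hab
  gcongr

lemma two_mul_le_hb {p : ℝ} (h0 : 0 ≤ p) (h1 : p ≤ 1 / 2) : 2 * p ≤ hb p := by
  rw [hb_eq_binEntropy]
  have h2 : (0:ℝ) < Real.log 2 := Real.log_pos (by norm_num)
  rw [le_div_iff₀ h2]
  have hc0 := Real.strictConcave_binEntropy.concaveOn.2
  have hc := hc0 (x := 0) (by norm_num) (y := 2⁻¹) (by norm_num)
    (a := 1 - 2 * p) (b := 2 * p) (by linarith) (by linarith) (by ring)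
  simp only [smul_eq_mul, Real.binEntropy_zero, Real.binEntropy_two_inv, mul_zero, zero_add] at hc
  have : 2 * p * 2⁻¹ = p := by ring
  rw [this] at hc
  exact hc

lemma hb_continuous : Continuous hb := by
  have : hb = fun p => Real.binEntropy p / Real.log 2 := funext hb_eq_binEntropy
  rw [this]
  fun_prop

lemma hb_one_sub (p : ℝ) : hb (1 - p) = hb p := by
  rw [hb_eq_binEntropy, hb_eq_binEntropy, Real.binEntropy_one_sub]

lemma hbInv_bdd (u : ℝ) : BddAbove {p : ℝ | p ∈ Set.Icc (0 : ℝ) (1 / 2) ∧ hb p ≤ u} :=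
  ⟨1 / 2, fun _ hp => hp.1.2⟩

lemma hbInv_nonneg (u : ℝ) : 0 ≤ hbInv u := Real.sSup_nonneg fun _ hp => hp.1.1

lemma hbInv_le_half (u : ℝ) : hbInv u ≤ 1 / 2 :=
  Real.sSup_le (fun _ hp => hp.1.2) (by norm_num)

lemma hbInv_mono : Monotone hbInv := by
  intro u v huv
  refine Real.sSup_le (fun p hp => ?_) (hbInv_nonneg v)
  exact le_csSup (hbInv_bdd v) ⟨hp.1, hp.2.trans huv⟩

lemma hbInv_le_div {u : ℝ} (hu : 0 ≤ u) : hbInv u ≤ u / 2 := by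
  refine Real.sSup_le (fun p hp => ?_) (by linarith)
  have := two_mul_le_hb hp.1.1 hp.1.2
  linarith [hp.2]

lemma hbInv_pos {u : ℝ} (hu : 0 < u) : 0 < hbInv u := by
  have h0 : hb 0 = 0 := by simp [hb_eq_binEntropy]
  have hev : ∀ᶠ p in nhds (0:ℝ), hb p < u :=
    hb_continuous.continuousAt.eventually (by rw [h0]; exact eventually_lt_nhds hu)
  obtain ⟨e, he, h⟩ := Metric.eventually_nhds_iff.1 hev
  have hp : 0 < min (e / 2) (1 / 2) := by positivity
  have hpe : min (e / 2) (1 / 2) < e := (min_le_left _ _).trans_lt (by linarith)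
  refine hp.trans_le (le_csSup (hbInv_bdd u) ⟨⟨hp.le, min_le_right _ _⟩, (h ?_).le⟩)
  rw [Real.dist_eq, sub_zero, abs_of_pos hp]
  exact hpe

lemma hbInv_le_of_hb {u q : ℝ} (h0 : 0 ≤ q) (h1 : q ≤ 1) (h : u ≤ hb ((1 + q) / 2)) :
    hbInv u ≤ (1 - q) / 2 := by
  refine Real.sSup_le (fun p hp => ?_) (by linarith)
  by_contra! hlt
  have := hb_strictMonoOn' (a := (1 - q) / 2) ⟨by linarith, by linarith⟩ hp.1 hlt
  have e : hb ((1 - q) / 2) = hb ((1 + q) / 2) := by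
    rw [← hb_one_sub]; congr 1; ring
  linarith [hp.2]

lemma psi_eq (u : ℝ) : psi u = 4 * hbInv u * (1 - hbInv u) := by unfold psi; ring

lemma psi_nonneg (u : ℝ) : 0 ≤ psi u := by
  rw [psi_eq]
  have := hbInv_nonneg u
  have := hbInv_le_half u
  have : 0 ≤ 1 - hbInv u := by linarith
  positivity

lemma psi_le_four (u : ℝ) : psi u ≤ 4 * hbInv u := by
  rw [psi_eq]
  nlinarith [hbInv_nonneg u]

lemma psi_mono : Monotone psi := by
  intro u v h
  have := hbInv_mono h
  rw [psi_eq, psi_eq]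
  nlinarith [hbInv_nonneg u, hbInv_le_half v, hbInv_le_half u]

lemma psi_pos {u : ℝ} (hu : 0 < u) : 0 < psi u := by
  rw [psi_eq]
  have := hbInv_pos hu
  have := hbInv_le_half u
  have : 0 < 1 - hbInv u := by linarith
  positivity

lemma psi_le_two_mul {u : ℝ} (hu : 0 ≤ u) : psi u ≤ 2 * u := by
  linarith [psi_le_four u, hbInv_le_div hu]

lemma psi_le_of_hb {u q : ℝ} (h0 : 0 ≤ q) (h1 : q ≤ 1) (h : u ≤ hb ((1 + q) / 2)) :
    psi u ≤ 2 * (1 - q) := by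
  linarith [psi_le_four u, hbInv_le_of_hb h0 h1 h]

lemma psi_intervalIntegrable (a b : ℝ) : IntervalIntegrable psi volume a b :=
  psi_mono.intervalIntegrable

lemma PsiInt_pos {u : ℝ} (hu : 0 < u) : 0 < PsiInt u := by
  unfold PsiInt
  rw [← intervalIntegral.integral_add_adjacent_intervals (psi_intervalIntegrable 0 (u/2))
    (psi_intervalIntegrable (u/2) u)]
  have h1 : 0 ≤ ∫ v in (0:ℝ)..(u/2), psi v :=
    intervalIntegral.integral_nonneg (by linarith) fun v _ => psi_nonneg v
  have h2 : ∫ v in (u/2)..u, psi (u/2) ≤ ∫ v in (u/2)..u, psi v :=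
    intervalIntegral.integral_mono_on (by linarith) (by simp) (psi_intervalIntegrable _ _)
      fun v hv => psi_mono hv.1
  rw [intervalIntegral.integral_const, smul_eq_mul] at h2
  have := psi_pos (u := u / 2) (by linarith)
  have : 0 < (u - u / 2) * psi (u / 2) := mul_pos (by linarith) this
  linarith

lemma sum_choose_succ (r m : ℕ) :
    ∑ i ∈ Finset.range (r + 1), (m + 1).choose i + m.choose r
      = 2 * ∑ i ∈ Finset.range (r + 1), m.choose i := by
  induction r with
  | zero => simp
  | succ r ih =>
    rw [Finset.sum_range_succ, Finset.sum_range_succ (n := r + 1) (f := fun i => m.choose i),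
      Nat.choose_succ_succ]
    simp only [Nat.succ_eq_add_one]
    omega

lemma RMrate_sub (r m : ℕ) :
    RMrate r m - RMrate r (m + 1) = (m.choose r : ℝ) / 2 ^ (m + 1) := by
  have h := sum_choose_succ r m
  have h' : (∑ i ∈ Finset.range (r + 1), ((m + 1).choose i : ℝ)) + (m.choose r : ℝ)
      = 2 * ∑ i ∈ Finset.range (r + 1), (m.choose i : ℝ) := by exact_mod_cast h
  unfold RMrate
  rw [pow_succ]
  have : (2:ℝ) ^ m ≠ 0 := by positivity
  field_simp
  linarith

lemma centralBinom_sq_le (n : ℕ) : (3 * n + 1) * n.centralBinom ^ 2 ≤ 16 ^ n := by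
  induction n with
  | zero => simp
  | succ n ih =>
    have h := Nat.succ_mul_centralBinom_succ n
    have key : (n + 1) ^ 2 * ((3 * (n + 1) + 1) * (n + 1).centralBinom ^ 2)
        ≤ (n + 1) ^ 2 * 16 ^ (n + 1) := by
      calc (n + 1) ^ 2 * ((3 * (n + 1) + 1) * (n + 1).centralBinom ^ 2)
          = (3 * n + 4) * ((n + 1) * (n + 1).centralBinom) ^ 2 := by ring
        _ = (3 * n + 4) * (2 * (2 * n + 1) * n.centralBinom) ^ 2 := by rw [h]
        _ = (4 * (3 * n + 4) * (2 * n + 1) ^ 2) * n.centralBinom ^ 2 := by ring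
        _ ≤ (16 * (n + 1) ^ 2 * (3 * n + 1)) * n.centralBinom ^ 2 := by
            apply Nat.mul_le_mul_right
            nlinarith
        _ = 16 * (n + 1) ^ 2 * ((3 * n + 1) * n.centralBinom ^ 2) := by ring
        _ ≤ 16 * (n + 1) ^ 2 * 16 ^ n := by gcongr
        _ = _ := by ring
    exact Nat.le_of_mul_le_mul_left key (by positivity)

lemma choose_sq_le (m r : ℕ) : 3 * m * (m.choose r) ^ 2 ≤ 2 * 4 ^ m := by
  obtain ⟨n, rfl | rfl⟩ := Nat.even_or_odd' m
  · have h := Nat.choose_le_centralBinom r n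
    have h2 := centralBinom_sq_le n
    calc 3 * (2 * n) * ((2 * n).choose r) ^ 2 ≤ 2 * ((3 * n + 1) * n.centralBinom ^ 2) := by
          have : ((2 * n).choose r) ^ 2 ≤ n.centralBinom ^ 2 := by gcongr
          nlinarith
      _ ≤ 2 * 16 ^ n := by gcongr
      _ = 2 * 4 ^ (2 * n) := by rw [pow_mul]; norm_num
  · have h := Nat.choose_le_middle r (2 * n + 1)
    have e : (2 * n + 1) / 2 = n := by omega
    rw [e] at h
    have h3 : 2 * (2 * n + 1).choose n = (n + 1).centralBinom := by
      rw [Nat.centralBinom_eq_two_mul_choose, show 2 * (n + 1) = (2 * n + 1) + 1 by ring,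
        Nat.choose_succ_succ]
      have : (2 * n + 1).choose (n + 1) = (2 * n + 1).choose n := by
        rw [← Nat.choose_symm_of_eq_add]; omega
      simp only [Nat.succ_eq_add_one]
      omega
    have h2 := centralBinom_sq_le (n + 1)
    rw [← h3] at h2
    have h4 : ((2 * n + 1).choose r) ^ 2 ≤ ((2 * n + 1).choose n) ^ 2 := by gcongr
    have h5 : (4:ℕ) ^ (2 * n + 1) * 4 = 16 ^ (n + 1) := by
      rw [← pow_succ, show 2 * n + 1 + 1 = 2 * (n + 1) by ring, pow_mul]; norm_num
    nlinarith

lemma RMrate_sub_le (r : ℕ) {m j : ℕ} (hm : 1 ≤ m) (hj : m ≤ j) :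
    RMrate r j - RMrate r (j + 1) ≤ 5 / (12 * Real.sqrt m) := by
  rw [RMrate_sub]
  have hm' : (0:ℝ) < m := by exact_mod_cast hm
  have hs : 0 < Real.sqrt m := Real.sqrt_pos.2 hm'
  have hss : Real.sqrt m ^ 2 = m := Real.sq_sqrt hm'.le
  rw [div_le_div_iff₀ (by positivity) (by positivity)]
  apply le_of_sq_le_sq _ (by positivity)
  have h := choose_sq_le j r
  have h' : 3 * (j:ℝ) * (j.choose r : ℝ) ^ 2 ≤ 2 * 4 ^ j := by exact_mod_cast h
  have hjm : (m:ℝ) ≤ j := by exact_mod_cast hj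
  have h4 : ((2:ℝ) ^ (j + 1)) ^ 2 = 4 * 4 ^ j := by
    rw [← pow_mul, mul_comm, pow_mul, pow_succ]; norm_num; ring
  have h6 : (m:ℝ) * (j.choose r : ℝ) ^ 2 ≤ (j:ℝ) * (j.choose r : ℝ) ^ 2 := by gcongr
  rw [mul_pow, mul_pow, mul_pow, hss, h4]
  have : (0:ℝ) < 4 ^ j := by positivity
  nlinarith
where
  le_of_sq_le_sq {a b : ℝ} (h : a ^ 2 ≤ b ^ 2) (hb : 0 ≤ b) : a ≤ b := by
    exact abs_le_of_sq_le_sq' h hb |>.2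

lemma RMrate_tendsto (r : ℕ) : Filter.Tendsto (RMrate r) Filter.atTop (nhds 0) := by
  have : ∀ i, Filter.Tendsto (fun m : ℕ => (m.choose i : ℝ) / 2 ^ m) Filter.atTop (nhds 0) := by
    intro i
    refine squeeze_zero (fun m => by positivity) (fun m => ?_)
      (tendsto_pow_const_div_const_pow_of_one_lt i (one_lt_two))
    gcongr
    exact_mod_cast Nat.choose_le_pow m i
  have h := tendsto_finsetSum (Finset.range (r + 1)) fun i _ => this i
  simp only [Finset.sum_const_zero] at h
  refine h.congr fun m => ?_
  rw [RMrate, Finset.mul_sum]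
  exact Finset.sum_congr rfl fun i _ => by rw [div_eq_inv_mul]

lemma final_assembly (C : ℝ) (hC0 : 0 < C) (hC1 : C < 1) (r m : ℕ) (hm : 1 ≤ m) (q : ℕ → ℝ)
    (hq0 : ∀ j ≥ m, 0 ≤ q j) (hq1 : ∀ j ≥ m, q j ≤ 1)
    (step : ∀ j ≥ m, q j * (1 - q j) ≤ 4 * (q (j + 1) - q j))
    (ent : ∀ j ≥ m, psi (RMrate r j - C) ≤ 2 * (1 - q j))
    (hrate : C < RMrate r m) :
    q m ≤ (1 - C) * rho m / (psi (1 - C) * PsiInt (RMrate r m - C)) := by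
  have hm' : (0:ℝ) < m := by exact_mod_cast hm
  have hs : 0 < Real.sqrt m := Real.sqrt_pos.2 hm'
  set δ : ℝ := 5 / (12 * Real.sqrt m) with hδ
  have hδ0 : 0 < δ := by positivity
  have hΨ : 0 < PsiInt (RMrate r m - C) := PsiInt_pos (by linarith)
  have hψ : 0 < psi (1 - C) := psi_pos (by linarith)
  have hmono : ∀ j ≥ m, q m ≤ q j := by
    intro j hj
    induction j, hj using Nat.le_induction with
    | base => rfl
    | succ j hj ih =>
      have := step j hj
      have : 0 ≤ q j * (1 - q j) := mul_nonneg (hq0 j hj) (by linarith [hq1 j hj])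
      linarith
  -- telescoped inequality
  have tele : ∀ j ≥ m, q m * ∫ v in (RMrate r j - C)..(RMrate r m - C), psi v
      ≤ 8 * δ * (q j - q m) := by
    intro j hj
    induction j, hj using Nat.le_induction with
    | base => simp
    | succ j hj ih =>
      rw [← intervalIntegral.integral_add_adjacent_intervals
        (psi_intervalIntegrable (RMrate r (j+1) - C) (RMrate r j - C))
        (psi_intervalIntegrable (RMrate r j - C) (RMrate r m - C))]
      have hle : RMrate r (j + 1) ≤ RMrate r j := by
        have : 0 ≤ RMrate r j - RMrate r (j + 1) := by rw [RMrate_sub]; positivity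
        linarith
      have h1 : ∫ v in (RMrate r (j+1) - C)..(RMrate r j - C), psi v
          ≤ ∫ v in (RMrate r (j+1) - C)..(RMrate r j - C), psi (RMrate r j - C) :=
        intervalIntegral.integral_mono_on (by linarith) (psi_intervalIntegrable _ _) (by simp)
          fun v hv => psi_mono hv.2
      rw [intervalIntegral.integral_const, smul_eq_mul] at h1
      have h2 := RMrate_sub_le r hm hj
      rw [← hδ] at h2
      have h3 : (RMrate r j - C - (RMrate r (j+1) - C)) * psi (RMrate r j - C)
          ≤ δ * (2 * (1 - q j)) := by
        apply mul_le_mul (by linarith) (ent j hj) (psi_nonneg _) hδ0.le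
      have h4 : q m * ∫ v in (RMrate r (j+1) - C)..(RMrate r j - C), psi v
          ≤ q j * (δ * (2 * (1 - q j))) := by
        apply mul_le_mul (hmono j hj) (h1.trans h3) _ (hq0 j hj)
        exact intervalIntegral.integral_nonneg (by linarith) fun v _ => psi_nonneg v
      have h5 := mul_le_mul_of_nonneg_left (step j hj) hδ0.le
      rw [mul_add]
      nlinarith
  obtain ⟨K, hKm, hK⟩ : ∃ K ≥ m, RMrate r K ≤ C := by
    have h := (RMrate_tendsto r).eventually (eventually_lt_nhds hC0)
    obtain ⟨K, hK⟩ := (h.and (Filter.eventually_ge_atTop m)).exists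
    exact ⟨K, hK.2, hK.1.le⟩
  have hfin : q m * PsiInt (RMrate r m - C) ≤ 8 * δ := by
    have h1 := tele K hKm
    have h2 : PsiInt (RMrate r m - C) ≤ ∫ v in (RMrate r K - C)..(RMrate r m - C), psi v := by
      rw [← intervalIntegral.integral_add_adjacent_intervals
        (psi_intervalIntegrable (RMrate r K - C) 0)
        (psi_intervalIntegrable 0 (RMrate r m - C))]
      have : 0 ≤ ∫ v in (RMrate r K - C)..0, psi v :=
        intervalIntegral.integral_nonneg (by linarith) fun v _ => psi_nonneg v
      unfold PsiInt
      linarith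
    have h3 := mul_le_mul_of_nonneg_left h2 (hq0 m le_rfl)
    have := hq1 K hKm
    have := hq0 m le_rfl
    nlinarith
  rw [le_div_iff₀ (by positivity)]
  have h6 : psi (1 - C) ≤ 2 * (1 - C) := psi_le_two_mul (by linarith)
  have hrho : 16 * δ ≤ rho m := by
    have hl : 0 ≤ Real.log m := Real.log_natCast_nonneg m
    rw [hδ, rho, mul_div_assoc', div_le_div_iff₀ (by positivity) (by positivity)]
    nlinarith [mul_nonneg hl hs.le]
  calc q m * (psi (1 - C) * PsiInt (RMrate r m - C))
      = psi (1 - C) * (q m * PsiInt (RMrate r m - C)) := by ring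
    _ ≤ (2 * (1 - C)) * (8 * δ) := by
        apply mul_le_mul h6 hfin (mul_nonneg (hq0 m le_rfl) hΨ.le) (by linarith)
    _ = (1 - C) * (16 * δ) := by ring
    _ ≤ (1 - C) * rho m := by
        apply mul_le_mul_of_nonneg_left hrho (by linarith)


section RMcomb

/-- The vector of binary digits of an index. -/
def bitv {m : ℕ} (i : Fin (2 ^ m)) : Fin m → ZMod 2 :=
  fun j => ((((i : ℕ) / 2 ^ (j : ℕ)) % 2 : ℕ) : ZMod 2)

lemma bitv_injective {m : ℕ} : Function.Injective (bitv (m := m)) := by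
  intro i i' h
  apply (finFunctionFinEquiv (m := 2) (n := m)).symm.injective
  funext j
  have hj := congrArg ZMod.val (congrFun h j)
  simp only [bitv, ZMod.val_natCast, Nat.mod_mod] at hj
  apply Fin.ext
  simpa [finFunctionFinEquiv] using hj

lemma bitv_bijective {m : ℕ} : Function.Bijective (bitv (m := m)) := by
  rw [Fintype.bijective_iff_injective_and_card]
  exact ⟨bitv_injective, by simp⟩

/-- Index set identified with the points of `𝔽₂^m`. -/
noncomputable def bitE (m : ℕ) : Fin (2 ^ m) ≃ (Fin m → ZMod 2) :=
  Equiv.ofBijective bitv bitv_bijective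

lemma bitE_apply {m : ℕ} (i : Fin (2 ^ m)) : bitE m i = bitv i := rfl

/-- Monomial functions. -/
def mono {m : ℕ} (S : Finset (Fin m)) : (Fin m → ZMod 2) → ZMod 2 := fun v => ∏ j ∈ S, v j

/-- Polynomial functions of degree at most `r`. -/
def Dpoly (r m : ℕ) : Submodule (ZMod 2) ((Fin m → ZMod 2) → ZMod 2) :=
  Submodule.span (ZMod 2) (mono '' {S | S.card ≤ r})

lemma mono_mem {r m : ℕ} {S : Finset (Fin m)} (h : S.card ≤ r) : mono S ∈ Dpoly r m :=
  Submodule.subset_span ⟨S, h, rfl⟩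

lemma Dpoly_le {r s m : ℕ} (h : r ≤ s) : Dpoly r m ≤ Dpoly s m :=
  Submodule.span_mono (Set.image_mono fun _ hS => le_trans hS h)

lemma zmod2_mul_self (x : ZMod 2) : x * x = x := by revert x; decide

lemma mono_mul {m : ℕ} (S T : Finset (Fin m)) : mono S * mono T = mono (S ∪ T) := by
  funext v
  simp only [mono, Pi.mul_apply]
  rw [← Finset.prod_union_inter, ← Finset.sdiff_union_inter (S ∪ T) (S ∩ T),
    Finset.prod_union (Finset.disjoint_sdiff_inter _ _)]
  have : (S ∪ T) ∩ (S ∩ T) = S ∩ T := by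
    ext; simp; tauto
  rw [this, mul_assoc, zmod2_mul_self]

lemma Dpoly_mul {r s m : ℕ} {f g : (Fin m → ZMod 2) → ZMod 2} (hf : f ∈ Dpoly r m)
    (hg : g ∈ Dpoly s m) : f * g ∈ Dpoly (r + s) m := by
  have h : Dpoly r m * Dpoly s m ≤ Dpoly (r + s) m := by
    unfold Dpoly
    rw [Submodule.span_mul_span, Submodule.span_le]
    rintro _ ⟨_, ⟨S, hS, rfl⟩, _, ⟨T, hT, rfl⟩, rfl⟩
    simp only [mono_mul]
    exact mono_mem ((Finset.card_union_le _ _).trans (Nat.add_le_add hS hT))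
  exact h (Submodule.mul_mem_mul hf hg)

lemma one_mem_Dpoly (r m : ℕ) : (1 : (Fin m → ZMod 2) → ZMod 2) ∈ Dpoly r m := by
  have : (1 : (Fin m → ZMod 2) → ZMod 2) = mono ∅ := by funext v; simp [mono]
  rw [this]
  exact mono_mem (by simp)

lemma Dpoly_comp {r n m : ℕ} (L : (Fin n → ZMod 2) → (Fin m → ZMod 2))
    (hL : ∀ j, (fun v => L v j) ∈ Dpoly 1 n) {f : (Fin m → ZMod 2) → ZMod 2}
    (hf : f ∈ Dpoly r m) : f ∘ L ∈ Dpoly r n := by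
  have hmono : ∀ S : Finset (Fin m), mono S ∘ L ∈ Dpoly S.card n := by
    intro S
    induction S using Finset.induction_on with
    | empty =>
      have : mono (∅ : Finset (Fin m)) ∘ L = 1 := by funext v; simp [mono]
      rw [this]; exact one_mem_Dpoly _ _
    | insert a S ha ih =>
      have : mono (insert a S) ∘ L = (fun v => L v a) * (mono S ∘ L) := by
        funext v; simp [mono, Finset.prod_insert ha]
      rw [this, Finset.card_insert_of_notMem ha, add_comm]
      exact Dpoly_mul (hL a) ih
  unfold Dpoly at hf
  induction hf using Submodule.span_induction with
  | mem x h =>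
    obtain ⟨S, hS, rfl⟩ := h
    exact Dpoly_le hS (hmono S)
  | zero => exact Submodule.zero_mem _
  | add x y _ _ hx hy => exact Submodule.add_mem _ hx hy
  | smul a x _ hx => exact Submodule.smul_mem _ a hx

lemma RMword_eq (r m : ℕ) (α : Finset (Fin m) → ZMod 2) :
    RMword r m α = (∑ S ∈ Finset.univ.filter (fun S : Finset (Fin m) => S.card ≤ r),
      α S • mono S) ∘ bitv := by
  funext i
  simp [RMword, mono, bitv, Finset.sum_apply]

lemma mem_RMcode {r m : ℕ} {c : Fin (2 ^ m) → ZMod 2} :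
    c ∈ RMcode r m ↔ ∃ f ∈ Dpoly r m, c = f ∘ bitv := by
  unfold RMcode
  simp only [Finset.mem_image, Finset.mem_univ, true_and]
  constructor
  · rintro ⟨α, rfl⟩
    refine ⟨_, ?_, RMword_eq r m α⟩
    refine Submodule.sum_mem _ fun S hS => Submodule.smul_mem _ _ (mono_mem ?_)
    simpa using hS
  · rintro ⟨f, hf, rfl⟩
    unfold Dpoly at hf
    induction hf using Submodule.span_induction with
    | mem x h =>
      obtain ⟨S, hS, rfl⟩ := h
      refine ⟨Pi.single S 1, ?_⟩
      rw [RMword_eq]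
      congr 1
      rw [Finset.sum_eq_single S]
      · simp
      · intro b _ hb; simp [hb]
      · intro h; exact absurd (by simpa using hS) h
    | zero => exact ⟨0, by funext i; simp [RMword]⟩
    | add x y _ _ hx hy =>
      obtain ⟨a, ha⟩ := hx
      obtain ⟨b, hb⟩ := hy
      refine ⟨a + b, ?_⟩
      funext i
      have ha := congrFun ha i
      have hb := congrFun hb i
      simp only [RMword, Function.comp_apply, Pi.add_apply, add_mul, Finset.sum_add_distrib] at *
      rw [ha, hb]
    | smul t x _ hx =>
      obtain ⟨a, ha⟩ := hx
      refine ⟨t • a, ?_⟩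
      funext i
      have ha := congrFun ha i
      simp only [RMword, Function.comp_apply, Pi.smul_apply, smul_eq_mul, mul_assoc,
        ← Finset.mul_sum] at *
      rw [ha]

lemma mem_bpskRM {r m : ℕ} {x : Fin (2 ^ m) → ℝ} :
    x ∈ bpskRM r m ↔ ∃ f ∈ Dpoly r m, x = bpsk (f ∘ bitv) := by
  unfold bpskRM bpskImage
  simp only [Finset.mem_image]
  constructor
  · rintro ⟨c, hc, rfl⟩
    obtain ⟨f, hf, rfl⟩ := mem_RMcode.1 hc
    exact ⟨f, hf, rfl⟩
  · rintro ⟨f, hf, rfl⟩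
    exact ⟨_, mem_RMcode.2 ⟨f, hf, rfl⟩, rfl⟩

lemma bpsk_val (a : ZMod 2) : (-1 : ℝ) ^ a.val = 1 ∨ (-1 : ℝ) ^ a.val = -1 :=
  neg_one_pow_eq_or ℝ _

lemma neg_one_pow_val_add (a b : ZMod 2) :
    (-1 : ℝ) ^ (a + b).val = (-1 : ℝ) ^ a.val * (-1 : ℝ) ^ b.val := by
  rw [← pow_add, ZMod.val_add, ← neg_one_pow_eq_pow_mod_two]

lemma bpsk_add {N : ℕ} (c d : Fin N → ZMod 2) : bpsk (c + d) = bpsk c * bpsk d := by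
  funext i
  simp only [bpsk, Pi.add_apply, Pi.mul_apply, neg_one_pow_val_add]

lemma zmod2_cases (x : ZMod 2) : x = 0 ∨ x = 1 := by revert x; decide

lemma bpsk_injective {N : ℕ} : Function.Injective (bpsk (N := N)) := by
  intro c d h
  funext i
  have := congrFun h i
  simp only [bpsk] at this
  generalize c i = a at *
  generalize d i = b at *
  rcases zmod2_cases a with rfl | rfl <;> rcases zmod2_cases b with rfl | rfl
  · rfl
  · simp [ZMod.val_one] at this; norm_num at this
  · simp [ZMod.val_one] at this; norm_num at this
  · rfl

lemma bpskRM_sign {r m : ℕ} : ∀ x ∈ bpskRM r m, ∀ i, x i = 1 ∨ x i = -1 := by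
  intro x hx i
  obtain ⟨f, _, rfl⟩ := mem_bpskRM.1 hx
  exact bpsk_val _

lemma bpskRM_nonempty (r m : ℕ) : (bpskRM r m).Nonempty :=
  ⟨_, mem_bpskRM.2 ⟨0, Submodule.zero_mem _, rfl⟩⟩

lemma bpskRM_mul {r m : ℕ} : ∀ x ∈ bpskRM r m, ∀ y ∈ bpskRM r m, x * y ∈ bpskRM r m := by
  intro x hx y hy
  obtain ⟨f, hf, rfl⟩ := mem_bpskRM.1 hx
  obtain ⟨g, hg, rfl⟩ := mem_bpskRM.1 hy
  refine mem_bpskRM.2 ⟨f + g, Submodule.add_mem _ hf hg, ?_⟩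
  rw [← bpsk_add]; rfl

lemma bpskRM_comp {r m n : ℕ} (L : (Fin n → ZMod 2) → (Fin m → ZMod 2))
    (hL : ∀ j, (fun v => L v j) ∈ Dpoly 1 n) (σ : Fin (2 ^ n) → Fin (2 ^ m))
    (hσ : ∀ i, bitv (σ i) = L (bitv i)) {x : Fin (2 ^ m) → ℝ} (hx : x ∈ bpskRM r m) :
    x ∘ σ ∈ bpskRM r n := by
  obtain ⟨f, hf, rfl⟩ := mem_bpskRM.1 hx
  refine mem_bpskRM.2 ⟨f ∘ L, Dpoly_comp L hL hf, ?_⟩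
  funext i
  simp only [bpsk, Function.comp_apply, hσ]

lemma coord_mem {n : ℕ} (k : Fin n) : (fun v : Fin n → ZMod 2 => v k) ∈ Dpoly 1 n := by
  have : (fun v : Fin n → ZMod 2 => v k) = mono {k} := by funext v; simp [mono]
  rw [this]; exact mono_mem (by simp)

lemma const_mem {n : ℕ} (r : ℕ) (c : ZMod 2) : (fun _ : Fin n → ZMod 2 => c) ∈ Dpoly r n := by
  have : (fun _ : Fin n → ZMod 2 => c) = c • (1 : (Fin n → ZMod 2) → ZMod 2) := by
    funext v; simp
  rw [this]; exact Submodule.smul_mem _ _ (one_mem_Dpoly _ _)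

/-- Translation of the index set. -/
noncomputable def transl (m : ℕ) (w : Fin m → ZMod 2) : Fin (2 ^ m) ≃ Fin (2 ^ m) :=
  (bitE m).trans ((Equiv.addRight w).trans (bitE m).symm)

lemma bitv_transl {m : ℕ} (w : Fin m → ZMod 2) (i : Fin (2 ^ m)) :
    bitv (transl m w i) = bitv i + w := by
  rw [← bitE_apply]; simp [transl, bitE_apply]

lemma bpskRM_transl {r m : ℕ} (w : Fin m → ZMod 2) {x : Fin (2 ^ m) → ℝ} (hx : x ∈ bpskRM r m) :
    x ∘ transl m w ∈ bpskRM r m :=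
  bpskRM_comp (fun v => v + w) (fun j => Submodule.add_mem _ (coord_mem j) (const_mem 1 (w j)))
    _ (bitv_transl w) hx

lemma bpskRM_transl_symm {r m : ℕ} (w : Fin m → ZMod 2) {x : Fin (2 ^ m) → ℝ}
    (hx : x ∈ bpskRM r m) : x ∘ (transl m w).symm ∈ bpskRM r m := by
  have : ∀ i, (transl m w).symm i = transl m (-w) i := by
    intro i
    rw [Equiv.symm_apply_eq]
    apply bitv_injective
    rw [bitv_transl, bitv_transl]; simp
  have e : x ∘ (transl m w).symm = x ∘ transl m (-w) := by funext i; simp [this]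
  rw [e]
  exact bpskRM_transl _ hx

/-- Embedding of `𝔽₂^m` in `𝔽₂^(m+1)` as the graph of a function. -/
noncomputable def emb (m : ℕ) (g : (Fin m → ZMod 2) → ZMod 2) (i : Fin (2 ^ m)) :
    Fin (2 ^ (m + 1)) :=
  (bitE (m + 1)).symm (Fin.snoc (α := fun _ => ZMod 2) (bitv i) (g (bitv i)))

lemma bitv_emb {m : ℕ} (g : (Fin m → ZMod 2) → ZMod 2) (i : Fin (2 ^ m)) :
    bitv (emb m g i) = Fin.snoc (α := fun _ => ZMod 2) (bitv i) (g (bitv i)) := by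
  rw [← bitE_apply]; simp [emb]

lemma bpskRM_emb {r m : ℕ} {g : (Fin m → ZMod 2) → ZMod 2} (hg : g ∈ Dpoly 1 m)
    {x : Fin (2 ^ (m + 1)) → ℝ} (hx : x ∈ bpskRM r (m + 1)) : x ∘ emb m g ∈ bpskRM r m := by
  refine bpskRM_comp (fun v => Fin.snoc (α := fun _ => ZMod 2) v (g v)) (fun j => ?_)
    _ (bitv_emb g) hx
  induction j using Fin.lastCases with
  | last => simpa using hg
  | cast k => simpa using coord_mem k

lemma emb_apply_eq {m : ℕ} (g h : (Fin m → ZMod 2) → ZMod 2) (i : Fin (2 ^ m))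
    (e : g (bitv i) = h (bitv i)) : emb m g i = emb m h i := by
  unfold emb; rw [e]

lemma emb_sum_bijective (m : ℕ) :
    Function.Bijective (Sum.elim (emb m 0) (emb m 1) :
      Fin (2 ^ m) ⊕ Fin (2 ^ m) → Fin (2 ^ (m + 1))) := by
  rw [Fintype.bijective_iff_injective_and_card]
  refine ⟨?_, by simp [pow_succ]; ring⟩
  have key : ∀ (g h : (Fin m → ZMod 2) → ZMod 2) (i j : Fin (2 ^ m)), emb m g i = emb m h j →
      i = j ∧ g (bitv i) = h (bitv j) := by
    intro g h i j e
    have e' := congrArg bitv e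
    rw [bitv_emb, bitv_emb, Fin.snoc_inj] at e'
    exact ⟨bitv_injective e'.1, e'.2⟩
  rintro (i | i) (j | j) e
  · exact congrArg _ (key _ _ _ _ e).1
  · have := (key _ _ _ _ e).2; simp at this
  · have := (key _ _ _ _ e).2; simp at this
  · exact congrArg _ (key _ _ _ _ e).1

/-- The origin. -/
noncomputable def orig (m : ℕ) : Fin (2 ^ m) := (bitE m).symm 0

lemma bitv_orig (m : ℕ) : bitv (orig m) = 0 := by
  rw [← bitE_apply]; simp [orig]

lemma emb_orig {m : ℕ} {g : (Fin m → ZMod 2) → ZMod 2} (hg : g 0 = 0) :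
    emb m g (orig m) = orig (m + 1) := by
  apply bitv_injective
  rw [bitv_emb, bitv_orig, bitv_orig, hg]
  funext j
  induction j using Fin.lastCases with
  | last => simp
  | cast k => simp

/-- Linear functional. -/
def lin {m : ℕ} (a : Fin m → ZMod 2) : (Fin m → ZMod 2) → ZMod 2 := fun v => ∑ k, a k * v k

lemma lin_mem {m : ℕ} (a : Fin m → ZMod 2) : lin a ∈ Dpoly 1 m := by
  have : lin a = ∑ k, a k • (fun v : Fin m → ZMod 2 => v k) := by
    funext v; simp [lin, Finset.sum_apply]
  rw [this]
  exact Submodule.sum_mem _ fun k _ => Submodule.smul_mem _ _ (coord_mem k)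

lemma card_lin_zero {m : ℕ} {v : Fin m → ZMod 2} (hv : v ≠ 0) :
    2 * (Finset.univ.filter (fun a : Fin m → ZMod 2 => lin a v = 0)).card = 2 ^ m := by
  obtain ⟨k, hk⟩ : ∃ k, v k ≠ 0 := by
    by_contra! h; exact hv (funext h)
  have hk1 : v k = 1 := (zmod2_cases _).resolve_left hk
  have hadd : ∀ a, lin (a + Pi.single k 1) v = lin a v + 1 := by
    intro a
    simp only [lin, Pi.add_apply, add_mul, Finset.sum_add_distrib]
    congr 1
    rw [Finset.sum_eq_single k]
    · simp [hk1]
    · intro b _ hb; simp [hb]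
    · simp
  have h1 : (Finset.univ.filter (fun a : Fin m → ZMod 2 => lin a v = 0)).card
      = (Finset.univ.filter (fun a : Fin m → ZMod 2 => ¬ lin a v = 0)).card := by
    refine Finset.card_bij' (fun a _ => a + Pi.single k 1) (fun a _ => a + Pi.single k 1)
      ?_ ?_ ?_ ?_
    · intro a ha
      simp only [Finset.mem_filter, Finset.mem_univ, true_and] at *
      rw [hadd, ha]; decide
    · intro a ha
      simp only [Finset.mem_filter, Finset.mem_univ, true_and] at *
      rw [hadd, (zmod2_cases _).resolve_left ha]; decide
    · intro a _
      funext j; simp only [Pi.add_apply, add_assoc]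
      rw [CharTwo.add_self_eq_zero]; simp
    · intro a _
      funext j; simp only [Pi.add_apply, add_assoc]
      rw [CharTwo.add_self_eq_zero]; simp
  have h2 := Finset.card_filter_add_card_filter_not (s := Finset.univ)
    (fun a : Fin m → ZMod 2 => lin a v = 0)
  rw [← h1] at h2
  simp only [Finset.card_univ, Fintype.card_fun, ZMod.card, Fintype.card_fin] at h2
  omega

lemma mono_indicator {m : ℕ} (S T : Finset (Fin m)) :
    mono S (fun j => if j ∈ T then 1 else 0) = if S ⊆ T then 1 else 0 := by
  unfold mono
  split_ifs with h
  · exact Finset.prod_eq_one fun j hj => by simp [h hj]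
  · obtain ⟨j, hj, hjT⟩ := Finset.not_subset.1 h
    exact Finset.prod_eq_zero hj (by simp [hjT])

lemma coeff_zero {r m : ℕ} {β : Finset (Fin m) → ZMod 2} (h : RMword r m β = 0) :
    ∀ S, S.card ≤ r → β S = 0 := by
  intro S
  induction S using Finset.strongInduction with
  | H S ih =>
    intro hS
    have h1 := congrFun h ((bitE m).symm (fun j => if j ∈ S then 1 else 0))
    rw [RMword_eq] at h1
    have hb : bitv ((bitE m).symm (fun j => if j ∈ S then 1 else 0))
        = fun j => if j ∈ S then 1 else 0 := by rw [← bitE_apply]; simp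
    simp only [Function.comp_apply, hb, Finset.sum_apply, Pi.smul_apply, smul_eq_mul,
      mono_indicator, Pi.zero_apply] at h1
    rw [Finset.sum_eq_single S] at h1
    · simpa using h1
    · intro T hT hTS
      by_cases hs : T ⊆ S
      · rw [ih T (Finset.ssubset_iff_subset_ne.2 ⟨hs, hTS⟩) (by simpa using hT)]; simp
      · simp [hs]
    · intro hn; exact absurd (by simpa using hS) hn

lemma card_bpskRM_eq (r m : ℕ) : (bpskRM r m).card = (RMcode r m).card := by
  unfold bpskRM bpskImage
  letI := Classical.decEq (Fin (2 ^ m) → ℝ)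
  exact Finset.card_image_of_injective _ bpsk_injective

lemma card_bpskRM_ge (r m : ℕ) :
    2 ^ (∑ i ∈ Finset.range (r + 1), m.choose i) ≤ (bpskRM r m).card := by
  classical
  rw [card_bpskRM_eq]
  let A := {S : Finset (Fin m) // S.card ≤ r}
  let e : (A → ZMod 2) → (Fin (2 ^ m) → ZMod 2) := fun α =>
    RMword r m (fun S => if h : S.card ≤ r then α ⟨S, h⟩ else 0)
  have hinj : Function.Injective e := by
    intro α α' h
    have hz : RMword r m (fun S => (if h : S.card ≤ r then α ⟨S, h⟩ else 0)
        - (if h : S.card ≤ r then α' ⟨S, h⟩ else 0)) = 0 := by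
      funext i
      have := congrFun h i
      simp only [e, RMword] at this
      simp only [RMword, sub_mul, Finset.sum_sub_distrib, Pi.zero_apply]
      rw [this, sub_self]
    funext ⟨S, hS⟩
    have := coeff_zero hz S hS
    simp only [hS, dif_pos] at this
    exact sub_eq_zero.1 this
  have hcard : Fintype.card A = ∑ i ∈ Finset.range (r + 1), m.choose i := by
    rw [Fintype.card_subtype]
    have : Finset.univ.filter (fun S : Finset (Fin m) => S.card ≤ r)
        = (Finset.range (r + 1)).biUnion fun i => Finset.powersetCard i Finset.univ := by
      ext S; simp [Finset.mem_powersetCard, Nat.lt_succ_iff]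
    rw [this, Finset.card_biUnion]
    · simp
    · intro i _ j _ hij
      exact Finset.pairwise_disjoint_powersetCard _ hij
  calc 2 ^ (∑ i ∈ Finset.range (r + 1), m.choose i) = Fintype.card (A → ZMod 2) := by
        rw [Fintype.card_fun, hcard, ZMod.card]
    _ = (Finset.univ.image e).card := by
        rw [Finset.card_image_of_injective _ hinj, Finset.card_univ]
    _ ≤ (RMcode r m).card := by
        apply Finset.card_le_card
        intro c hc
        obtain ⟨α, _, rfl⟩ := Finset.mem_image.1 hc
        exact Finset.mem_image.2 ⟨_, Finset.mem_univ _, rfl⟩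

end RMcomb


section Shearer

/-- Bounded measurable functions. -/
def BM {α : Type*} [MeasurableSpace α] (F : α → ℝ) : Prop :=
  Measurable F ∧ ∃ C, ∀ z, |F z| ≤ C

lemma BM.integrable {α : Type*} [MeasurableSpace α] {F : α → ℝ} (h : BM F) (μ : Measure α)
    [IsFiniteMeasure μ] : Integrable F μ := by
  obtain ⟨C, hC⟩ := h.2
  exact Integrable.of_bound h.1.aestronglyMeasurable C (Filter.Eventually.of_forall hC)

lemma BM.add {α : Type*} [MeasurableSpace α] {F G : α → ℝ} (h : BM F) (h' : BM G) :
    BM (fun z => F z + G z) := by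
  obtain ⟨C, hC⟩ := h.2
  obtain ⟨D, hD⟩ := h'.2
  exact ⟨h.1.add h'.1, C + D, fun z => (abs_add_le _ _).trans (add_le_add (hC z) (hD z))⟩

lemma BM.neg {α : Type*} [MeasurableSpace α] {F : α → ℝ} (h : BM F) :
    BM (fun z => -F z) := by
  obtain ⟨C, hC⟩ := h.2
  exact ⟨h.1.neg, C, fun z => by simpa using hC z⟩

lemma BM.sub {α : Type*} [MeasurableSpace α] {F G : α → ℝ} (h : BM F) (h' : BM G) :
    BM (fun z => F z - G z) := by
  simpa [sub_eq_add_neg] using h.add h'.neg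

lemma BM.mul {α : Type*} [MeasurableSpace α] {F G : α → ℝ} (h : BM F) (h' : BM G) :
    BM (fun z => F z * G z) := by
  obtain ⟨C, hC⟩ := h.2
  obtain ⟨D, hD⟩ := h'.2
  refine ⟨h.1.mul h'.1, C * D, fun z => ?_⟩
  rw [abs_mul]
  exact mul_le_mul (hC z) (hD z) (abs_nonneg _) ((abs_nonneg _).trans (hC z))

lemma BM.comp {α β : Type*} [MeasurableSpace α] [MeasurableSpace β] {F : α → ℝ} (h : BM F)
    {g : β → α} (hg : Measurable g) : BM (fun z => F (g z)) := by
  obtain ⟨C, hC⟩ := h.2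
  exact ⟨h.1.comp hg, C, fun z => hC _⟩

lemma BM.const {α : Type*} [MeasurableSpace α] (c : ℝ) : BM (fun _ : α => c) :=
  ⟨measurable_const, |c|, fun _ => le_rfl⟩

lemma BM.sq {α : Type*} [MeasurableSpace α] {F : α → ℝ} (h : BM F) :
    BM (fun z => F z ^ 2) := by
  simpa [pow_two] using h.mul h

variable {ι : Type*} [Fintype ι] [DecidableEq ι] (P : Measure ℝ) [IsProbabilityMeasure P]

/-- Exchange of the coordinates in `s` between two vectors. -/
def exch (s : Finset ι) (p : (ι → ℝ) × (ι → ℝ)) : (ι → ℝ) × (ι → ℝ) :=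
  (s.piecewise p.2 p.1, s.piecewise p.1 p.2)

lemma exch_mp (s : Finset ι) : MeasurePreserving (exch s)
    ((Measure.pi fun _ : ι => P).prod (Measure.pi fun _ : ι => P))
    ((Measure.pi fun _ : ι => P).prod (Measure.pi fun _ : ι => P)) := by
  have h1 := measurePreserving_arrowProdEquivProdArrow ℝ ℝ ι (fun _ => P) (fun _ => P)
  have h2 : MeasurePreserving (fun (a : ι → ℝ × ℝ) i => (if i ∈ s then Prod.swap else id) (a i))
      (Measure.pi fun _ : ι => P.prod P) (Measure.pi fun _ : ι => P.prod P) := by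
    refine measurePreserving_pi _ _ (f := fun i => if i ∈ s then Prod.swap else id) (fun i => ?_)
    by_cases hi : i ∈ s
    · simpa [hi] using Measure.measurePreserving_swap
    · simpa [hi] using MeasurePreserving.id _
  have h3 := (h1.comp h2).comp h1.symm
  convert h3 using 1
  funext p
  ext i <;> by_cases hi : i ∈ s <;>
    simp [exch, hi, MeasurableEquiv.arrowProdEquivProdArrow, Equiv.arrowProdEquivProdArrow]

lemma piecewise_mp (s : Finset ι) : MeasurePreserving
    (fun p : (ι → ℝ) × (ι → ℝ) => s.piecewise p.2 p.1)
    ((Measure.pi fun _ : ι => P).prod (Measure.pi fun _ : ι => P))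
    (Measure.pi fun _ : ι => P) :=
  (measurePreserving_fst).comp (exch_mp P s)

/-- Averaging over the coordinates in `s`. -/
noncomputable def KK (s : Finset ι) (F : (ι → ℝ) → ℝ) : (ι → ℝ) → ℝ :=
  fun z => ∫ z', F (s.piecewise z' z) ∂(Measure.pi fun _ : ι => P)

lemma measurable_pw (s : Finset ι) :
    Measurable (fun p : (ι → ℝ) × (ι → ℝ) => s.piecewise p.2 p.1) := by
  refine measurable_pi_lambda _ fun i => ?_
  by_cases hi : i ∈ s
  · simp only [hi, Finset.piecewise_eq_of_mem]; fun_prop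
  · simp only [hi, not_false_eq_true, Finset.piecewise_eq_of_notMem]; fun_prop

lemma KK_BM (s : Finset ι) {F : (ι → ℝ) → ℝ} (hF : BM F) : BM (KK P s F) := by
  constructor
  · have := (hF.comp (measurable_pw s)).1.stronglyMeasurable
    exact (this.integral_prod_right (ν := Measure.pi fun _ : ι => P)).measurable
  · obtain ⟨C, hC⟩ := hF.2
    refine ⟨C, fun z => ?_⟩
    have := norm_integral_le_of_norm_le_const (μ := Measure.pi fun _ : ι => P)
      (f := fun z' => F (s.piecewise z' z)) (C := C) (Filter.Eventually.of_forall fun z' => hC _)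
    simpa [KK] using this

lemma pw_meas_right (s : Finset ι) (z : ι → ℝ) : Measurable fun z' => s.piecewise z' z :=
  (measurable_pw s).comp (measurable_const.prodMk measurable_id)

lemma KK_sub (s : Finset ι) {F G : (ι → ℝ) → ℝ} (hF : BM F) (hG : BM G) :
    KK P s (fun z => F z - G z) = fun z => KK P s F z - KK P s G z := by
  funext z
  exact integral_sub ((hF.comp (pw_meas_right s z)).integrable _)
    ((hG.comp (pw_meas_right s z)).integrable _)

lemma KK_KK (s t : Finset ι) {F : (ι → ℝ) → ℝ} (hF : BM F) :
    KK P s (KK P t F) = KK P (s ∪ t) F := by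
  funext z
  unfold KK
  have e : ∀ z' z'' : ι → ℝ, t.piecewise z'' (s.piecewise z' z)
      = (s ∪ t).piecewise (t.piecewise z'' z') z := by
    intro z' z''
    funext i
    by_cases hs : i ∈ s <;> by_cases ht : i ∈ t <;> simp [hs, ht, Finset.piecewise]
  simp only [e]
  have hG : BM (fun y => F ((s ∪ t).piecewise y z)) := hF.comp (pw_meas_right _ z)
  rw [← (piecewise_mp P t).map_eq, integral_map (piecewise_mp P t).measurable.aemeasurable
    hG.1.aestronglyMeasurable, integral_prod]
  · rw [(piecewise_mp P t).map_eq]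
  · exact (hG.comp (measurable_pw t)).integrable _

lemma KK_adj (s : Finset ι) {F G : (ι → ℝ) → ℝ} (hF : BM F) (hG : BM G) :
    ∫ z, KK P s F z * G z ∂(Measure.pi fun _ : ι => P)
      = ∫ z, F z * KK P s G z ∂(Measure.pi fun _ : ι => P) := by
  have h1 : ∫ z, KK P s F z * G z ∂(Measure.pi fun _ : ι => P)
      = ∫ p : (ι → ℝ) × (ι → ℝ), F (s.piecewise p.2 p.1) * G p.1
        ∂((Measure.pi fun _ : ι => P).prod (Measure.pi fun _ : ι => P)) := by
    rw [integral_prod _ (((hF.comp (measurable_pw s)).mul (hG.comp measurable_fst)).integrable _)]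
    simp only [KK, integral_mul_const]
  have h2 : ∫ z, F z * KK P s G z ∂(Measure.pi fun _ : ι => P)
      = ∫ p : (ι → ℝ) × (ι → ℝ), F p.1 * G (s.piecewise p.2 p.1)
        ∂((Measure.pi fun _ : ι => P).prod (Measure.pi fun _ : ι => P)) := by
    rw [integral_prod _ (((hF.comp measurable_fst).mul (hG.comp (measurable_pw s))).integrable _)]
    simp only [KK, integral_const_mul]
  rw [h1, h2]
  have h3 : BM (fun p : (ι → ℝ) × (ι → ℝ) => F p.1 * G (s.piecewise p.2 p.1)) :=
    (hF.comp measurable_fst).mul (hG.comp (measurable_pw s))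
  conv_rhs => rw [← (exch_mp P s).map_eq, integral_map (exch_mp P s).measurable.aemeasurable
    h3.1.aestronglyMeasurable]
  congr 1
  funext p
  simp only [exch]
  congr 2
  funext i
  by_cases hs : i ∈ s <;> simp [hs]

lemma KK_sq (s : Finset ι) {F : (ι → ℝ) → ℝ} (hF : BM F) :
    ∫ z, KK P s F z ^ 2 ∂(Measure.pi fun _ : ι => P)
      = ∫ z, F z * KK P s F z ∂(Measure.pi fun _ : ι => P) := by
  simp only [pow_two]
  rw [KK_adj P s hF (KK_BM P s hF), KK_KK P s s hF, Finset.union_self]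

lemma KK_pyth (s : Finset ι) {F : (ι → ℝ) → ℝ} (hF : BM F) :
    ∫ z, F z ^ 2 ∂(Measure.pi fun _ : ι => P)
      = ∫ z, KK P s F z ^ 2 ∂(Measure.pi fun _ : ι => P)
        + ∫ z, (F z - KK P s F z) ^ 2 ∂(Measure.pi fun _ : ι => P) := by
  have hK := KK_BM P s hF
  have e : ∀ z, (F z - KK P s F z) ^ 2 = F z ^ 2 - 2 * (F z * KK P s F z) + KK P s F z ^ 2 := by
    intro z; ring
  simp only [e]
  rw [integral_add ((hF.sq.sub ((BM.const 2).mul (hF.mul hK))).integrable _) (hK.sq.integrable _),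
    integral_sub (hF.sq.integrable _) (((BM.const 2).mul (hF.mul hK)).integrable _),
    integral_const_mul, ← KK_sq P s hF]
  ring

lemma KK_contr (s : Finset ι) {F : (ι → ℝ) → ℝ} (hF : BM F) :
    ∫ z, KK P s F z ^ 2 ∂(Measure.pi fun _ : ι => P)
      ≤ ∫ z, F z ^ 2 ∂(Measure.pi fun _ : ι => P) := by
  rw [KK_pyth P s hF]
  have : 0 ≤ ∫ z, (F z - KK P s F z) ^ 2 ∂(Measure.pi fun _ : ι => P) :=
    integral_nonneg fun z => sq_nonneg _
  linarith

lemma pw_empty (F : (ι → ℝ) → ℝ) : KK P ∅ F = F := by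
  funext z; simp [KK]

lemma shearer {α : Type*} [Fintype α] (w : α → ℝ) (hw : ∀ a, 0 ≤ w a) (hw1 : ∑ a, w a = 1)
    (I : α → Finset ι) (p : ℝ) (s : Finset ι)
    (hp : ∀ j ∈ s, ∑ a, (if j ∈ I a then w a else 0) ≤ p) :
    ∀ {F : (ι → ℝ) → ℝ}, BM F →
    ∑ a, w a * ∫ z, KK P (s \ I a) F z ^ 2 ∂(Measure.pi fun _ : ι => P)
      ≤ (1 - p) * ∫ z, KK P s F z ^ 2 ∂(Measure.pi fun _ : ι => P)
        + p * ∫ z, F z ^ 2 ∂(Measure.pi fun _ : ι => P) := by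
  induction s using Finset.induction_on with
  | empty =>
    intro F hF
    simp only [Finset.empty_sdiff, pw_empty]
    rw [← Finset.sum_mul, hw1]
    linarith
  | insert j s hj ih =>
    intro F hF
    have ih' := ih (fun k hk => hp k (Finset.mem_insert_of_mem hk)) (KK_BM P {j} hF)
    have hD : BM (fun z => F z - KK P {j} F z) := hF.sub (KK_BM P {j} hF)
    have hpj := hp j (Finset.mem_insert_self _ _)
    rw [KK_KK P s {j} hF] at ih'
    have es : s ∪ {j} = insert j s := by rw [Finset.union_comm]; rfl
    rw [es] at ih'
    have hpy := KK_pyth P {j} hF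
    set nD := ∫ z, (F z - KK P {j} F z) ^ 2 ∂(Measure.pi fun _ : ι => P) with hnD
    have hnD0 : 0 ≤ nD := integral_nonneg fun z => sq_nonneg _
    have key : ∀ a, ∫ z, KK P (insert j s \ I a) F z ^ 2 ∂(Measure.pi fun _ : ι => P)
        ≤ ∫ z, KK P (s \ I a) (KK P {j} F) z ^ 2 ∂(Measure.pi fun _ : ι => P)
          + if j ∈ I a then nD else 0 := by
      intro a
      by_cases ha : j ∈ I a
      · rw [Finset.insert_sdiff_of_mem _ ha, if_pos ha, KK_pyth P {j} (KK_BM P (s \ I a) hF)]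
        rw [KK_KK P {j} _ hF, KK_KK P _ {j} hF, Finset.union_comm {j}]
        have h4 := KK_contr P (s \ I a) hD
        rw [KK_sub P _ hF (KK_BM P {j} hF), KK_KK P _ {j} hF] at h4
        linarith
      · rw [Finset.insert_sdiff_of_notMem _ ha, if_neg ha, KK_KK P _ {j} hF,
          Finset.union_comm, add_zero]
        rfl
    calc ∑ a, w a * ∫ z, KK P (insert j s \ I a) F z ^ 2 ∂(Measure.pi fun _ : ι => P)
        ≤ ∑ a, w a * (∫ z, KK P (s \ I a) (KK P {j} F) z ^ 2 ∂(Measure.pi fun _ : ι => P)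
          + if j ∈ I a then nD else 0) :=
          Finset.sum_le_sum fun a _ => mul_le_mul_of_nonneg_left (key a) (hw a)
      _ = ∑ a, w a * ∫ z, KK P (s \ I a) (KK P {j} F) z ^ 2 ∂(Measure.pi fun _ : ι => P)
          + (∑ a, (if j ∈ I a then w a else 0)) * nD := by
          rw [Finset.sum_mul, ← Finset.sum_add_distrib]
          refine Finset.sum_congr rfl fun a _ => ?_
          split_ifs <;> ring
      _ ≤ _ := by
          have := mul_le_mul_of_nonneg_right hpj hnD0
          rw [hpy]
          linarith

end Shearer


section Cond

variable {ι : Type*} [Fintype ι]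

/-- `T` is the optimal estimator of coordinate `i` from the other coordinates. -/
structure Opt (P : Measure ℝ) (𝒞 : Finset (ι → ℝ)) (i : ι) (T : (ι → ℝ) → ℝ) : Prop where
  meas : Measurable T
  bdd : ∀ y, |T y| ≤ 1
  ind : ∀ y y', (∀ j, j ≠ i → y j = y' j) → T y = T y'
  equi : ∀ x ∈ 𝒞, ∀ y, T (x * y) = x i * T y
  orth : ∀ φ : (ι → ℝ) → ℝ, BM φ → (∀ y y', (∀ j, j ≠ i → y j = y' j) → φ y = φ y') →
    (∀ x ∈ 𝒞, ∀ y, φ (x * y) = x i * φ y) →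
    ∫ z, φ z ∂(Measure.pi fun _ : ι => P) = ∫ z, T z * φ z ∂(Measure.pi fun _ : ι => P)

lemma Opt.bm {P : Measure ℝ} {𝒞 : Finset (ι → ℝ)} {i : ι} {T : (ι → ℝ) → ℝ}
    (h : Opt P 𝒞 i T) : BM T := ⟨h.meas, 1, h.bdd⟩

lemma Opt.unique {P : Measure ℝ} {𝒞 : Finset (ι → ℝ)} {i : ι} {T T' : (ι → ℝ) → ℝ}
    (h : Opt P 𝒞 i T) (h' : Opt P 𝒞 i T') :
    ∫ z, T z ∂(Measure.pi fun _ : ι => P) = ∫ z, T' z ∂(Measure.pi fun _ : ι => P) := by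
  rw [h'.orth T h.bm h.ind h.equi, h.orth T' h'.bm h'.ind h'.equi]
  simp only [mul_comm]

lemma Opt.sq {P : Measure ℝ} {𝒞 : Finset (ι → ℝ)} {i : ι} {T : (ι → ℝ) → ℝ}
    (h : Opt P 𝒞 i T) :
    ∫ z, T z ^ 2 ∂(Measure.pi fun _ : ι => P) = ∫ z, T z ∂(Measure.pi fun _ : ι => P) := by
  rw [h.orth T h.bm h.ind h.equi]
  simp only [pow_two]

lemma Opt.nonneg {P : Measure ℝ} {𝒞 : Finset (ι → ℝ)} {i : ι} {T : (ι → ℝ) → ℝ}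
    (h : Opt P 𝒞 i T) : 0 ≤ ∫ z, T z ∂(Measure.pi fun _ : ι => P) := by
  rw [← h.sq]; exact integral_nonneg fun _ => sq_nonneg _

lemma Opt.le_one {P : Measure ℝ} [IsProbabilityMeasure P] {𝒞 : Finset (ι → ℝ)} {i : ι}
    {T : (ι → ℝ) → ℝ} (h : Opt P 𝒞 i T) : ∫ z, T z ∂(Measure.pi fun _ : ι => P) ≤ 1 := by
  calc ∫ z, T z ∂(Measure.pi fun _ : ι => P) ≤ ∫ _, (1 : ℝ) ∂(Measure.pi fun _ : ι => P) :=
        integral_mono (h.bm.integrable _) (integrable_const _) fun z => (le_abs_self _).trans (h.bdd z)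
    _ = 1 := by simp

lemma uniform_prob {α : Type*} [MeasurableSpace α] {s : Finset α} (hs : s.Nonempty) :
    IsProbabilityMeasure (uniformOnFinset s) := by
  constructor
  simp only [uniformOnFinset, Measure.smul_apply, Measure.coe_finset_sum, Finset.sum_apply,
    measure_univ, Finset.sum_const, nsmul_eq_mul, mul_one, smul_eq_mul]
  exact ENNReal.inv_mul_cancel (by simpa using hs.ne_empty) (by simp)

lemma uniform_ae {α : Type*} [MeasurableSpace α] [MeasurableSingletonClass α] (s : Finset α) :
    ∀ᵐ x ∂(uniformOnFinset s), x ∈ s := by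
  rw [ae_iff]
  simp only [uniformOnFinset, Measure.smul_apply, Measure.coe_finset_sum, Finset.sum_apply,
    smul_eq_mul]
  rw [Finset.sum_eq_zero, mul_zero]
  intro x hx
  rw [Measure.dirac_apply]
  simp [hx]

lemma uniform_int {α β : Type*} [MeasurableSpace α] [MeasurableSpace β] {s : Finset α}
    (hs : s.Nonempty) (ν : Measure β) [IsProbabilityMeasure ν] {G : α × β → ℝ} (hG : BM G) :
    ∫ p, G p ∂((uniformOnFinset s).prod ν) = (s.card : ℝ)⁻¹ * ∑ x ∈ s, ∫ z, G (x, z) ∂ν := by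
  haveI := uniform_prob hs
  rw [integral_prod _ (hG.integrable _)]
  have hm : StronglyMeasurable fun x => ∫ z, G (x, z) ∂ν :=
    hG.1.stronglyMeasurable.integral_prod_right'
  obtain ⟨C, hC⟩ := hG.2
  have hbm : BM (fun x => ∫ z, G (x, z) ∂ν) := by
    refine ⟨hm.measurable, C, fun x => ?_⟩
    have := norm_integral_le_of_norm_le_const (μ := ν)
      (f := fun z => G (x, z)) (C := C) (Filter.Eventually.of_forall fun z' => hC _)
    simpa using this
  unfold uniformOnFinset
  rw [integral_smul_measure, integral_finsetSum_measure fun x _ => hbm.integrable _]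
  simp only [ENNReal.toReal_inv, ENNReal.toReal_natCast, smul_eq_mul]
  congr 1
  exact Finset.sum_congr rfl fun x _ => integral_dirac' _ _ hm

/-- Restriction to the coordinates other than `i`. -/
def restr (i : ι) (y : ι → ℝ) : {j : ι // j ≠ i} → ℝ := fun j => y j.1

lemma restr_meas (i : ι) : Measurable (restr (ι := ι) i) := by
  unfold restr; fun_prop

/-- Truncation to `[-1,1]`. -/
def clamp (t : ℝ) : ℝ := max (-1) (min 1 t)

lemma clamp_abs (t : ℝ) : |clamp t| ≤ 1 := by
  unfold clamp
  exact abs_le.2 ⟨le_max_left _ _, max_le (by norm_num) (min_le_left _ _)⟩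

lemma clamp_eq {t : ℝ} (h : |t| ≤ 1) : clamp t = t := by
  unfold clamp
  rw [min_eq_right (abs_le.1 h).2, max_eq_right (abs_le.1 h).1]

lemma clamp_meas : Measurable clamp := by unfold clamp; fun_prop

/-- Pull-out property of conditional means, in integrated form; plus a bounded version
as a function of the observation. -/
lemma condMean_factor {Ω β : Type*} [MeasurableSpace Ω] [MeasurableSpace β] (μ : Measure Ω)
    [IsProbabilityMeasure μ] (X : Ω → ℝ) (W : Ω → β) (hX : Measurable X) (hW : Measurable W)
    (hb : ∀ᵐ ω ∂μ, |X ω| ≤ 1) :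
    ∃ T : β → ℝ, Measurable T ∧ (∀ b, |T b| ≤ 1) ∧ condMean μ X W =ᵐ[μ] (fun ω => T (W ω)) ∧
      ∀ g : β → ℝ, BM g → ∫ ω, X ω * g (W ω) ∂μ = ∫ ω, T (W ω) * g (W ω) ∂μ := by
  have hm : MeasurableSpace.comap W inferInstance ≤ (inferInstance : MeasurableSpace Ω) :=
    hW.comap_le
  have hsm : StronglyMeasurable[MeasurableSpace.comap W inferInstance] (condMean μ X W) :=
    stronglyMeasurable_condExp
  obtain ⟨T0, hT0, hT0e⟩ := hsm.exists_eq_measurable_comp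
  have hbd : ∀ᵐ ω ∂μ, |condMean μ X W ω| ≤ 1 := by
    have := ae_bdd_condExp_of_ae_bdd (m := MeasurableSpace.comap W inferInstance) (R := 1) (f := X) (μ := μ) (by simpa using hb)
    simpa [condMean] using this
  have hae : condMean μ X W =ᵐ[μ] (fun ω => clamp (T0 (W ω))) := by
    filter_upwards [hbd] with ω hω
    have e : condMean μ X W ω = T0 (W ω) := congrFun hT0e ω
    rw [← e, clamp_eq hω]
  refine ⟨fun b => clamp (T0 b), clamp_meas.comp hT0.measurable, fun b => clamp_abs _, hae, ?_⟩
  intro g hg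
  have hXi : Integrable X μ :=
    Integrable.of_bound hX.aestronglyMeasurable 1 (by simpa using hb)
  obtain ⟨C, hC⟩ := hg.2
  have hgm : StronglyMeasurable[MeasurableSpace.comap W inferInstance] (fun ω => g (W ω)) :=
    (hg.1.comp (comap_measurable W)).stronglyMeasurable
  have h1 := condExp_stronglyMeasurable_mul_of_bound hm hgm hXi C
    (Filter.Eventually.of_forall fun ω => hC (W ω))
  have h2 := integral_condExp (μ := μ) hm (f := (fun ω => g (W ω)) * X)
  rw [integral_congr_ae h1] at h2
  have h3 : ∫ ω, X ω * g (W ω) ∂μ = ∫ ω, ((fun ω => g (W ω)) * X) ω ∂μ := by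
    simp [mul_comm]
  rw [h3, ← h2]
  refine integral_congr_ae ?_
  filter_upwards [hae] with ω hω
  have hω' : (μ[X | MeasurableSpace.comap W inferInstance]) ω = clamp (T0 (W ω)) := hω
  simp [hω', mul_comm]

lemma cond_exists {Ω : Type*} [MeasurableSpace Ω] (μ : Measure Ω) [IsProbabilityMeasure μ]
    (P : Measure ℝ) [IsProbabilityMeasure P] {𝒞 : Finset (ι → ℝ)} (hne : 𝒞.Nonempty)
    (hsg : ∀ x ∈ 𝒞, ∀ i, x i = 1 ∨ x i = -1) (hmul : ∀ x ∈ 𝒞, ∀ y ∈ 𝒞, x * y ∈ 𝒞)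
    (X Z : Ω → (ι → ℝ)) (hX : Measurable X) (hZ : Measurable Z)
    (hlaw : Measure.map (fun ω => (X ω, Z ω)) μ
        = (uniformOnFinset 𝒞).prod (Measure.pi fun _ => P)) (i : ι) :
    ∃ T, Opt P 𝒞 i T ∧
      mmse μ (fun ω => X ω i) (fun ω => fun j : {j : ι // j ≠ i} => X ω j.1 * Z ω j.1)
        = 1 - ∫ z, T z ∂(Measure.pi fun _ : ι => P) := by
  haveI := uniform_prob hne
  have hsq : ∀ x ∈ 𝒞, ∀ j, x j * x j = 1 := by
    intro x hx j; rcases hsg x hx j with h | h <;> simp [h]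
  have hcard : (𝒞.card : ℝ) ≠ 0 := by
    have := hne.card_pos; positivity
  have hXZ : Measurable fun ω => (X ω, Z ω) := hX.prodMk hZ
  have law : ∀ G : (ι → ℝ) × (ι → ℝ) → ℝ, BM G → ∫ ω, G (X ω, Z ω) ∂μ
      = (𝒞.card : ℝ)⁻¹ * ∑ x ∈ 𝒞, ∫ z, G (x, z) ∂(Measure.pi fun _ : ι => P) := by
    intro G hG
    rw [← uniform_int hne _ hG, ← hlaw, integral_map hXZ.aemeasurable hG.1.aestronglyMeasurable]
  have hXC : ∀ᵐ ω ∂μ, X ω ∈ 𝒞 := by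
    have h1 : ∀ᵐ p ∂((uniformOnFinset 𝒞).prod (Measure.pi fun _ : ι => P)), p.1 ∈ 𝒞 :=
      Measure.quasiMeasurePreserving_fst.ae (uniform_ae 𝒞)
    rw [← hlaw] at h1
    exact ae_of_ae_map hXZ.aemeasurable h1
  have hXb : ∀ᵐ ω ∂μ, |X ω i| ≤ 1 := by
    filter_upwards [hXC] with ω hω
    rcases hsg _ hω i with h | h <;> simp [h]
  set W : Ω → ({j : ι // j ≠ i} → ℝ) := fun ω => fun j => X ω j.1 * Z ω j.1 with hWdef
  have hWe : ∀ ω, W ω = restr i (X ω * Z ω) := fun ω => rfl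
  have hW : Measurable W := (restr_meas i).comp (hX.mul hZ)
  have hXi : Measurable fun ω => X ω i := (measurable_pi_apply i).comp hX
  obtain ⟨T1, hT1m, hT1b, hT1e, hT1o⟩ := condMean_factor μ (fun ω => X ω i) W hXi hW hXb
  have hT1 : BM T1 := ⟨hT1m, 1, hT1b⟩
  -- clamp of a coordinate
  have hcl : ∀ x ∈ 𝒞, clamp (x i) = x i := by
    intro x hx
    apply clamp_eq
    rcases hsg _ hx i with h | h <;> simp [h]
  have hXcl : ∀ᵐ ω ∂μ, X ω i = clamp (X ω i) := by
    filter_upwards [hXC] with ω hω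
    rw [hcl _ hω]
  have hclBM : BM (fun p : (ι → ℝ) × (ι → ℝ) => clamp (p.1 i)) :=
    ⟨clamp_meas.comp (by fun_prop), 1, fun _ => clamp_abs _⟩
  have hmulm : Measurable fun p : (ι → ℝ) × (ι → ℝ) => restr i (p.1 * p.2) :=
    (restr_meas i).comp (measurable_fst.mul measurable_snd)
  have hTx : ∀ x : ι → ℝ, Measurable fun z : ι → ℝ => restr i (x * z) := fun x =>
    (restr_meas i).comp (measurable_const.mul measurable_id)
  -- expectation of X_i g(W)
  have lawXg : ∀ g, BM g → ∫ ω, X ω i * g (W ω) ∂μ = (𝒞.card : ℝ)⁻¹ * ∑ x ∈ 𝒞,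
      ∫ z, x i * g (restr i (x * z)) ∂(Measure.pi fun _ : ι => P) := by
    intro g hg
    have h := law (fun p => clamp (p.1 i) * g (restr i (p.1 * p.2))) (hclBM.mul (hg.comp hmulm))
    calc ∫ ω, X ω i * g (W ω) ∂μ = ∫ ω, clamp (X ω i) * g (restr i (X ω * Z ω)) ∂μ := by
          refine integral_congr_ae ?_
          filter_upwards [hXcl] with ω hω
          simp only [← hω, hWe]
      _ = _ := by
          rw [h]
          congr 1
          refine Finset.sum_congr rfl fun x hx => ?_
          simp only [hcl x hx]
  set T : (ι → ℝ) → ℝ := fun y => (𝒞.card : ℝ)⁻¹ * ∑ x ∈ 𝒞, x i * T1 (restr i (x * y)) with hT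
  have hTint : ∀ φ : (ι → ℝ) → ℝ, BM φ → ∫ z, T z * φ z ∂(Measure.pi fun _ : ι => P)
      = (𝒞.card : ℝ)⁻¹ * ∑ x ∈ 𝒞,
        ∫ z, x i * T1 (restr i (x * z)) * φ z ∂(Measure.pi fun _ : ι => P) := by
    intro φ hφ
    rw [← integral_finset_sum, ← integral_const_mul]
    · simp only [hT, mul_assoc, Finset.sum_mul]
    · intro x hx
      exact (((BM.const (x i)).mul (hT1.comp (hTx x))).mul hφ).integrable _
  refine ⟨T, ⟨?_, ?_, ?_, ?_, ?_⟩, ?_⟩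
  · refine Measurable.const_mul (Finset.measurable_sum _ fun x _ => ?_) _
    exact (hT1m.comp (hTx x)).const_mul _
  · intro y
    rw [hT, abs_mul, abs_of_nonneg (by positivity : (0 : ℝ) ≤ (𝒞.card : ℝ)⁻¹)]
    have : |∑ x ∈ 𝒞, x i * T1 (restr i (x * y))| ≤ 𝒞.card := by
      refine (Finset.abs_sum_le_sum_abs _ _).trans ?_
      calc ∑ x ∈ 𝒞, |x i * T1 (restr i (x * y))| ≤ ∑ x ∈ 𝒞, (1 : ℝ) := by
            refine Finset.sum_le_sum fun x hx => ?_
            rcases hsg x hx i with h | h <;> simpa [h] using hT1b _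
        _ = 𝒞.card := by simp
    calc (𝒞.card : ℝ)⁻¹ * |∑ x ∈ 𝒞, x i * T1 (restr i (x * y))|
        ≤ (𝒞.card : ℝ)⁻¹ * 𝒞.card := mul_le_mul_of_nonneg_left this (by positivity)
      _ = 1 := inv_mul_cancel₀ hcard
  · intro y y' h
    simp only [hT]
    congr 1
    refine Finset.sum_congr rfl fun x _ => ?_
    congr 2
    funext j
    simp [restr, h j.1 j.2]
  · intro x0 hx0 y
    simp only [hT]
    rw [mul_left_comm]
    congr 1
    rw [Finset.mul_sum]
    refine Finset.sum_bij' (fun x _ => x * x0) (fun x _ => x * x0) ?_ ?_ ?_ ?_ ?_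
    · intro x hx; exact hmul _ hx _ hx0
    · intro x hx; exact hmul _ hx _ hx0
    · intro x hx; funext j; simp [mul_assoc, hsq x0 hx0]
    · intro x hx; funext j; simp [mul_assoc, hsq x0 hx0]
    · intro x hx
      have := hsq x0 hx0 i
      rw [mul_assoc x x0 y, Pi.mul_apply]
      linear_combination (-(x i * T1 (restr i (x * (x0 * y))))) * this
  · intro φ hφ hind heq
    classical
    -- extension by zero
    set ext0 : ({j : ι // j ≠ i} → ℝ) → (ι → ℝ) := fun u j => if h : j ≠ i then u ⟨j, h⟩ else 0
      with hext
    have hextm : Measurable ext0 := by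
      refine measurable_pi_lambda _ fun j => ?_
      by_cases h : j ≠ i
      · simp only [hext, dif_pos h]; fun_prop
      · simp only [hext, dif_neg h]; fun_prop
    have hφe : ∀ y, φ (ext0 (restr i y)) = φ y := by
      intro y
      apply hind
      intro j hj
      simp [hext, restr, hj]
    have h1 := hT1o (fun u => φ (ext0 u)) (hφ.comp hextm)
    have h2 := lawXg (fun u => φ (ext0 u)) (hφ.comp hextm)
    have h3 := law (fun p => T1 (restr i (p.1 * p.2)) * φ (p.1 * p.2))
      ((hT1.comp hmulm).mul (hφ.comp (measurable_fst.mul measurable_snd)))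
    simp only [hφe] at h2
    rw [h2] at h1
    have h4 : ∫ ω, T1 (W ω) * φ (ext0 (W ω)) ∂μ
        = ∫ ω, T1 (restr i (X ω * Z ω)) * φ (X ω * Z ω) ∂μ := by
      simp only [hWe, hφe]
    rw [h4, h3] at h1
    rw [hTint φ hφ]
    have h5 : (𝒞.card : ℝ)⁻¹ * ∑ x ∈ 𝒞, ∫ z, x i * φ (x * z) ∂(Measure.pi fun _ : ι => P)
        = ∫ z, φ z ∂(Measure.pi fun _ : ι => P) := by
      rw [Finset.sum_congr rfl (g := fun _ => ∫ z, φ z ∂(Measure.pi fun _ : ι => P))]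
      · rw [Finset.sum_const, nsmul_eq_mul, ← mul_assoc, inv_mul_cancel₀ hcard, one_mul]
      · intro x hx
        simp only [heq x hx, ← mul_assoc, hsq x hx, one_mul]
    rw [h5] at h1
    rw [h1]
    congr 1
    refine Finset.sum_congr rfl fun x hx => ?_
    congr 1
    funext z
    rw [heq x hx]; ring
  · have hq : ∫ ω, X ω i * T1 (W ω) ∂μ = ∫ z, T z ∂(Measure.pi fun _ : ι => P) := by
      rw [lawXg T1 hT1]
      have := hTint (fun _ => 1) (BM.const 1)
      simp only [mul_one] at this
      rw [this]
    have hq2 := hT1o T1 hT1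
    rw [hq] at hq2
    unfold mmse
    have hXI : Integrable (fun ω => X ω i * T1 (W ω)) μ :=
      Integrable.of_bound (hXi.mul (hT1m.comp hW)).aestronglyMeasurable 1 (by
        filter_upwards [hXb] with ω hω
        rw [norm_mul]
        exact mul_le_one₀ hω (norm_nonneg _) (hT1b _))
    have hTI : Integrable (fun ω => T1 (W ω) * T1 (W ω)) μ := ((hT1.mul hT1).comp hW).integrable _
    calc ∫ ω, (X ω i - condMean μ (fun ω => X ω i) W ω) ^ 2 ∂μ
        = ∫ ω, (1 - 2 * (X ω i * T1 (W ω)) + T1 (W ω) * T1 (W ω)) ∂μ := by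
          refine integral_congr_ae ?_
          filter_upwards [hXC, hT1e] with ω h1 h2
          have := hsq _ h1 i
          rw [h2]
          linear_combination this
      _ = _ := by
          have hI1 : Integrable (fun ω => 1 - 2 * (X ω i * T1 (W ω))) μ :=
            (integrable_const _).sub (hXI.const_mul 2)
          rw [integral_add hI1 hTI,
            integral_sub (integrable_const _) (hXI.const_mul 2), integral_const_mul, hq, ← hq2]
          simp
          ring

end Cond


section TwoLook

lemma comp_mp {ι κ : Type*} [Fintype ι] [Fintype κ] (P : Measure ℝ) [IsProbabilityMeasure P]
    (e : ι ≃ κ) : MeasurePreserving (fun (y : κ → ℝ) (i : ι) => y (e i))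
      (Measure.pi fun _ : κ => P) (Measure.pi fun _ : ι => P) :=
  (measurePreserving_piCongrLeft (fun _ : κ => P) e).symm

lemma mp_int {α β : Type*} [MeasurableSpace α] [MeasurableSpace β] {μ : Measure α} {ν : Measure β}
    {f : α → β} (hf : MeasurePreserving f μ ν) {G : β → ℝ} (hG : BM G) :
    ∫ x, G (f x) ∂μ = ∫ y, G y ∂ν := by
  rw [← hf.map_eq, integral_map hf.measurable.aemeasurable hG.1.aestronglyMeasurable]

lemma Opt.perm {ι : Type*} [Fintype ι] {P : Measure ℝ} [IsProbabilityMeasure P]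
    {𝒞 : Finset (ι → ℝ)} {i : ι} {T : (ι → ℝ) → ℝ} (h : Opt P 𝒞 i T) (σ : ι ≃ ι)
    (h1 : ∀ x ∈ 𝒞, x ∘ σ ∈ 𝒞) (h2 : ∀ x ∈ 𝒞, x ∘ σ.symm ∈ 𝒞) :
    Opt P 𝒞 (σ i) (fun y => T (fun j => y (σ j))) := by
  have hm : Measurable fun (y : ι → ℝ) (j : ι) => y (σ j) := (comp_mp P σ).measurable
  have hm' : Measurable fun (y : ι → ℝ) (j : ι) => y (σ.symm j) := (comp_mp P σ.symm).measurable
  refine ⟨h.meas.comp hm, fun y => h.bdd _, ?_, ?_, ?_⟩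
  · intro y y' hy
    exact h.ind _ _ fun j hj => hy _ fun e => hj (σ.injective e)
  · intro x hx y
    exact h.equi _ (h1 x hx) (fun j => y (σ j))
  · intro φ hφ hind heq
    have h3 := h.orth (fun y => φ (fun j => y (σ.symm j))) (hφ.comp hm') ?_ ?_
    · rw [mp_int (comp_mp P σ.symm) hφ] at h3
      rw [h3, ← mp_int (comp_mp P σ) (h.bm.mul (hφ.comp hm'))]
      simp
    · intro y y' hy
      exact hind _ _ fun j hj => hy _ fun e => hj (by rw [← e]; simp)
    · intro x hx y
      have := heq _ (h2 x hx) (fun j => y (σ.symm j))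
      simp only [Function.comp_apply, Equiv.symm_apply_apply] at this
      exact this

lemma opt_exists (P : Measure ℝ) [IsProbabilityMeasure P] (r m : ℕ) (i : Fin (2 ^ m)) :
    ∃ T, Opt P (bpskRM r m) i T := by
  haveI := uniform_prob (bpskRM_nonempty r m)
  obtain ⟨T, hT, _⟩ := cond_exists
    ((uniformOnFinset (bpskRM r m)).prod (Measure.pi fun _ : Fin (2 ^ m) => P)) P
    (bpskRM_nonempty r m) bpskRM_sign bpskRM_mul Prod.fst Prod.snd measurable_fst measurable_snd
    (by simp) i
  exact ⟨T, hT⟩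

lemma opt_int_eq {P : Measure ℝ} [IsProbabilityMeasure P] {r m : ℕ} {i j : Fin (2 ^ m)}
    {T T' : (Fin (2 ^ m) → ℝ) → ℝ} (h : Opt P (bpskRM r m) i T) (h' : Opt P (bpskRM r m) j T') :
    ∫ z, T z ∂(Measure.pi fun _ => P) = ∫ z, T' z ∂(Measure.pi fun _ => P) := by
  have e : transl m (bitv j - bitv i) i = j := by
    apply bitv_injective; rw [bitv_transl]; abel
  have h2 := h.perm (transl m (bitv j - bitv i)) (fun x hx => bpskRM_transl _ hx)
    (fun x hx => bpskRM_transl_symm _ hx)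
  rw [e] at h2
  rw [h'.unique h2, mp_int (comp_mp P _) h.bm]

lemma pair_mp (P : Measure ℝ) [IsProbabilityMeasure P] (m : ℕ) : MeasurePreserving
    (fun z : Fin (2 ^ (m + 1)) → ℝ => ((fun v => z (emb m 0 v), fun v => z (emb m 1 v)) :
      (Fin (2 ^ m) → ℝ) × (Fin (2 ^ m) → ℝ)))
    (Measure.pi fun _ => P) ((Measure.pi fun _ => P).prod (Measure.pi fun _ => P)) := by
  have h1 := comp_mp P (Equiv.ofBijective _ (emb_sum_bijective m))
  have h2 := measurePreserving_sumPiEquivProdPi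
    (X := fun _ : Fin (2 ^ m) ⊕ Fin (2 ^ m) => ℝ) (fun _ => P)
  exact h2.comp h1

lemma two_look {P : Measure ℝ} [IsProbabilityMeasure P] {r m : ℕ}
    {T : (Fin (2 ^ m) → ℝ) → ℝ} {T' : (Fin (2 ^ (m + 1)) → ℝ) → ℝ}
    (h : Opt P (bpskRM r m) (orig m) T) (h' : Opt P (bpskRM r (m + 1)) (orig (m + 1)) T')
    {q q' : ℝ} (hq : q = ∫ z, T z ∂(Measure.pi fun _ => P))
    (hq' : q' = ∫ z, T' z ∂(Measure.pi fun _ => P)) :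
    q * (1 - q) ≤ 4 * (q' - q) := by
  set s : (Fin m → ZMod 2) → Finset (Fin (2 ^ m)) := fun a =>
    (Finset.univ.erase (orig m)) \ Finset.univ.filter (fun v => lin a (bitv v) = 0) with hs
  have hTg : ∀ g ∈ Dpoly 1 m, g 0 = 0 →
      ∫ z, T (fun v => z (emb m g v)) ∂(Measure.pi fun _ => P)
        = ∫ z, T' z * T (fun v => z (emb m g v)) ∂(Measure.pi fun _ => P) := by
    intro g hg hg0
    refine h'.orth (fun z => T (fun v => z (emb m g v))) (h.bm.comp (by fun_prop)) ?_ ?_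
    · intro y y' hy
      refine h.ind _ _ fun j hj => hy _ fun e => hj ?_
      have e' := congrArg bitv (e.trans (emb_orig hg0).symm)
      rw [bitv_emb, bitv_emb, Fin.snoc_inj] at e'
      exact bitv_injective e'.1
    · intro x hx y
      have := h.equi _ (bpskRM_emb hg hx) (fun v => y (emb m g v))
      simp only [Function.comp_apply, emb_orig hg0] at this
      exact this
  have hB : ∀ a : Fin m → ZMod 2, ∀ z : Fin (2 ^ (m + 1)) → ℝ,
      (fun v => z (emb m (lin a) v))
        = (s a).piecewise (fun v => z (emb m 1 v)) (fun v => z (emb m 0 v)) := by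
    intro a z
    funext v
    rcases zmod2_cases (lin a (bitv v)) with h0 | h1
    · have : v ∉ s a := by simp [hs, h0]
      rw [Finset.piecewise_eq_of_notMem _ _ _ this, emb_apply_eq (lin a) 0 v (by simpa using h0)]
    · have : v ∈ s a := by
        simp only [hs, Finset.mem_sdiff, Finset.mem_erase, Finset.mem_univ, and_true,
          Finset.mem_filter, true_and, h1]
        refine ⟨?_, by decide⟩
        rintro rfl
        rw [bitv_orig] at h1
        simp [lin] at h1
      rw [Finset.piecewise_eq_of_mem _ _ _ this, emb_apply_eq (lin a) 1 v (by simpa using h1)]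
  have hBmp : ∀ a : Fin m → ZMod 2, MeasurePreserving
      (fun (z : Fin (2 ^ (m + 1)) → ℝ) v => z (emb m (lin a) v)) (Measure.pi fun _ => P)
      (Measure.pi fun _ => P) := by
    intro a
    have := (piecewise_mp P (s a)).comp (pair_mp P m)
    convert this using 1
    funext z
    exact hB a z
  have hAmp : MeasurePreserving
      (fun (z : Fin (2 ^ (m + 1)) → ℝ) v => z (emb m 0 v)) (Measure.pi fun _ => P)
      (Measure.pi fun _ => P) := measurePreserving_fst.comp (pair_mp P m)
  have hdiff : ∀ g ∈ Dpoly 1 m, g 0 = 0 → MeasurePreserving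
      (fun (z : Fin (2 ^ (m + 1)) → ℝ) v => z (emb m g v)) (Measure.pi fun _ => P)
      (Measure.pi fun _ => P) →
      ∫ z, (T' z - T (fun v => z (emb m g v))) ^ 2 ∂(Measure.pi fun _ => P) = q' - q := by
    intro g hg hg0 hmp
    have hTb : BM (fun z : Fin (2 ^ (m + 1)) → ℝ => T (fun v => z (emb m g v))) :=
      h.bm.comp (by fun_prop)
    have e : ∀ z, (T' z - T (fun v => z (emb m g v))) ^ 2
        = T' z ^ 2 - 2 * (T' z * T (fun v => z (emb m g v))) + T (fun v => z (emb m g v)) ^ 2 := by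
      intro z; ring
    simp only [e]
    rw [integral_add ((h'.bm.sq.sub ((BM.const 2).mul (h'.bm.mul hTb))).integrable _)
      (hTb.sq.integrable _),
      integral_sub (h'.bm.sq.integrable _) (((BM.const 2).mul (h'.bm.mul hTb)).integrable _),
      integral_const_mul, ← hTg g hg hg0, h'.sq, mp_int hmp h.bm, mp_int hmp h.bm.sq, h.sq,
      ← hq, ← hq']
    ring
  have hc : ∀ a : Fin m → ZMod 2,
      2 * q - 2 * ∫ z, KK P (s a) T z ^ 2 ∂(Measure.pi fun _ => P) ≤ 4 * (q' - q) := by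
    intro a
    have hTA : BM (fun z : Fin (2 ^ (m + 1)) → ℝ => T (fun v => z (emb m 0 v))) :=
      h.bm.comp (by fun_prop)
    have hTB : BM (fun z : Fin (2 ^ (m + 1)) → ℝ => T (fun v => z (emb m (lin a) v))) :=
      h.bm.comp (by fun_prop)
    have hcr : ∫ z, T (fun v => z (emb m 0 v)) * T (fun v => z (emb m (lin a) v))
          ∂(Measure.pi fun _ => P)
        = ∫ z, KK P (s a) T z ^ 2 ∂(Measure.pi fun _ => P) := by
      rw [KK_sq P _ h.bm]
      simp only [hB]
      have hG : BM (fun p : (Fin (2 ^ m) → ℝ) × (Fin (2 ^ m) → ℝ) =>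
          T p.1 * T ((s a).piecewise p.2 p.1)) :=
        (h.bm.comp measurable_fst).mul (h.bm.comp (measurable_pw (s a)))
      rw [mp_int (pair_mp P m) hG, integral_prod _ (hG.integrable _)]
      simp only [KK, integral_const_mul]
    have hA := hdiff 0 (Submodule.zero_mem _) rfl hAmp
    have hBd := hdiff (lin a) (lin_mem a) (by simp [lin]) (hBmp a)
    have hAB : ∫ z, (T (fun v => z (emb m 0 v)) - T (fun v => z (emb m (lin a) v))) ^ 2
        ∂(Measure.pi fun _ => P) = 2 * q - 2 * ∫ z, KK P (s a) T z ^ 2 ∂(Measure.pi fun _ => P) := by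
      have e : ∀ z : Fin (2 ^ (m + 1)) → ℝ,
          (T (fun v => z (emb m 0 v)) - T (fun v => z (emb m (lin a) v))) ^ 2
          = T (fun v => z (emb m 0 v)) ^ 2
            - 2 * (T (fun v => z (emb m 0 v)) * T (fun v => z (emb m (lin a) v)))
            + T (fun v => z (emb m (lin a) v)) ^ 2 := by
        intro z; ring
      simp only [e]
      rw [integral_add ((hTA.sq.sub ((BM.const 2).mul (hTA.mul hTB))).integrable _)
        (hTB.sq.integrable _),
        integral_sub (hTA.sq.integrable _) (((BM.const 2).mul (hTA.mul hTB)).integrable _),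
        integral_const_mul, hcr, mp_int hAmp h.bm.sq, mp_int (hBmp a) h.bm.sq, h.sq, ← hq]
      ring
    rw [← hAB]
    calc ∫ z, (T (fun v => z (emb m 0 v)) - T (fun v => z (emb m (lin a) v))) ^ 2
          ∂(Measure.pi fun _ => P)
        ≤ ∫ z, (2 * (T' z - T (fun v => z (emb m 0 v))) ^ 2
            + 2 * (T' z - T (fun v => z (emb m (lin a) v))) ^ 2) ∂(Measure.pi fun _ => P) := by
          refine integral_mono ((hTA.sub hTB).sq.integrable _)
            ((((BM.const 2).mul (h'.bm.sub hTA).sq).add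
              ((BM.const 2).mul (h'.bm.sub hTB).sq)).integrable _) fun z => ?_
          simp only
          nlinarith [sq_nonneg ((T' z - T (fun v => z (emb m 0 v)))
            + (T' z - T (fun v => z (emb m (lin a) v))))]
      _ = 4 * (q' - q) := by
          rw [integral_add (((BM.const 2).mul (h'.bm.sub hTA).sq).integrable _)
            (((BM.const 2).mul (h'.bm.sub hTB).sq).integrable _), integral_const_mul,
            integral_const_mul, hA, hBd]
          ring
  -- Shearer
  have hpos : (0 : ℝ) < 2 ^ m := by positivity
  have hsh := shearer P (fun _ : Fin m → ZMod 2 => ((2 : ℝ) ^ m)⁻¹) (fun _ => by positivity)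
    (by simp [hpos.ne']) (fun a => Finset.univ.filter (fun v => lin a (bitv v) = 0)) (1 / 2)
    (Finset.univ.erase (orig m)) (by
      intro j hj
      have hj' : bitv j ≠ 0 := by
        intro e
        rw [← bitv_orig m] at e
        exact (Finset.mem_erase.1 hj).1 (bitv_injective e)
      have hcd := card_lin_zero hj'
      have hcd' : (2 : ℝ) * (Finset.univ.filter
        (fun a : Fin m → ZMod 2 => lin a (bitv j) = 0)).card = 2 ^ m := by exact_mod_cast hcd
      simp only [Finset.mem_filter, Finset.mem_univ, true_and]
      rw [← Finset.sum_filter, Finset.sum_const, nsmul_eq_mul]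
      rw [← hcd']
      apply le_of_eq
      have : ((Finset.univ.filter
        (fun a : Fin m → ZMod 2 => lin a (bitv j) = 0)).card : ℝ) ≠ 0 := by
        intro h0; rw [h0] at hcd'; linarith
      field_simp) h.bm
  have hK : KK P (Finset.univ.erase (orig m)) T = fun _ => q := by
    funext z
    unfold KK
    rw [hq]
    congr 1
    funext z'
    refine h.ind _ _ fun j hj => ?_
    rw [Finset.piecewise_eq_of_mem _ _ _ (by simp [hj])]
  rw [hK, h.sq, ← hq] at hsh
  simp only [integral_const, smul_eq_mul, probReal_univ, one_mul] at hsh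
  have hsum : ∑ a : Fin m → ZMod 2, ((2 : ℝ) ^ m)⁻¹ *
      (2 * q - 2 * ∫ z, KK P (s a) T z ^ 2 ∂(Measure.pi fun _ => P)) ≤ 4 * (q' - q) := by
    calc _ ≤ ∑ a : Fin m → ZMod 2, ((2 : ℝ) ^ m)⁻¹ * (4 * (q' - q)) :=
          Finset.sum_le_sum fun a _ => mul_le_mul_of_nonneg_left (hc a) (by positivity)
      _ = 4 * (q' - q) := by
          simp [hpos.ne']
  have e : ∑ a : Fin m → ZMod 2, ((2 : ℝ) ^ m)⁻¹ *
      (2 * q - 2 * ∫ z, KK P (s a) T z ^ 2 ∂(Measure.pi fun _ => P))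
      = 2 * q - 2 * ∑ a : Fin m → ZMod 2, ((2 : ℝ) ^ m)⁻¹ *
        ∫ z, KK P (s a) T z ^ 2 ∂(Measure.pi fun _ => P) := by
    simp only [mul_sub, Finset.sum_sub_distrib]
    congr 1
    · simp [hpos.ne']
    · rw [Finset.mul_sum]
      exact Finset.sum_congr rfl fun a _ => by ring
  rw [e] at hsum
  nlinarith [hsh, hsum]

end TwoLook


section Entropy

lemma hb_concave {s t : ℝ} (hs : |s| ≤ 1) (ht : |t| ≤ 1) :
    (hb ((1 + s) / 2) + hb ((1 + t) / 2)) / 2 ≤ hb ((1 + (s + t) / 2) / 2) := by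
  have h := Real.strictConcave_binEntropy.concaveOn
  have hs' : (1 + s) / 2 ∈ Set.Icc (0 : ℝ) 1 := by
    have := abs_le.1 hs; constructor <;> linarith [this.1, this.2]
  have ht' : (1 + t) / 2 ∈ Set.Icc (0 : ℝ) 1 := by
    have := abs_le.1 ht; constructor <;> linarith [this.1, this.2]
  have h2 := h.2 hs' ht' (by norm_num : (0 : ℝ) ≤ 1 / 2) (by norm_num : (0 : ℝ) ≤ 1 / 2)
    (by norm_num)
  simp only [smul_eq_mul] at h2
  have e : 1 / 2 * ((1 + s) / 2) + 1 / 2 * ((1 + t) / 2) = (1 + (s + t) / 2) / 2 := by ring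
  rw [e] at h2
  simp only [hb_eq_binEntropy]
  have hl : 0 < Real.log 2 := Real.log_pos (by norm_num)
  rw [← add_div, div_div, mul_comm (Real.log 2) 2, ← div_div]
  exact div_le_div_of_nonneg_right (by linarith) hl.le

lemma signMeasure_eq : signMeasure = uniformOnFinset ({-1, 1} : Finset ℝ) := by
  have h : (-1 : ℝ) ≠ 1 := by norm_num
  unfold signMeasure uniformOnFinset
  rw [Finset.sum_pair h, Finset.card_pair h]
  norm_num

lemma hb_comp_BM {α : Type*} [MeasurableSpace α] {T : α → ℝ} (hT : Measurable T)
    (hb1 : ∀ y, |T y| ≤ 1) : BM (fun y => hb ((1 + T y) / 2)) := by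
  refine ⟨hb_continuous.measurable.comp (by fun_prop), ?_⟩
  obtain ⟨C, hC⟩ := isCompact_Icc.exists_bound_of_continuousOn (s := Set.Icc (0 : ℝ) 1)
    hb_continuous.continuousOn
  refine ⟨C, fun y => hC _ ?_⟩
  have := abs_le.1 (hb1 y)
  constructor <;> linarith [this.1, this.2]

lemma tau_exists (P : Measure ℝ) [IsProbabilityMeasure P] : ∃ τ : ℝ → ℝ, Measurable τ ∧
    (∀ y, |τ y| ≤ 1) ∧ (∀ y, τ (-y) = -τ y) ∧
    (∀ φ : ℝ → ℝ, BM φ → (∀ y, φ (-y) = -φ y) → ∫ z, φ z ∂P = ∫ z, τ z * φ z ∂P) ∧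
    1 - ∫ z, hb ((1 + τ z) / 2) ∂P ≤ capacity P := by
  have hne : ({-1, 1} : Finset ℝ).Nonempty := by simp
  haveI := uniform_prob hne
  have h11 : (-1 : ℝ) ≠ 1 := by norm_num
  have law : ∀ G : ℝ × ℝ → ℝ, BM G → ∫ p, G p ∂((uniformOnFinset ({-1, 1} : Finset ℝ)).prod P)
      = 1 / 2 * (∫ z, G (-1, z) ∂P + ∫ z, G (1, z) ∂P) := by
    intro G hG
    rw [uniform_int hne P hG, Finset.sum_pair h11, Finset.card_pair h11]
    norm_num
  have hX1 : ∀ᵐ p ∂((uniformOnFinset ({-1, 1} : Finset ℝ)).prod P),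
      p.1 ∈ ({-1, 1} : Finset ℝ) :=
    Measure.quasiMeasurePreserving_fst.ae (uniform_ae _)
  have hXb : ∀ᵐ p ∂((uniformOnFinset ({-1, 1} : Finset ℝ)).prod P), |p.1| ≤ 1 := by
    filter_upwards [hX1] with p hp
    simp only [Finset.mem_insert, Finset.mem_singleton] at hp
    rcases hp with h | h <;> simp [h]
  have hWm : Measurable fun q : ℝ × ℝ => q.1 * q.2 := by fun_prop
  obtain ⟨t, htm, htb, hte, hto⟩ := condMean_factor
    ((uniformOnFinset ({-1, 1} : Finset ℝ)).prod P) (fun q : ℝ × ℝ => q.1)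
    (fun q : ℝ × ℝ => q.1 * q.2) measurable_fst hWm hXb
  have ht : BM t := ⟨htm, 1, htb⟩
  have htn : BM (fun z => t (-z)) := ht.comp (by fun_prop)
  have hτb : ∀ y, |(t y - t (-y)) / 2| ≤ 1 := by
    intro y
    have h1 := abs_le.1 (htb y)
    have h2 := abs_le.1 (htb (-y))
    rw [abs_le]; constructor <;> linarith [h1.1, h1.2, h2.1, h2.2]
  refine ⟨fun y => (t y - t (-y)) / 2, by fun_prop, hτb, ?_, ?_, ?_⟩
  · intro y; simp only [neg_neg]; ring
  · intro φ hφ hodd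
    have h1 := hto φ hφ
    have hclb : BM (fun p : ℝ × ℝ => clamp p.1) :=
      ⟨clamp_meas.comp measurable_fst, 1, fun _ => clamp_abs _⟩
    have e1 : ∫ p : ℝ × ℝ, p.1 * φ (p.1 * p.2) ∂((uniformOnFinset ({-1, 1} : Finset ℝ)).prod P)
        = ∫ p : ℝ × ℝ, clamp p.1 * φ (p.1 * p.2)
          ∂((uniformOnFinset ({-1, 1} : Finset ℝ)).prod P) := by
      refine integral_congr_ae ?_
      filter_upwards [hXb] with p hp
      rw [clamp_eq hp]
    rw [e1, law (fun p => clamp p.1 * φ (p.1 * p.2))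
      (hclb.mul (hφ.comp hWm)),
      law (fun p => t (p.1 * p.2) * φ (p.1 * p.2)) ((ht.mul hφ).comp hWm)] at h1
    have c1 : clamp (-1) = -1 := clamp_eq (by norm_num)
    have c2 : clamp 1 = 1 := clamp_eq (by norm_num)
    simp only [c1, c2, one_mul, neg_mul, hodd, neg_neg] at h1
    have h2 : ∫ z, φ z ∂P = 1 / 2 * (∫ z, -(t (-z) * φ z) ∂P + ∫ z, t z * φ z ∂P) := by
      simp only [mul_neg] at h1
      linarith
    rw [h2, ← integral_add ((htn.mul hφ).neg.integrable _) ((ht.mul hφ).integrable _),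
      ← integral_const_mul]
    congr 1
    funext z
    ring
  · unfold capacity
    rw [signMeasure_eq]
    have e1 : ∫ p, hb ((1 + condMean ((uniformOnFinset ({-1, 1} : Finset ℝ)).prod P)
        (fun q : ℝ × ℝ => q.1) (fun q : ℝ × ℝ => q.1 * q.2) p) / 2)
          ∂((uniformOnFinset ({-1, 1} : Finset ℝ)).prod P)
        = ∫ p : ℝ × ℝ, hb ((1 + t (p.1 * p.2)) / 2)
          ∂((uniformOnFinset ({-1, 1} : Finset ℝ)).prod P) := by
      refine integral_congr_ae ?_
      filter_upwards [hte] with p hp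
      rw [hp]
    have hh := hb_comp_BM htm htb
    have hhn := hb_comp_BM (T := fun z => t (-z)) (by fun_prop) (fun y => htb (-y))
    rw [e1, law (fun p => hb ((1 + t (p.1 * p.2)) / 2)) (hh.comp hWm)]
    simp only [one_mul, neg_mul]
    have h3 : 1 / 2 * (∫ z, hb ((1 + t (-z)) / 2) ∂P + ∫ z, hb ((1 + t z) / 2) ∂P)
        ≤ ∫ z, hb ((1 + (t z - t (-z)) / 2) / 2) ∂P := by
      rw [← integral_add (hhn.integrable _) (hh.integrable _), ← integral_const_mul]
      refine integral_mono (((BM.const (1 / 2)).mul (hhn.add hh)).integrable _)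
        ((hb_comp_BM (T := fun z => (t z - t (-z)) / 2) (by fun_prop) hτb).integrable _)
        fun z => ?_
      simp only
      have h4 := hb_concave (htb z) (t := -t (-z)) (by simpa using htb (-z))
      have h5 : hb ((1 + -t (-z)) / 2) = hb ((1 + t (-z)) / 2) := by
        rw [← hb_one_sub]; congr 1; ring
      rw [h5, ← sub_eq_add_neg] at h4
      linarith
    linarith

variable {ι : Type*} [Fintype ι] [DecidableEq ι]

/-- Sign vector which is `-1` exactly on `u`. -/
def sgn (u : Finset ι) : ι → ℝ := fun i => if i ∈ u then -1 else 1

lemma one_coord (P : Measure ℝ) [IsProbabilityMeasure P] {τ : ℝ → ℝ} (hτm : Measurable τ)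
    (hτb : ∀ y, |τ y| ≤ 1)
    (hτo : ∀ φ : ℝ → ℝ, BM φ → (∀ y, φ (-y) = -φ y) → ∫ z, φ z ∂P = ∫ z, τ z * φ z ∂P)
    (k : ι) {φ : (ι → ℝ) → ℝ} (hφ : BM φ) (hodd : ∀ z, φ (sgn {k} * z) = -φ z) :
    ∫ z, φ z ∂(Measure.pi fun _ : ι => P) = ∫ z, τ (z k) * φ z ∂(Measure.pi fun _ : ι => P) := by
  have hτ : BM τ := ⟨hτm, 1, hτb⟩
  have hτφ : BM (fun z : ι → ℝ => τ (z k) * φ z) := (hτ.comp (measurable_pi_apply k)).mul hφ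
  rw [← mp_int (piecewise_mp P {k}) hφ, ← mp_int (piecewise_mp P {k}) hτφ,
    integral_prod _ ((hφ.comp (measurable_pw {k})).integrable _),
    integral_prod _ ((hτφ.comp (measurable_pw {k})).integrable _)]
  congr 1
  funext z
  have hu : Measurable fun t : ℝ => Function.update z k t := measurable_update z
  have hf : BM (fun t => φ (Function.update z k t)) := hφ.comp hu
  have h1 := hτo (fun t => φ (Function.update z k t)) hf (by
    intro t
    rw [← hodd]
    congr 1
    funext i
    by_cases hi : i = k
    · subst hi; simp [sgn]
    · simp [sgn, hi])
  have hev := measurePreserving_eval (fun _ : ι => P) k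
  rw [← mp_int hev hf, ← mp_int hev (hτ.mul hf)] at h1
  have e : ∀ z' : ι → ℝ, ({k} : Finset ι).piecewise z' z = Function.update z k (z' k) := by
    intro z'; exact Finset.piecewise_singleton _ _ _
  simp only [e, Function.update_self]
  exact h1

lemma sgn_mul_self (u : Finset ι) (z : ι → ℝ) : sgn u * (sgn u * z) = z := by
  funext i
  by_cases h : i ∈ u <;> simp [sgn, h]

lemma sgn_meas (u : Finset ι) : Measurable fun z : ι → ℝ => sgn u * z :=
  measurable_const.mul measurable_id

lemma sgn_symmDiff (u v : Finset ι) : sgn u * sgn v = sgn (symmDiff u v) := by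
  funext i
  by_cases h : i ∈ u <;> by_cases h' : i ∈ v <;> simp [sgn, Finset.mem_symmDiff, h, h']

lemma one_coord' (P : Measure ℝ) [IsProbabilityMeasure P] {τ : ℝ → ℝ} (hτm : Measurable τ)
    (hτb : ∀ y, |τ y| ≤ 1)
    (hτo : ∀ φ : ℝ → ℝ, BM φ → (∀ y, φ (-y) = -φ y) → ∫ z, φ z ∂P = ∫ z, τ z * φ z ∂P)
    (k : ι) {ψ : (ι → ℝ) → ℝ} (hψ : BM ψ) :
    ∫ z, ψ z ∂(Measure.pi fun _ : ι => P)
      = ∫ z, ((1 + τ (z k)) * ψ z + (1 - τ (z k)) * ψ (sgn {k} * z)) / 2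
        ∂(Measure.pi fun _ : ι => P) := by
  have hτ0 : BM τ := ⟨hτm, 1, hτb⟩
  have hτ : BM (fun z : ι → ℝ => τ (z k)) := hτ0.comp (measurable_pi_apply k)
  have hψ' : BM (fun z => ψ (sgn {k} * z)) := hψ.comp (sgn_meas _)
  have hh : BM (fun _ : ι → ℝ => (1 / 2 : ℝ)) := BM.const _
  have hod : BM (fun z => 1 / 2 * (ψ z - ψ (sgn {k} * z))) := hh.mul (hψ.sub hψ')
  have hev : BM (fun z => 1 / 2 * (ψ z + ψ (sgn {k} * z))) := hh.mul (hψ.add hψ')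
  have h1 := one_coord P hτm hτb hτo k hod (by
    intro z; simp only [sgn_mul_self]; ring)
  calc ∫ z, ψ z ∂(Measure.pi fun _ : ι => P)
      = ∫ z, (1 / 2 * (ψ z + ψ (sgn {k} * z)) + 1 / 2 * (ψ z - ψ (sgn {k} * z)))
        ∂(Measure.pi fun _ : ι => P) := by
        congr 1; funext z; ring
    _ = ∫ z, (1 / 2 * (ψ z + ψ (sgn {k} * z)) + τ (z k) * (1 / 2 * (ψ z - ψ (sgn {k} * z))))
        ∂(Measure.pi fun _ : ι => P) := by
        rw [integral_add (hev.integrable _) (hod.integrable _), h1,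
          ← integral_add (hev.integrable _) ((hτ.mul hod).integrable _)]
    _ = _ := by congr 1; funext z; ring

end Entropy


section Entropy2

variable {ι : Type*} [Fintype ι] [DecidableEq ι]

lemma BM.prod {α κ : Type*} [MeasurableSpace α] (s : Finset κ) (f : κ → α → ℝ)
    (h : ∀ k ∈ s, BM (f k)) : BM (fun z => ∏ k ∈ s, f k z) := by
  classical
  induction s using Finset.induction_on with
  | empty => simpa using BM.const 1
  | insert k s hk ih =>
    simp only [Finset.prod_insert hk]
    exact (h k (Finset.mem_insert_self _ _)).mul (ih fun j hj => h j (Finset.mem_insert_of_mem hj))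

lemma sgn_insert {k : ι} {u : Finset ι} (hk : k ∉ u) : sgn (insert k u) = sgn {k} * sgn u := by
  funext i
  by_cases h : i = k
  · subst h; simp [sgn, hk]
  · simp [sgn, h]

lemma inv_BM {α : Type*} [MeasurableSpace α] {τ : α → ℝ} (hτm : Measurable τ)
    (hτb : ∀ y, |τ y| ≤ 1) {ε : ℝ} (hε : 0 < ε) : BM (fun z => (1 + ε + τ z)⁻¹) := by
  refine ⟨by fun_prop, ε⁻¹, fun z => ?_⟩
  have := (abs_le.1 (hτb z)).1
  have h2 : ε ≤ 1 + ε + τ z := by linarith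
  rw [abs_of_nonneg (inv_nonneg.2 (hε.le.trans h2))]
  exact inv_anti₀ hε h2

lemma density_iter (P : Measure ℝ) [IsProbabilityMeasure P] {τ : ℝ → ℝ} (hτm : Measurable τ)
    (hτb : ∀ y, |τ y| ≤ 1) (hτodd : ∀ y, τ (-y) = -τ y)
    (hτo : ∀ φ : ℝ → ℝ, BM φ → (∀ y, φ (-y) = -φ y) → ∫ z, φ z ∂P = ∫ z, τ z * φ z ∂P)
    {ε : ℝ} (hε : 0 < ε) (S : Finset ι) : ∀ {G : (ι → ℝ) → ℝ}, BM G → (∀ z, 0 ≤ G z) →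
    ∫ z, G z * ∏ j ∈ S, (1 + ε + τ (z j))⁻¹ ∂(Measure.pi fun _ : ι => P)
      ≤ (2⁻¹) ^ S.card * ∑ u ∈ S.powerset, ∫ z, G (sgn u * z) ∂(Measure.pi fun _ : ι => P) := by
  have hd : ∀ j : ι, BM (fun z : ι → ℝ => (1 + ε + τ (z j))⁻¹) := fun j =>
    (inv_BM hτm hτb hε).comp (measurable_pi_apply j)
  have hτ0 : BM τ := ⟨hτm, 1, hτb⟩
  have hdpos : ∀ y, 0 < 1 + ε + τ y := fun y => by linarith [(abs_le.1 (hτb y)).1]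
  induction S using Finset.induction_on with
  | empty =>
    intro G hG hG0
    have e : ∀ z : ι → ℝ, sgn ∅ * z = z := by
      intro z; funext i; simp [sgn]
    simp [e]
  | insert k S hk ih =>
    intro G hG hG0
    have hG' : BM (fun z => G (sgn {k} * z)) := hG.comp (sgn_meas _)
    have hBG : BM (fun z => 1 / 2 * (G z + G (sgn {k} * z))) := (BM.const _).mul (hG.add hG')
    have h1 := ih hBG (fun z => by have := hG0 z; have := hG0 (sgn {k} * z); positivity)
    have hpr : BM (fun z : ι → ℝ => ∏ j ∈ S, (1 + ε + τ (z j))⁻¹) := BM.prod _ _ fun j _ => hd j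
    have hτk : BM (fun z : ι → ℝ => τ (z k)) := hτ0.comp (measurable_pi_apply k)
    have hflip : ∀ z : ι → ℝ, ∏ j ∈ S, (1 + ε + τ ((sgn {k} * z) j))⁻¹
        = ∏ j ∈ S, (1 + ε + τ (z j))⁻¹ := by
      intro z
      refine Finset.prod_congr rfl fun j hj => ?_
      have : j ≠ k := fun e => hk (e ▸ hj)
      simp [sgn, this]
    have h2 : ∫ z, G z * ∏ j ∈ insert k S, (1 + ε + τ (z j))⁻¹ ∂(Measure.pi fun _ : ι => P)
        ≤ ∫ z, (1 / 2 * (G z + G (sgn {k} * z))) * ∏ j ∈ S, (1 + ε + τ (z j))⁻¹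
          ∂(Measure.pi fun _ : ι => P) := by
      have hψ : BM (fun z : ι → ℝ => G z * ∏ j ∈ insert k S, (1 + ε + τ (z j))⁻¹) :=
        hG.mul (BM.prod _ _ fun j _ => hd j)
      rw [one_coord' P hτm hτb hτo k hψ]
      have hψ' : BM (fun z : ι → ℝ =>
          G (sgn {k} * z) * ∏ j ∈ insert k S, (1 + ε + τ ((sgn {k} * z) j))⁻¹) :=
        hψ.comp (sgn_meas _)
      have hbig : BM (fun z : ι → ℝ =>
          ((1 + τ (z k)) * (G z * ∏ j ∈ insert k S, (1 + ε + τ (z j))⁻¹)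
          + (1 - τ (z k)) * (G (sgn {k} * z) *
            ∏ j ∈ insert k S, (1 + ε + τ ((sgn {k} * z) j))⁻¹)) / 2) := by
        have := ((((BM.const 1).add hτk).mul hψ).add (((BM.const 1).sub hτk).mul hψ')).mul
          (BM.const (1 / 2))
        simpa [div_eq_mul_inv] using this
      refine integral_mono (hbig.integrable _) ((hBG.mul hpr).integrable _) fun z => ?_
      simp only [Finset.prod_insert hk, hflip]
      have e1 : (sgn {k} * z) k = -z k := by simp [sgn]
      rw [e1, hτodd]
      set D := ∏ j ∈ S, (1 + ε + τ (z j))⁻¹ with hD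
      have hD0 : 0 ≤ D := Finset.prod_nonneg fun j _ => inv_nonneg.2 (hdpos _).le
      have hp := hdpos (z k)
      have hn : 0 < 1 + ε + -τ (z k) := by linarith [(abs_le.1 (hτb (z k))).2]
      have a1 : (1 + τ (z k)) * (1 + ε + τ (z k))⁻¹ ≤ 1 := by
        rw [← div_eq_mul_inv, div_le_one hp]; linarith
      have a2 : (1 - τ (z k)) * (1 + ε + -τ (z k))⁻¹ ≤ 1 := by
        rw [← div_eq_mul_inv, div_le_one hn]; linarith
      have b1 := mul_le_mul_of_nonneg_right a1 (mul_nonneg (hG0 z) hD0)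
      have b2 := mul_le_mul_of_nonneg_right a2 (mul_nonneg (hG0 (sgn {k} * z)) hD0)
      nlinarith [b1, b2]
    refine h2.trans (h1.trans ?_)
    rw [Finset.card_insert_of_notMem hk, pow_succ, mul_assoc]
    refine mul_le_mul_of_nonneg_left ?_ (by positivity)
    rw [Finset.sum_powerset_insert hk, ← Finset.sum_add_distrib, Finset.mul_sum]
    refine Finset.sum_le_sum fun u hu => ?_
    have hku : k ∉ u := fun h => hk (Finset.mem_powerset.1 hu h)
    rw [integral_const_mul, integral_add ((hG.comp (sgn_meas u)).integrable _)
      ((hG'.comp (sgn_meas u)).integrable _), sgn_insert hku]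
    apply le_of_eq
    simp only [mul_assoc, one_div]

lemma sum_sgn_prod (a : ℝ) (t : ι → ℝ) :
    ∑ w : Finset ι, ∏ i, (a + sgn w i * t i) = (2 * a) ^ Fintype.card ι := by
  have h := Finset.prod_add (fun i => a - t i) (fun i => a + t i) (Finset.univ : Finset ι)
  have h0 : ∏ i : ι, ((a - t i) + (a + t i)) = (2 * a) ^ Fintype.card ι := by
    rw [← Finset.card_univ, ← Finset.prod_const]
    exact Finset.prod_congr rfl fun i _ => by ring
  rw [← h0, h, Finset.powerset_univ]
  refine Finset.sum_congr rfl fun w _ => ?_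
  rw [← Finset.prod_sdiff (Finset.subset_univ w), mul_comm]
  congr 1
  · exact Finset.prod_congr rfl fun i hi => by simp [sgn, hi]; ring
  · refine Finset.prod_congr rfl fun i hi => ?_
    have : i ∉ w := (Finset.mem_sdiff.1 hi).2
    simp [sgn, this]

lemma coset_bound {P : Measure ℝ} {𝒞 : Finset (ι → ℝ)}
    (hsg : ∀ x ∈ 𝒞, ∀ i, x i = 1 ∨ x i = -1) {T : ι → (ι → ℝ) → ℝ}
    (hT : ∀ i, Opt P 𝒞 i (T i)) {a : ℝ} (ha : 1 ≤ a) (z : ι → ℝ) :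
    (𝒞.card : ℝ) * ∑ u : Finset ι, ∏ i, (a + T i (sgn u * z))
      ≤ 2 ^ Fintype.card ι * (2 * a) ^ Fintype.card ι := by
  classical
  have hx : ∀ x ∈ 𝒞, x = sgn (Finset.univ.filter fun i => x i = -1) := by
    intro x hx
    funext i
    rcases hsg x hx i with h | h
    · simp only [sgn, Finset.mem_filter, Finset.mem_univ, true_and, h]; norm_num
    · simp [sgn, h]
  have h1 : ∀ x ∈ 𝒞, ∑ u : Finset ι, ∏ i, (a + T i (sgn u * z))
      = ∑ u : Finset ι, ∏ i, (a + x i * T i (sgn u * z)) := by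
    intro x hxC
    set w := Finset.univ.filter fun i => x i = -1 with hw
    have e : ∀ u, ∏ i, (a + x i * T i (sgn u * z)) = ∏ i, (a + T i (sgn (symmDiff w u) * z)) := by
      intro u
      refine Finset.prod_congr rfl fun i _ => ?_
      rw [← (hT i).equi x hxC, ← sgn_symmDiff, hw, ← hx x hxC, mul_assoc]
    simp only [e]
    refine (Fintype.sum_equiv (Function.Involutive.toPerm (fun u => symmDiff w u) ?_) _ _ ?_).symm
    · intro u; simp
    · intro u; rfl
  have h2 : (𝒞.card : ℝ) * ∑ u : Finset ι, ∏ i, (a + T i (sgn u * z))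
      = ∑ x ∈ 𝒞, ∑ u : Finset ι, ∏ i, (a + x i * T i (sgn u * z)) := by
    rw [← Finset.sum_congr rfl h1, Finset.sum_const, nsmul_eq_mul]
  rw [h2, Finset.sum_comm]
  calc ∑ u : Finset ι, ∑ x ∈ 𝒞, ∏ i, (a + x i * T i (sgn u * z))
      ≤ ∑ u : Finset ι, (2 * a) ^ Fintype.card ι := by
        refine Finset.sum_le_sum fun u _ => ?_
        rw [← sum_sgn_prod a (fun i => T i (sgn u * z))]
        have hinj : Set.InjOn (fun x : ι → ℝ => Finset.univ.filter fun i => x i = -1)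
            (𝒞 : Set (ι → ℝ)) := by
          intro x hxC y hyC e
          rw [hx x hxC, hx y hyC]
          exact congrArg sgn e
        calc ∑ x ∈ 𝒞, ∏ i, (a + x i * T i (sgn u * z))
            = ∑ x ∈ 𝒞, ∏ i, (a + sgn (Finset.univ.filter fun i => x i = -1) i
                * T i (sgn u * z)) := by
              refine Finset.sum_congr rfl fun x hxC => ?_
              rw [← hx x hxC]
          _ = ∑ w ∈ 𝒞.image (fun x : ι → ℝ => Finset.univ.filter fun i => x i = -1),
                ∏ i, (a + sgn w i * T i (sgn u * z)) := by
              rw [Finset.sum_image hinj]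
          _ ≤ ∑ w : Finset ι, ∏ i, (a + sgn w i * T i (sgn u * z)) := by
              refine Finset.sum_le_sum_of_subset_of_nonneg (Finset.subset_univ _) fun w _ _ => ?_
              refine Finset.prod_nonneg fun i _ => ?_
              have := abs_le.1 ((hT i).bdd (sgn u * z))
              by_cases hi : i ∈ w
              · simp [sgn, hi]; linarith [this.2]
              · simp [sgn, hi]; linarith [this.1]
    _ = 2 ^ Fintype.card ι * (2 * a) ^ Fintype.card ι := by
        simp [Finset.sum_const, Fintype.card_finset]

end Entropy2


section Entropy3

/-- Symmetrized logarithm. -/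
noncomputable def phiE (ε t : ℝ) : ℝ :=
  ((1 + t) * Real.log (1 + ε + t) + (1 - t) * Real.log (1 + ε - t)) / 2

lemma term_bound {s ε : ℝ} (hs : 0 ≤ s) (hε : 0 < ε) :
    s * (Real.log (s / 2) + Real.log 2) ≤ s * Real.log (s + ε) ∧
    s * Real.log (s + ε) ≤ s * (Real.log (s / 2) + Real.log 2) + ε := by
  rcases hs.eq_or_lt with rfl | hs
  · simp [hε.le]
  · rw [Real.log_div hs.ne' (by norm_num)]
    constructor
    · refine mul_le_mul_of_nonneg_left ?_ hs.le
      have := Real.log_le_log hs (by linarith : s ≤ s + ε)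
      linarith
    · have h1 : Real.log ((s + ε) / s) ≤ (s + ε) / s - 1 :=
        Real.log_le_sub_one_of_pos (by positivity)
      rw [Real.log_div (by positivity) hs.ne'] at h1
      have h2 : (s + ε) / s - 1 = ε / s := by field_simp; ring
      rw [h2] at h1
      have h3 := mul_le_mul_of_nonneg_left h1 hs.le
      have h4 : s * (ε / s) = ε := by field_simp
      rw [h4] at h3
      linarith

lemma phiE_bounds {ε t : ℝ} (hε : 0 < ε) (ht : |t| ≤ 1) :
    Real.log 2 * (1 - hb ((1 + t) / 2)) ≤ phiE ε t ∧
    phiE ε t ≤ Real.log 2 * (1 - hb ((1 + t) / 2)) + ε := by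
  have hl : Real.log 2 ≠ 0 := (Real.log_pos (by norm_num)).ne'
  have ht' := abs_le.1 ht
  have e : Real.log 2 * (1 - hb ((1 + t) / 2))
      = ((1 + t) * (Real.log ((1 + t) / 2) + Real.log 2)
        + (1 - t) * (Real.log ((1 - t) / 2) + Real.log 2)) / 2 := by
    rw [hb_eq_binEntropy, Real.binEntropy, Real.log_inv, Real.log_inv]
    have : 1 - (1 + t) / 2 = (1 - t) / 2 := by ring
    rw [this]
    field_simp
    ring
  have a := term_bound (s := 1 + t) (by linarith [ht'.1]) hε
  have b := term_bound (s := 1 - t) (by linarith [ht'.2]) hε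
  have e1 : 1 + ε + t = 1 + t + ε := by ring
  have e2 : 1 + ε - t = 1 - t + ε := by ring
  rw [e, phiE, e1, e2]
  constructor <;> linarith [a.1, a.2, b.1, b.2]

lemma log_BM {α : Type*} [MeasurableSpace α] {T : α → ℝ} (hTm : Measurable T)
    (hTb : ∀ y, |T y| ≤ 1) {ε : ℝ} (hε : 0 < ε) : BM (fun z => Real.log (1 + ε + T z)) := by
  refine ⟨by fun_prop, |Real.log ε| + |Real.log (2 + ε)|, fun z => ?_⟩
  have h := abs_le.1 (hTb z)
  have h1 := Real.log_le_log hε (by linarith [h.1] : ε ≤ 1 + ε + T z)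
  have h2 := Real.log_le_log (by linarith [h.1] : 0 < 1 + ε + T z)
    (by linarith [h.2] : 1 + ε + T z ≤ 2 + ε)
  rw [abs_le]
  constructor
  · linarith [neg_abs_le (Real.log ε), abs_nonneg (Real.log (2 + ε))]
  · linarith [le_abs_self (Real.log (2 + ε)), abs_nonneg (Real.log ε)]

lemma phiE_int {α : Type*} [MeasurableSpace α] {μ : Measure α} [IsProbabilityMeasure μ]
    {T : α → ℝ} (hTm : Measurable T) (hTb : ∀ y, |T y| ≤ 1) {ε : ℝ} (hε : 0 < ε)
    (ho : ∫ z, (Real.log (1 + ε + T z) - Real.log (1 + ε + -T z)) ∂μ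
      = ∫ z, T z * (Real.log (1 + ε + T z) - Real.log (1 + ε + -T z)) ∂μ) :
    ∫ z, Real.log (1 + ε + T z) ∂μ = ∫ z, phiE ε (T z) ∂μ := by
  have h1 := log_BM hTm hTb hε
  have h2 := log_BM (T := fun z => -T z) hTm.neg (fun y => by simpa using hTb y) hε
  have hT : BM T := ⟨hTm, 1, hTb⟩
  have hs := (BM.const (α := α) (1 / 2)).mul (h1.add h2)
  have hd := h1.sub h2
  have hTd := hT.mul hd
  calc ∫ z, Real.log (1 + ε + T z) ∂μ
      = ∫ z, (1 / 2 * (Real.log (1 + ε + T z) + Real.log (1 + ε + -T z))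
          + 1 / 2 * (Real.log (1 + ε + T z) - Real.log (1 + ε + -T z))) ∂μ := by
        congr 1; funext z; ring
    _ = ∫ z, (1 / 2 * (Real.log (1 + ε + T z) + Real.log (1 + ε + -T z))
          + 1 / 2 * (T z * (Real.log (1 + ε + T z) - Real.log (1 + ε + -T z)))) ∂μ := by
        rw [integral_add (hs.integrable _) (((BM.const (1 / 2)).mul hd).integrable _),
          integral_add (hs.integrable _) (((BM.const (1 / 2)).mul hTd).integrable _),
          integral_const_mul (1 / 2 : ℝ) (fun z => Real.log (1 + ε + T z)
            - Real.log (1 + ε + -T z)), ho,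
          ← integral_const_mul]
    _ = _ := by
        congr 1; funext z
        simp only [phiE, sub_eq_add_neg]; ring

lemma phiE_int_bounds {α : Type*} [MeasurableSpace α] {μ : Measure α} [IsProbabilityMeasure μ]
    {T : α → ℝ} (hTm : Measurable T) (hTb : ∀ y, |T y| ≤ 1) {ε : ℝ} (hε : 0 < ε) :
    Real.log 2 * (1 - ∫ z, hb ((1 + T z) / 2) ∂μ) ≤ ∫ z, phiE ε (T z) ∂μ ∧
    ∫ z, phiE ε (T z) ∂μ ≤ Real.log 2 * (1 - ∫ z, hb ((1 + T z) / 2) ∂μ) + ε := by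
  have h1 := log_BM hTm hTb hε
  have h2 := log_BM (T := fun z => -T z) hTm.neg (fun y => by simpa using hTb y) hε
  have hT : BM T := ⟨hTm, 1, hTb⟩
  have hh := hb_comp_BM hTm hTb
  have hph : BM (fun z => phiE ε (T z)) := by
    have := ((((BM.const 1).add hT).mul h1).add (((BM.const 1).sub hT).mul h2)).mul
      (BM.const (1 / 2))
    simpa [phiE, div_eq_mul_inv, sub_eq_add_neg] using this
  have hL := (BM.const (α := α) (Real.log 2)).mul ((BM.const 1).sub hh)
  have e : ∫ z, Real.log 2 * (1 - hb ((1 + T z) / 2)) ∂μ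
      = Real.log 2 * (1 - ∫ z, hb ((1 + T z) / 2) ∂μ) := by
    rw [integral_const_mul, integral_sub (integrable_const _) (hh.integrable _)]
    simp
  constructor
  · rw [← e]
    exact integral_mono (hL.integrable _) (hph.integrable _) fun z => (phiE_bounds hε (hTb z)).1
  · have e2 : ∫ z, (Real.log 2 * (1 - hb ((1 + T z) / 2)) + ε) ∂μ
        = Real.log 2 * (1 - ∫ z, hb ((1 + T z) / 2) ∂μ) + ε := by
      rw [integral_add (hL.integrable _) (integrable_const _), e]
      simp
    rw [← e2]
    exact integral_mono (hph.integrable _) ((hL.add (BM.const ε)).integrable _)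
      fun z => (phiE_bounds hε (hTb z)).2

variable {ι : Type*} [Fintype ι] [DecidableEq ι]

lemma entropy_eps (P : Measure ℝ) [IsProbabilityMeasure P] {τ : ℝ → ℝ} (hτm : Measurable τ)
    (hτb : ∀ y, |τ y| ≤ 1) (hτodd : ∀ y, τ (-y) = -τ y)
    (hτo : ∀ φ : ℝ → ℝ, BM φ → (∀ y, φ (-y) = -φ y) → ∫ z, φ z ∂P = ∫ z, τ z * φ z ∂P)
    {𝒞 : Finset (ι → ℝ)} (hne : 𝒞.Nonempty)
    (hsg : ∀ x ∈ 𝒞, ∀ i, x i = 1 ∨ x i = -1) {T : ι → (ι → ℝ) → ℝ}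
    (hT : ∀ i, Opt P 𝒞 i (T i)) {ε : ℝ} (hε : 0 < ε) :
    Real.log 𝒞.card ≤ Real.log 2 * (∑ i, ∫ z, hb ((1 + T i z) / 2) ∂(Measure.pi fun _ : ι => P)
      + Fintype.card ι * (1 - ∫ z, hb ((1 + τ z) / 2) ∂P)) + 2 * Fintype.card ι * ε := by
  set N := Fintype.card ι with hN
  have hcard : (0 : ℝ) < 𝒞.card := by exact_mod_cast hne.card_pos
  set c : ℝ := (2 * (1 + ε)) ^ N / 𝒞.card with hc
  have hcpos : 0 < c := by positivity
  have hTpos : ∀ i z, 0 < 1 + ε + T i z := fun i z => by linarith [(abs_le.1 ((hT i).bdd z)).1]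
  have hτpos : ∀ y, 0 < 1 + ε + τ y := fun y => by linarith [(abs_le.1 (hτb y)).1]
  have hGb : BM (fun z => ∏ i, (1 + ε + T i z)) :=
    BM.prod _ _ fun i _ => (BM.const (1 + ε)).add (hT i).bm
  have hDb : BM (fun z : ι → ℝ => ∏ j : ι, (1 + ε + τ (z j))⁻¹) :=
    BM.prod _ _ fun j _ => (inv_BM hτm hτb hε).comp (measurable_pi_apply j)
  -- the main bound
  have hmain : ∫ z, (∏ i, (1 + ε + T i z)) * ∏ j, (1 + ε + τ (z j))⁻¹
      ∂(Measure.pi fun _ : ι => P) ≤ c := by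
    refine (density_iter P hτm hτb hτodd hτo hε Finset.univ hGb
      (fun z => Finset.prod_nonneg fun i _ => (hTpos i z).le)).trans ?_
    rw [← integral_finset_sum _ fun u _ => (hGb.comp (sgn_meas u)).integrable _]
    rw [← integral_const_mul]
    have hsumb : ∀ z : ι → ℝ, 2⁻¹ ^ (Finset.univ : Finset ι).card *
        ∑ u ∈ (Finset.univ : Finset ι).powerset, ∏ i, (1 + ε + T i (sgn u * z)) ≤ c := by
      intro z
      have h := coset_bound hsg hT (a := 1 + ε) (by linarith) z
      rw [Finset.powerset_univ, Finset.card_univ, hc, le_div_iff₀ hcard, inv_pow]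
      rw [← hN] at *
      rw [inv_mul_eq_div, div_mul_eq_mul_div, div_le_iff₀ (by positivity)]
      linarith
    have hintg : Integrable (fun z : ι → ℝ => 2⁻¹ ^ (Finset.univ : Finset ι).card *
        ∑ u ∈ (Finset.univ : Finset ι).powerset, ∏ i, (1 + ε + T i (sgn u * z)))
        (Measure.pi fun _ : ι => P) :=
      (integrable_finset_sum _ fun u _ => (hGb.comp (sgn_meas u)).integrable _).const_mul _
    calc _ ≤ ∫ _, c ∂(Measure.pi fun _ : ι => P) :=
          integral_mono hintg (integrable_const _) hsumb
      _ = c := by simp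
  -- logarithms
  have hlogT : ∀ i, BM (fun z => Real.log (1 + ε + T i z)) := fun i =>
    log_BM (hT i).meas (hT i).bdd hε
  have hlogτ : BM (fun z => Real.log (1 + ε + τ z)) := log_BM hτm hτb hε
  have hlog : ∑ i, ∫ z, Real.log (1 + ε + T i z) ∂(Measure.pi fun _ : ι => P)
      - N * ∫ z, Real.log (1 + ε + τ z) ∂P ≤ Real.log c := by
    have hI1 : Integrable (fun z => ∑ i, Real.log (1 + ε + T i z))
        (Measure.pi fun _ : ι => P) :=
      integrable_finset_sum _ fun i _ => (hlogT i).integrable _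
    have hI2 : Integrable (fun z : ι → ℝ => ∑ j, Real.log (1 + ε + τ (z j)))
        (Measure.pi fun _ : ι => P) :=
      integrable_finset_sum _ fun j _ => (hlogτ.comp (measurable_pi_apply j)).integrable _
    have e2 : ∫ z, ∑ j : ι, Real.log (1 + ε + τ (z j)) ∂(Measure.pi fun _ : ι => P)
        = N * ∫ z, Real.log (1 + ε + τ z) ∂P := by
      rw [integral_finset_sum _ fun j _ => (hlogτ.comp (measurable_pi_apply j)).integrable _]
      rw [Finset.sum_congr rfl (g := fun _ => ∫ z, Real.log (1 + ε + τ z) ∂P)]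
      · simp [hN]
      · intro j _
        exact mp_int (measurePreserving_eval (fun _ : ι => P) j) hlogτ
    rw [← integral_finset_sum _ fun i _ => (hlogT i).integrable _, ← e2, ← integral_sub hI1 hI2]
    have hGD := hGb.mul hDb
    calc ∫ z, (∑ i, Real.log (1 + ε + T i z) - ∑ j, Real.log (1 + ε + τ (z j)))
          ∂(Measure.pi fun _ : ι => P)
        ≤ ∫ z, (c⁻¹ * ((∏ i, (1 + ε + T i z)) * ∏ j, (1 + ε + τ (z j))⁻¹) + (Real.log c - 1))
          ∂(Measure.pi fun _ : ι => P) := by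
          refine integral_mono (hI1.sub hI2)
            (((hGD.integrable _).const_mul _).add (integrable_const _)) fun z => ?_
          simp only
          have hp1 : 0 < ∏ i, (1 + ε + T i z) := Finset.prod_pos fun i _ => hTpos i z
          have hp2 : 0 < ∏ j, (1 + ε + τ (z j))⁻¹ :=
            Finset.prod_pos fun j _ => inv_pos.2 (hτpos _)
          have h1 := Real.log_le_sub_one_of_pos (x := c⁻¹ * ((∏ i, (1 + ε + T i z))
            * ∏ j, (1 + ε + τ (z j))⁻¹)) (by positivity)
          rw [Real.log_mul (by positivity) (by positivity), Real.log_mul hp1.ne' hp2.ne',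
            Real.log_inv, Real.log_prod fun i _ => (hTpos i z).ne',
            Real.log_prod fun j _ => (inv_pos.2 (hτpos (z j))).ne'] at h1
          simp only [Real.log_inv, Finset.sum_neg_distrib] at h1
          linarith
      _ ≤ Real.log c := by
          rw [integral_add ((hGD.integrable _).const_mul _) (integrable_const _),
            integral_const_mul]
          have := mul_le_mul_of_nonneg_left hmain (inv_pos.2 hcpos).le
          rw [inv_mul_cancel₀ hcpos.ne'] at this
          simp only [integral_const, probReal_univ, one_smul]
          linarith
  -- symmetrization
  have hTi : ∀ i, Real.log 2 * (1 - ∫ z, hb ((1 + T i z) / 2) ∂(Measure.pi fun _ : ι => P))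
      ≤ ∫ z, Real.log (1 + ε + T i z) ∂(Measure.pi fun _ : ι => P) := by
    intro i
    rw [phiE_int (hT i).meas (hT i).bdd hε]
    · exact (phiE_int_bounds (hT i).meas (hT i).bdd hε).1
    · refine (hT i).orth (fun z => Real.log (1 + ε + T i z) - Real.log (1 + ε + -T i z))
        ((hlogT i).sub (log_BM (T := fun z => -T i z) (hT i).meas.neg
          (fun y => by simpa using (hT i).bdd y) hε)) ?_ ?_
      · intro y y' hy
        simp only [(hT i).ind y y' hy]
      · intro x hx y
        simp only [(hT i).equi x hx]
        rcases hsg x hx i with h | h <;> simp [h]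
  have hτi : ∫ z, Real.log (1 + ε + τ z) ∂P
      ≤ Real.log 2 * (1 - ∫ z, hb ((1 + τ z) / 2) ∂P) + ε := by
    rw [phiE_int hτm hτb hε]
    · exact (phiE_int_bounds hτm hτb hε).2
    · refine hτo (fun z => Real.log (1 + ε + τ z) - Real.log (1 + ε + -τ z))
        (hlogτ.sub (log_BM (T := fun z => -τ z) hτm.neg
          (fun y => by simpa using hτb y) hε)) ?_
      intro y
      simp only [hτodd, neg_neg]; ring
  have hlc : Real.log c = N * (Real.log 2 + Real.log (1 + ε)) - Real.log 𝒞.card := by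
    rw [hc, Real.log_div (by positivity) hcard.ne', Real.log_pow,
      Real.log_mul (by norm_num) (by positivity)]
  have hl1 : Real.log (1 + ε) ≤ ε := by
    have := Real.log_le_sub_one_of_pos (x := 1 + ε) (by positivity); linarith
  have hS : ∑ i : ι, Real.log 2 * (1 - ∫ z, hb ((1 + T i z) / 2) ∂(Measure.pi fun _ : ι => P))
      ≤ ∑ i, ∫ z, Real.log (1 + ε + T i z) ∂(Measure.pi fun _ : ι => P) :=
    Finset.sum_le_sum fun i _ => hTi i
  rw [← Finset.mul_sum, Finset.sum_sub_distrib] at hS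
  simp only [Finset.sum_const, Finset.card_univ, nsmul_eq_mul, mul_one, ← hN] at hS
  have hN0 : (0 : ℝ) ≤ N := by positivity
  have a1 := mul_le_mul_of_nonneg_left hτi hN0
  have a2 := mul_le_mul_of_nonneg_left hl1 hN0
  rw [hlc] at hlog
  nlinarith [hlog, hS, a1, a2]

end Entropy3


section Final

lemma hb_jensen {α : Type*} [MeasurableSpace α] (ν : Measure α) [IsProbabilityMeasure ν]
    {T : α → ℝ} (hT : Measurable T) (hb1 : ∀ y, |T y| ≤ 1) :
    ∫ y, hb ((1 + T y) / 2) ∂ν ≤ hb ((1 + ∫ y, T y ∂ν) / 2) := by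
  have hl : 0 < Real.log 2 := Real.log_pos (by norm_num)
  have hcc : ConcaveOn ℝ (Set.Icc (0 : ℝ) 1) hb := by
    have h := Real.strictConcave_binEntropy.concaveOn.smul (c := (Real.log 2)⁻¹) (by positivity)
    refine h.congr ?_
    intro p _
    simp only [smul_eq_mul, hb_eq_binEntropy]
    ring
  have hTB : BM T := ⟨hT, 1, hb1⟩
  have hi : Integrable (fun y => (1 + T y) / 2) ν :=
    ((integrable_const (1 : ℝ)).add (hTB.integrable ν)).div_const 2
  have h := hcc.le_map_integral (μ := ν) (f := fun y => (1 + T y) / 2)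
    hb_continuous.continuousOn isClosed_Icc
    (Filter.Eventually.of_forall fun y => by
      have := abs_le.1 (hb1 y)
      constructor <;> linarith)
    hi ((hb_comp_BM hT hb1).integrable ν)
  have e : ∫ y, (1 + T y) / 2 ∂ν = (1 + ∫ y, T y ∂ν) / 2 := by
    rw [integral_div, integral_add (integrable_const (1 : ℝ)) (hTB.integrable ν)]
    simp
  rw [e] at h
  exact h

lemma entropy_final (P : Measure ℝ) [IsProbabilityMeasure P] (r m : ℕ)
    {T : (Fin (2 ^ m) → ℝ) → ℝ} (h : Opt P (bpskRM r m) (orig m) T) :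
    RMrate r m - capacity P ≤ hb ((1 + ∫ z, T z ∂(Measure.pi fun _ => P)) / 2) := by
  have hl : 0 < Real.log 2 := Real.log_pos (by norm_num)
  obtain ⟨τ, hτm, hτb, hτodd, hτo, hcap⟩ := tau_exists P
  choose S hS using fun i => opt_exists P r m i
  set q := ∫ z, T z ∂(Measure.pi fun _ : Fin (2 ^ m) => P) with hq
  have hi : ∀ i, ∫ z, hb ((1 + S i z) / 2) ∂(Measure.pi fun _ : Fin (2 ^ m) => P)
      ≤ hb ((1 + q) / 2) := by
    intro i
    have h1 := hb_jensen (Measure.pi fun _ : Fin (2 ^ m) => P) (hS i).meas (hS i).bdd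
    rwa [opt_int_eq (hS i) h] at h1
  have hsum := Finset.sum_le_card_nsmul Finset.univ _ _ fun i _ => hi i
  simp only [Finset.card_univ, Fintype.card_fin, nsmul_eq_mul, Nat.cast_pow,
    Nat.cast_ofNat] at hsum
  have hN : (0 : ℝ) < 2 ^ m := by positivity
  set K : ℕ := ∑ i ∈ Finset.range (r + 1), m.choose i with hK
  have hR : RMrate r m * 2 ^ m = K := by
    rw [RMrate, hK]; push_cast; field_simp
  have hcard : K * Real.log 2 ≤ Real.log (bpskRM r m).card := by
    rw [← Real.log_pow]
    apply Real.log_le_log (by positivity)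
    exact_mod_cast card_bpskRM_ge r m
  have key : ∀ ε > 0, K * Real.log 2 ≤
      Real.log 2 * (2 ^ m * hb ((1 + q) / 2) + 2 ^ m * capacity P) + ε := by
    intro ε hε
    have h1 := entropy_eps P hτm hτb hτodd hτo (bpskRM_nonempty r m) bpskRM_sign hS
      (ε := ε / (2 * 2 ^ m)) (by positivity)
    simp only [Fintype.card_fin, Nat.cast_pow, Nat.cast_ofNat] at h1
    have e : 2 * (2 : ℝ) ^ m * (ε / (2 * 2 ^ m)) = ε := by field_simp
    rw [e] at h1
    refine hcard.trans (h1.trans ?_)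
    gcongr
  have h2 := le_of_forall_pos_le_add key
  have h3 : (K : ℝ) ≤ 2 ^ m * hb ((1 + q) / 2) + 2 ^ m * capacity P := by
    rw [mul_comm] at h2
    exact le_of_mul_le_mul_left h2 hl
  rw [← hR] at h3
  have : 2 ^ m * RMrate r m ≤ 2 ^ m * (hb ((1 + q) / 2) + capacity P) := by linarith
  have := le_of_mul_le_mul_left this hN
  linarith

end Final


/-- For an RM(r,m) code over a BMS channel with capacity `C ∈ (0,1)`, if
`R(r,m) > C` then for every coordinate `i`, the extrinsic MMSE satisfies
`mmse(X_i | Y_{∼i}) ≥ 1 − (1−C)·ρ(m)/(ψ(1−C)·Ψ(R(r,m)−C))`. -/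
theorem stmt_4
    {Ω : Type*} [MeasurableSpace Ω] (μ : Measure Ω) [IsProbabilityMeasure μ]
    (PZ : Measure ℝ) [IsProbabilityMeasure PZ]
    (hC0 : 0 < capacity PZ) (hC1 : capacity PZ < 1)
    (r m : ℕ) (hrm : r ≤ m) (hm : 1 ≤ m)
    (X Z : Ω → (Fin (2 ^ m) → ℝ)) (hX : Measurable X) (hZ : Measurable Z)
    (hlaw : Measure.map (fun ω => (X ω, Z ω)) μ
        = (uniformOnFinset (bpskRM r m)).prod (Measure.pi fun _ => PZ))
    (hrate : capacity PZ < RMrate r m) :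
    ∀ i : Fin (2 ^ m),
      mmse μ (fun ω => X ω i)
          (fun ω => fun j : {j : Fin (2 ^ m) // j ≠ i} => X ω j.1 * Z ω j.1)
        ≥ 1 - (1 - capacity PZ) * rho m /
            (psi (1 - capacity PZ) * PsiInt (RMrate r m - capacity PZ)) := by
  intro i
  choose T hT using fun j => opt_exists PZ r j (orig j)
  have hq0 : ∀ j, 0 ≤ ∫ z, T j z ∂(Measure.pi fun _ => PZ) := fun j => (hT j).nonneg
  have hq1 : ∀ j, ∫ z, T j z ∂(Measure.pi fun _ => PZ) ≤ 1 := fun j => (hT j).le_one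
  have hfin := final_assembly (capacity PZ) hC0 hC1 r m hm
    (fun j => ∫ z, T j z ∂(Measure.pi fun _ => PZ)) (fun j _ => hq0 j) (fun j _ => hq1 j)
    (fun j _ => two_look (hT j) (hT (j + 1)) rfl rfl)
    (fun j _ => psi_le_of_hb (hq0 j) (hq1 j) (entropy_final PZ r j (hT j))) hrate
  obtain ⟨S, hS, he⟩ := cond_exists μ PZ (bpskRM_nonempty r m) bpskRM_sign bpskRM_mul
    X Z hX hZ hlaw i
  rw [he, opt_int_eq hS (hT m)]
  linarith
end

section
/- Let X be a {−1,+1}-valued random variable with mean μ = E[X] ∈ [−1,1], let Z be a real-valued random variable, and let U be a random variable such that Z is independent of the pair (X, U). Set Y := X·Z. Let X_u be uniform on {±1}, independent of Z' where Z' has the same law as Z, and set Y_u := X_u·Z'. Define q_k := E[ (E[X_u | Y_u])^{2k} ] for k ≥ 1 and c_k := 1/(ln(2)·2k·(2k−1)). Then: (a) E[ h_b( (1 + E[X|Y])/2 ) ] = Σ_{k=1}^{∞} c_k·(1 − q_k)·(1 − μ^{2k}); and (b) E[ h_b( (1 + E[X | Y, U])/2 ) ] = Σ_{k=1}^{∞}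 c_k·(1 − q_k)·(1 − E[ (E[X|U])^{2k} ]). -/
open MeasureTheory ProbabilityTheory

/-- The entropy of a sign with mean `x`. -/
noncomputable def gent (x : ℝ) : ℝ := hb ((1 + x) / 2)

lemma gent_eq (x : ℝ) : gent x
    = (Real.negMulLog ((1 + x) / 2) + Real.negMulLog ((1 - x) / 2)) / Real.log 2 := by
  have h : 1 - (1 + x) / 2 = (1 - x) / 2 := by ring
  unfold gent hb Real.negMulLog Real.logb
  rw [h]; ring

lemma gent_eq' (x : ℝ) : gent x
    = 1 + (Real.negMulLog (1 + x) + Real.negMulLog (1 - x)) / (2 * Real.log 2) := by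
  have h2 : Real.log 2 ≠ 0 := (Real.log_pos one_lt_two).ne'
  have hh : Real.negMulLog (1 / 2) = Real.log 2 / 2 := by
    unfold Real.negMulLog
    rw [one_div, Real.log_inv]; ring
  rw [gent_eq, show (1 + x) / 2 = (1 + x) * (1 / 2) by ring,
    show (1 - x) / 2 = (1 - x) * (1 / 2) by ring, Real.negMulLog_mul, Real.negMulLog_mul, hh]
  field_simp
  ring

lemma gent_continuous : Continuous gent := by
  have : gent = fun x =>
      1 + (Real.negMulLog (1 + x) + Real.negMulLog (1 - x)) / (2 * Real.log 2) := funext gent_eq'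
  rw [this]
  fun_prop

lemma gent_abs_le {x : ℝ} (hx : |x| ≤ 1) : |gent x| ≤ 1 := by
  have h2 : 0 < Real.log 2 := Real.log_pos one_lt_two
  have hx' := abs_le.1 hx
  have e : gent x = Real.binEntropy ((1 + x) / 2) / Real.log 2 := by
    rw [gent_eq, Real.binEntropy_eq_negMulLog_add_negMulLog_one_sub,
      show 1 - (1 + x) / 2 = (1 - x) / 2 by ring]
  rw [e, abs_of_nonneg (div_nonneg (Real.binEntropy_nonneg (by linarith) (by linarith)) h2.le),
    div_le_one h2]
  exact Real.binEntropy_le_log_two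

lemma ck_nonneg (k : ℕ) : 0 ≤ ck (k + 1) := by
  have h2 : 0 < Real.log 2 := Real.log_pos one_lt_two
  unfold ck
  push_cast
  have : (0 : ℝ) ≤ 2 * (k + 1) - 1 := by have := k.cast_nonneg (α := ℝ); linarith
  positivity

lemma ck_summable : Summable fun k : ℕ => ck (k + 1) := by
  have h2 : 0 < Real.log 2 := Real.log_pos one_lt_two
  have hs : Summable fun k : ℕ => (1 / Real.log 2) * (1 / ((k + 1 : ℕ) : ℝ) ^ 2) :=
    ((summable_nat_add_iff 1).2 (Real.summable_one_div_nat_pow.2 one_lt_two)).mul_left _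
  refine Summable.of_nonneg_of_le ck_nonneg (fun k => ?_) hs
  unfold ck
  push_cast
  have hk := k.cast_nonneg (α := ℝ)
  rw [← one_div_mul_one_div_rev] 
  rw [one_div_mul_one_div_rev, div_mul_div_comm, one_mul]
  refine one_div_le_one_div_of_le (by positivity) ?_
  nlinarith [mul_nonneg h2.le hk, mul_nonneg (mul_nonneg h2.le hk) hk]

lemma gent_series_aux {x : ℝ} (hx : |x| < 1) :
    gent x = 1 - ∑' k : ℕ, ck (k + 1) * x ^ (2 * (k + 1)) := by
  have h2 : Real.log 2 ≠ 0 := (Real.log_pos one_lt_two).ne'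
  have h1 := Real.hasSum_log_sub_log_of_abs_lt_one hx
  have hx2 : |x ^ 2| < 1 := by
    rw [abs_pow]; exact pow_lt_one₀ (abs_nonneg _) hx two_ne_zero
  have h3 := Real.hasSum_pow_div_log_of_abs_lt_one hx2
  have h4 := ((h1.mul_left x).sub h3).mul_left (1 / (2 * Real.log 2))
  have hx' := abs_lt.1 hx
  have e : (fun k : ℕ => ck (k + 1) * x ^ (2 * (k + 1))) = fun k : ℕ =>
      1 / (2 * Real.log 2) * (x * (2 * (1 / (2 * (k : ℝ) + 1)) * x ^ (2 * k + 1))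
        - (x ^ 2) ^ (k + 1) / ((k : ℝ) + 1)) := by
    funext k
    have hk := k.cast_nonneg (α := ℝ)
    have ha : (2 * (k : ℝ) + 1) ≠ 0 := by positivity
    have hb : ((k : ℝ) + 1) ≠ 0 := by positivity
    have hc : (2 * ((k : ℝ) + 1) - 1) ≠ 0 := by
      rw [show (2 * ((k : ℝ) + 1) - 1) = 2 * k + 1 by ring]; exact ha
    unfold ck
    push_cast
    rw [show (2 * ((k : ℝ) + 1) - 1) = 2 * k + 1 by ring, ← pow_mul]
    field_simp
    ring
  rw [e, h4.tsum_eq, gent_eq']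
  have hl : Real.log (1 - x ^ 2) = Real.log (1 + x) + Real.log (1 - x) := by
    rw [← Real.log_mul (by linarith) (by linarith)]; ring_nf
  rw [hl]
  unfold Real.negMulLog
  field_simp
  ring

lemma gent_series' {x : ℝ} (hx : |x| ≤ 1) :
    gent x = 1 - ∑' k : ℕ, ck (k + 1) * x ^ (2 * (k + 1)) := by
  have hc : ContinuousOn (fun x : ℝ => ∑' k : ℕ, ck (k + 1) * x ^ (2 * (k + 1)))
      (Set.Icc (-1) 1) := by
    refine continuousOn_tsum (fun i => by fun_prop) ck_summable (fun n y hy => ?_)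
    rw [norm_mul, norm_pow, Real.norm_eq_abs, Real.norm_eq_abs, abs_of_nonneg (ck_nonneg n)]
    exact mul_le_of_le_one_right (ck_nonneg n) (pow_le_one₀ (abs_nonneg _) (abs_le.2 hy))
  have hE : Set.EqOn gent (fun x : ℝ => 1 - ∑' k : ℕ, ck (k + 1) * x ^ (2 * (k + 1)))
      (Set.Icc (-1) 1) := by
    refine Set.EqOn.of_subset_closure (s := Set.Ioo (-1) 1)
      (fun y hy => gent_series_aux (abs_lt.2 hy)) gent_continuous.continuousOn
      (continuousOn_const.sub hc) Set.Ioo_subset_Icc_self ?_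
    rw [closure_Ioo (by norm_num)]
  exact hE (abs_le.1 hx)

lemma ck_mul_summable {x : ℝ} (hx : |x| ≤ 1) :
    Summable fun k : ℕ => ck (k + 1) * x ^ (2 * (k + 1)) := by
  refine Summable.of_norm_bounded ck_summable fun n => ?_
  rw [norm_mul, norm_pow, Real.norm_eq_abs, Real.norm_eq_abs, abs_of_nonneg (ck_nonneg n)]
  exact mul_le_of_le_one_right (ck_nonneg n) (pow_le_one₀ (abs_nonneg _) hx)

lemma ck_tsum : ∑' k : ℕ, ck (k + 1) = 1 := by
  have h := gent_series' (x := 1) (by simp)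
  have h0 : gent 1 = 0 := by
    rw [gent_eq]; norm_num
  simp only [one_pow, mul_one] at h
  linarith

lemma gent_comb {m s : ℝ} (hm : |m| ≤ 1) (hs : |s| ≤ 1) :
    gent m + gent s - gent (m * s)
      = ∑' k : ℕ, ck (k + 1) * ((1 - m ^ (2 * (k + 1))) * (1 - s ^ (2 * (k + 1)))) := by
  have hms : |m * s| ≤ 1 := by
    rw [abs_mul]; exact mul_le_one₀ hm (abs_nonneg _) hs
  have a := ck_summable.hasSum
  rw [ck_tsum] at a
  have b := (ck_mul_summable hm).hasSum
  have c := (ck_mul_summable hs).hasSum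
  have d := (ck_mul_summable hms).hasSum
  rw [gent_series' hm, gent_series' hs, gent_series' hms]
  have := (((a.sub b).sub c).add d).tsum_eq
  rw [show ∀ p q r : ℝ, 1 - p + (1 - q) - (1 - r) = 1 - p - q + r by intros; ring, ← this]
  congr 1
  funext k
  rw [mul_pow]; ring

/-- Posterior mean combination. -/
noncomputable def comb (m s : ℝ) : ℝ := (m + s) / (1 + m * s)

lemma comb_t {m s : ℝ} (hm : |m| ≤ 1) (hs : |s| ≤ 1) (h : 1 + m * s = 0) :
    (m = 1 ∧ s = -1) ∨ (m = -1 ∧ s = 1) := by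
  have hm' := abs_le.1 hm
  have hs' := abs_le.1 hs
  have h2 : (1 - m ^ 2) = 0 := by nlinarith [mul_nonneg (by linarith [hm'.1] : 0 ≤ 1 + m) (by linarith [hm'.2] : 0 ≤ 1 - m), mul_nonneg (by linarith [hs'.1] : 0 ≤ 1 + s) (by linarith [hs'.2] : 0 ≤ 1 - s), sq_nonneg (m + s)]
  have h3 : (m - 1) * (m + 1) = 0 := by linarith
  rcases mul_eq_zero.1 h3 with h | h
  · left
    have : m = 1 := by linarith
    subst this
    exact ⟨rfl, by linarith⟩
  · right
    have : m = -1 := by linarith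
    subst this
    exact ⟨rfl, by linarith⟩

lemma comb_t_nonneg {m s : ℝ} (hm : |m| ≤ 1) (hs : |s| ≤ 1) : 0 ≤ 1 + m * s := by
  have hms : |m * s| ≤ 1 := by
    rw [abs_mul]; exact mul_le_one₀ hm (abs_nonneg _) hs
  linarith [(abs_le.1 hms).1]

lemma comb_abs_le {m s : ℝ} (hm : |m| ≤ 1) (hs : |s| ≤ 1) : |comb m s| ≤ 1 := by
  unfold comb
  have h := comb_t_nonneg hm hs
  have hm' := abs_le.1 hm
  have hs' := abs_le.1 hs
  rw [abs_div, abs_of_nonneg h]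
  refine div_le_one_of_le₀ (abs_le.2 ⟨?_, ?_⟩) h <;> nlinarith

lemma comb_gent_one {m s : ℝ} (hm : |m| ≤ 1) (hs : |s| ≤ 1) :
    (1 + m * s) * gent (comb m s) = (Real.negMulLog ((1 + m) * ((1 + s) * (1 / 2)))
      + Real.negMulLog ((1 - m) * ((1 - s) * (1 / 2))) - Real.negMulLog (1 + m * s))
        / Real.log 2 := by
  have h2 : Real.log 2 ≠ 0 := (Real.log_pos one_lt_two).ne'
  by_cases h : 1 + m * s = 0
  · rw [h]
    rcases comb_t hm hs h with ⟨rfl, rfl⟩ | ⟨rfl, rfl⟩ <;> norm_num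
  · have e1 : (1 + m) * ((1 + s) * (1 / 2)) = (1 + m * s) * ((1 + comb m s) / 2) := by
      unfold comb; field_simp; ring
    have e2 : (1 - m) * ((1 - s) * (1 / 2)) = (1 + m * s) * ((1 - comb m s) / 2) := by
      unfold comb; field_simp; ring
    rw [e1, e2, Real.negMulLog_mul, Real.negMulLog_mul, gent_eq]
    field_simp
    ring

lemma comb_gent {m s : ℝ} (hm : |m| ≤ 1) (hs : |s| ≤ 1) :
    ((1 + m * s) * gent (comb m s) + (1 - m * s) * gent (comb m (-s))) / 2
      = gent m + gent s - gent (m * s) := by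
  have h2 : Real.log 2 ≠ 0 := (Real.log_pos one_lt_two).ne'
  have h := comb_gent_one hm hs
  have h' := comb_gent_one (s := -s) hm (by simpa using hs)
  have hh : Real.negMulLog (1 / 2) = Real.log 2 / 2 := by
    unfold Real.negMulLog
    rw [one_div, Real.log_inv]; ring
  rw [show 1 + m * -s = 1 - m * s by ring, show 1 + -s = 1 - s by ring,
    show 1 - -s = 1 + s by ring] at h'
  rw [h, h', gent_eq', gent_eq', gent_eq']
  simp only [Real.negMulLog_mul, hh]
  field_simp
  ring

lemma comb_one_sub {m s : ℝ} (hm : |m| ≤ 1) (hs : |s| ≤ 1) (h : s ≠ -1) :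
    (1 + m) * (1 - comb m s) = (1 - s) * ((1 - m ^ 2) / (1 + m * s)) := by
  by_cases ht : 1 + m * s = 0
  · rcases comb_t hm hs ht with ⟨rfl, rfl⟩ | ⟨rfl, rfl⟩
    · exact absurd rfl h
    · norm_num
  · unfold comb; field_simp; ring

lemma comb_one_add {m s : ℝ} (hm : |m| ≤ 1) (hs : |s| ≤ 1) (h : s ≠ -1) :
    (1 - m) * (1 + comb m (-s)) = (1 - s) * ((1 - m ^ 2) / (1 + m * (-s))) := by
  by_cases ht : 1 + m * (-s) = 0
  · rcases comb_t hm (by simpa using hs) ht with ⟨rfl, h1⟩ | ⟨rfl, h1⟩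
    · norm_num
    · exact absurd (by linarith) h
  · obtain ⟨x, rfl⟩ : ∃ x, s = -x := ⟨-s, by ring⟩
    rw [neg_neg] at ht ⊢
    unfold comb; field_simp; ring

lemma comb_bdd {m s : ℝ} (hm : |m| ≤ 1) (hs : |s| ≤ 1) : |(1 - m ^ 2) / (1 + m * s)| ≤ 2 := by
  have h := comb_t_nonneg hm hs
  have hm' := abs_le.1 hm
  have hs' := abs_le.1 hs
  rw [abs_div, abs_of_nonneg h]
  refine div_le_of_le_mul₀ h (by norm_num) (abs_le.2 ⟨by nlinarith, ?_⟩)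
  rcases le_total 0 m with h0 | h0 <;> nlinarith

lemma bint {α : Type*} [MeasurableSpace α] (P : Measure α) [IsFiniteMeasure P] {f : α → ℝ}
    (hf : Measurable f) (C : ℝ) (hC : ∀ x, |f x| ≤ C) : Integrable f P :=
  Integrable.of_bound hf.aestronglyMeasurable C (Filter.Eventually.of_forall hC)

lemma condMean_factor_s10 {α γ : Type*} [MeasurableSpace α] [MeasurableSpace γ]
    (P : Measure α) [IsProbabilityMeasure P] (X : α → ℝ) (W : α → γ)
    (hX : Measurable X) (hW : Measurable W) (hX1 : ∀ a, |X a| ≤ 1) :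
    ∃ c : γ → ℝ, Measurable c ∧ (∀ y, |c y| ≤ 1) ∧ (condMean P X W =ᵐ[P] fun a => c (W a)) ∧
      ∀ f : γ → ℝ, Measurable f → (∃ C, ∀ y, |f y| ≤ C) →
        ∫ a, X a * f (W a) ∂P = ∫ a, c (W a) * f (W a) ∂P := by
  have hle : MeasurableSpace.comap W inferInstance ≤ (inferInstance : MeasurableSpace α) :=
    hW.comap_le
  have hsm : StronglyMeasurable[MeasurableSpace.comap W inferInstance] (condMean P X W) :=
    stronglyMeasurable_condExp
  obtain ⟨c0, hc0, hcc⟩ := hsm.measurable.exists_eq_measurable_comp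
  have hbd : ∀ᵐ a ∂P, |condMean P X W a| ≤ 1 :=
    ae_bdd_abs_condExp_of_ae_bdd_abs (Filter.Eventually.of_forall hX1)
  have hE : condMean P X W =ᵐ[P] fun a => max (-1) (min 1 (c0 (W a))) := by
    filter_upwards [hbd] with a ha
    have : condMean P X W a = c0 (W a) := congrFun hcc a
    rw [this] at ha ⊢
    rw [min_eq_right (abs_le.1 ha).2, max_eq_right (abs_le.1 ha).1]
  refine ⟨fun y => max (-1) (min 1 (c0 y)), by fun_prop, fun y => abs_le.2 ⟨le_max_left _ _,
    max_le (by norm_num) (min_le_left _ _)⟩, hE, ?_⟩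
  rintro f hf ⟨C, hC⟩
  have hfm : StronglyMeasurable[MeasurableSpace.comap W inferInstance] (fun a => f (W a)) :=
    (hf.comp (comap_measurable W)).stronglyMeasurable
  have hXi : Integrable X P := bint P hX 1 hX1
  have hXf : Integrable (X * fun a => f (W a)) P := by
    refine bint P (hX.mul (hf.comp hW)) C fun a => ?_
    rw [Pi.mul_apply, abs_mul]
    calc |X a| * |f (W a)| ≤ 1 * |f (W a)| :=
          mul_le_mul_of_nonneg_right (hX1 a) (abs_nonneg _)
      _ ≤ C := by rw [one_mul]; exact hC _
  have h1 := condExp_mul_of_stronglyMeasurable_right hfm hXf hXi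
  have h2 := integral_condExp (μ := P) hle (f := X * fun a => f (W a))
  calc ∫ a, X a * f (W a) ∂P = ∫ a, (X * fun a => f (W a)) a ∂P := rfl
    _ = _ := h2.symm
    _ = ∫ a, max (-1) (min 1 (c0 (W a))) * f (W a) ∂P := by
      refine integral_congr_ae ?_
      filter_upwards [h1, hE] with a ha hb
      rw [ha, ← hb]; rfl

lemma condMean_unique {α γ : Type*} [MeasurableSpace α] [MeasurableSpace γ]
    (P : Measure α) [IsProbabilityMeasure P] (X : α → ℝ) (W : α → γ)
    (hX : Measurable X) (hW : Measurable W) (hX1 : ∀ a, |X a| ≤ 1)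
    (c : γ → ℝ) (hc : Measurable c) (hc1 : ∀ y, |c y| ≤ 1)
    (h : ∀ f : γ → ℝ, Measurable f → (∀ y, |f y| ≤ 1) →
        ∫ a, X a * f (W a) ∂P = ∫ a, c (W a) * f (W a) ∂P) :
    condMean P X W =ᵐ[P] fun a => c (W a) := by
  have hle : MeasurableSpace.comap W inferInstance ≤ (inferInstance : MeasurableSpace α) :=
    hW.comap_le
  symm
  have hci : Integrable (fun a => c (W a)) P := bint P (hc.comp hW) 1 fun a => hc1 _
  refine ae_eq_condExp_of_forall_setIntegral_eq hle (bint P hX 1 hX1)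
    (fun s _ _ => hci.integrableOn) ?_
    (hc.comp (comap_measurable W)).aestronglyMeasurable
  rintro s ⟨t, ht, rfl⟩ -
  have := h (t.indicator 1) (measurable_one.indicator ht) (fun y => by
    by_cases hy : y ∈ t <;> simp [hy])
  rw [← integral_indicator (hW ht), ← integral_indicator (hW ht)]
  have e : ∀ g : α → ℝ, (W ⁻¹' t).indicator g = fun a => g a * t.indicator 1 (W a) := by
    intro g
    funext a
    by_cases hy : W a ∈ t <;> simp [hy]
  rw [e, e]
  exact this.symm

instance signMeasure_prob : IsProbabilityMeasure signMeasure := by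
  constructor
  simp only [signMeasure, Measure.smul_apply, Measure.add_apply, measure_univ, smul_eq_mul]
  rw [one_add_one_eq_two]
  exact ENNReal.inv_mul_cancel two_ne_zero (by simp)

lemma integral_sign_prod (PZ : Measure ℝ) [IsProbabilityMeasure PZ] (F : ℝ × ℝ → ℝ)
    (hF : Measurable F) (C : ℝ) (hC : ∀ x, |F x| ≤ C) :
    ∫ q, F q ∂(signMeasure.prod PZ) = ((∫ z, F (1, z) ∂PZ) + ∫ z, F (-1, z) ∂PZ) / 2 := by
  rw [integral_prod _ (bint _ hF C hC)]
  unfold signMeasure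
  rw [integral_smul_measure, integral_add_measure (integrable_dirac (by simp)) (integrable_dirac (by simp)),
    integral_dirac, integral_dirac]
  · simp; ring

lemma channel (PZ : Measure ℝ) [IsProbabilityMeasure PZ] :
    ∃ r : ℝ → ℝ, Measurable r ∧ (∀ y, |r y| ≤ 1) ∧ (∀ y, r (-y) = -r y) ∧
      (∀ k, qmom PZ k = ∫ z, r z ^ (2 * k) ∂PZ) ∧
      (∀ G : ℝ → ℝ, Measurable G → (∃ C, ∀ y, |G y| ≤ C) →
        ∫ z, (1 - r z) * G z ∂PZ = ∫ z, (1 - r z) * G (-z) ∂PZ) ∧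
      (∀ᵐ z ∂PZ, r z ≠ -1) := by
  -- we truncate the first coordinate to make it bounded everywhere
  have hsupp : ∀ᵐ q ∂(signMeasure.prod PZ), q.1 = max (-1) (min 1 q.1) := by
    have : ∀ᵐ x ∂signMeasure, x = max (-1) (min 1 x) := by
      unfold signMeasure
      refine Measure.ae_smul_measure ?_ _
      rw [ae_add_measure_iff]
      constructor <;> simp [ae_dirac_eq]
    exact (Measure.quasiMeasurePreserving_fst (μ := signMeasure) (ν := PZ)).ae this
  have hYm : Measurable fun q : ℝ × ℝ => q.1 * q.2 := by fun_prop
  obtain ⟨r0, hr0, hr1, hE, hH⟩ := condMean_factor_s10 (signMeasure.prod PZ)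
    (fun q : ℝ × ℝ => max (-1) (min 1 q.1)) (fun q : ℝ × ℝ => q.1 * q.2) (by fun_prop) hYm
    (fun q => abs_le.2 ⟨le_max_left _ _, max_le (by norm_num) (min_le_left _ _)⟩)
  have hE' : condMean (signMeasure.prod PZ) (fun q : ℝ × ℝ => q.1) (fun q : ℝ × ℝ => q.1 * q.2)
      =ᵐ[signMeasure.prod PZ] fun q => r0 (q.1 * q.2) :=
    (condExp_congr_ae hsupp).trans hE
  have key : ∀ f : ℝ → ℝ, Measurable f → (∃ C, ∀ y, |f y| ≤ C) →
      (∫ z, f z ∂PZ) - ∫ z, f (-z) ∂PZ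
        = (∫ z, r0 z * f z ∂PZ) + ∫ z, r0 (-z) * f (-z) ∂PZ := by
    rintro f hf ⟨C, hC⟩
    have h := hH f hf ⟨C, hC⟩
    rw [integral_sign_prod PZ _ (by fun_prop) C, integral_sign_prod PZ _ (by fun_prop) C] at h
    · norm_num [integral_neg] at h
      linarith
    · intro q
      rw [abs_mul]
      exact (mul_le_of_le_one_left (abs_nonneg _) (hr1 _)).trans (hC _)
    · intro q
      rw [abs_mul]
      refine (mul_le_of_le_one_left (abs_nonneg _) ?_).trans (hC _)
      exact abs_le.2 ⟨le_max_left _ _, max_le (by norm_num) (min_le_left _ _)⟩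
  have hs0 : ∀ᵐ z ∂PZ, r0 z + r0 (-z) = 0 := by
    have hb : ∀ y, |r0 y + r0 (-y)| ≤ 2 := fun y =>
      (abs_add_le _ _).trans (by linarith [hr1 y, hr1 (-y)])
    have hb' : ∀ y x, |r0 x| ≤ 1 → |r0 x * (r0 y + r0 (-y))| ≤ 2 := fun y x hx => by
      rw [abs_mul]; exact (mul_le_of_le_one_left (abs_nonneg _) hx).trans (hb _)
    have h := key (fun y => r0 y + r0 (-y)) (by fun_prop) ⟨2, hb⟩
    simp only [neg_neg] at h
    have e : (∫ z, r0 (-z) + r0 z ∂PZ) = ∫ z, r0 z + r0 (-z) ∂PZ := by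
      congr 1; funext z; ring
    rw [e, sub_self, ← integral_add] at h
    · have h2 : ∫ z, (r0 z + r0 (-z)) ^ 2 ∂PZ = 0 := by
        rw [h]; congr 1; funext z; ring
      rw [integral_eq_zero_iff_of_nonneg (fun z => sq_nonneg _)] at h2
      · filter_upwards [h2] with z hz
        exact pow_eq_zero_iff two_ne_zero |>.1 hz
      · refine bint PZ ((by fun_prop : Measurable fun z => r0 z + r0 (-z)).pow_const 2) 4 fun y => ?_
        rw [abs_pow]
        nlinarith [hb y, abs_nonneg (r0 y + r0 (-y))]
    · exact bint PZ (by fun_prop) 2 fun y => hb' y y (hr1 _)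
    · refine bint PZ (by fun_prop) 2 fun y => ?_
      rw [add_comm]; exact hb' y (-y) (hr1 _)
  set r : ℝ → ℝ := fun y => (r0 y - r0 (-y)) / 2 with hr
  have hrm : Measurable r := by fun_prop
  have hodd : ∀ y, r (-y) = -r y := fun y => by simp only [hr, neg_neg]; ring
  have hrb : ∀ y, |r y| ≤ 1 := fun y => by
    have h1 := abs_le.1 (hr1 y)
    have h2 := abs_le.1 (hr1 (-y))
    exact abs_le.2 ⟨by simp only [hr]; linarith, by simp only [hr]; linarith⟩
  have hG : ∀ G : ℝ → ℝ, Measurable G → (∃ C, ∀ y, |G y| ≤ C) →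
        ∫ z, (1 - r z) * G z ∂PZ = ∫ z, (1 - r z) * G (-z) ∂PZ := by
    rintro G hGm ⟨C, hC⟩
    have h := key G hGm ⟨C, hC⟩
    have e1 : ∫ z, r0 z * G z ∂PZ = ∫ z, r z * G z ∂PZ := by
      refine integral_congr_ae ?_
      filter_upwards [hs0] with z hz
      have : r0 z = r z := by simp only [hr]; linarith
      rw [this]
    have e2 : ∫ z, r0 (-z) * G (-z) ∂PZ = - ∫ z, r z * G (-z) ∂PZ := by
      rw [← integral_neg]
      refine integral_congr_ae ?_
      filter_upwards [hs0] with z hz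
      have : r0 (-z) = -r z := by simp only [hr]; linarith
      rw [this]; ring
    rw [e1, e2] at h
    have hb' : ∀ x y, |r x * G y| ≤ C := fun x y => by
      rw [abs_mul]; exact (mul_le_of_le_one_left (abs_nonneg _) (hrb x)).trans (hC _)
    simp only [sub_mul, one_mul]
    rw [integral_sub, integral_sub]
    · linarith
    · exact bint PZ (by fun_prop) C fun y => hC _
    · exact bint PZ (by fun_prop) C fun y => hb' _ _
    · exact bint PZ (by fun_prop) C fun y => hC _
    · exact bint PZ (by fun_prop) C fun y => hb' _ _
  refine ⟨r, hrm, hrb, hodd, ?_, hG, ?_⟩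
  · intro k
    unfold qmom
    have e : ∀ᵐ q ∂(signMeasure.prod PZ), (condMean (signMeasure.prod PZ)
        (fun q : ℝ × ℝ => q.1) (fun q : ℝ × ℝ => q.1 * q.2) q) ^ (2 * k)
        = r0 (q.1 * q.2) ^ (2 * k) := by
      filter_upwards [hE'] with q hq
      rw [hq]
    rw [integral_congr_ae e, integral_sign_prod PZ _ (by fun_prop) 1]
    · simp only [one_mul, neg_one_mul]
      have e1 : ∫ z, r0 z ^ (2 * k) ∂PZ = ∫ z, r z ^ (2 * k) ∂PZ := by
        refine integral_congr_ae ?_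
        filter_upwards [hs0] with z hz
        have : r0 z = r z := by simp only [hr]; linarith
        rw [this]
      have e2 : ∫ z, r0 (-z) ^ (2 * k) ∂PZ = ∫ z, r z ^ (2 * k) ∂PZ := by
        refine integral_congr_ae ?_
        filter_upwards [hs0] with z hz
        have : r0 (-z) = -r z := by simp only [hr]; linarith
        rw [this, (even_two_mul k).neg_pow]
      rw [e1, e2]; ring
    · intro q
      rw [abs_pow]; exact pow_le_one₀ (abs_nonneg _) (hr1 _)
  · have hms : MeasurableSet {z | r z = -1} := hrm (measurableSet_singleton _)
    have h := hG ({z | r z = -1}.indicator 1) (measurable_one.indicator hms) ⟨1, fun y => by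
      by_cases hy : r y = -1 <;> simp [hy]⟩
    have e1 : (fun z => (1 - r z) * {z | r z = -1}.indicator (1 : ℝ → ℝ) z)
        = {z | r z = -1}.indicator (fun _ => (2 : ℝ)) := by
      funext z
      by_cases hy : r z = -1 <;> simp [hy]
      norm_num
    have e2 : (fun z => (1 - r z) * {z | r z = -1}.indicator (1 : ℝ → ℝ) (-z))
        = fun _ => (0 : ℝ) := by
      funext z
      by_cases hy : r z = 1 <;> simp [hy, hodd]
    rw [e1, e2, integral_indicator_const _ hms] at h
    simp at h
    rw [ae_iff]
    simpa [Measure.real, ENNReal.toReal_eq_zero_iff] using h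

section Core

variable {Ω β : Type*} [MeasurableSpace Ω] [MeasurableSpace β]

lemma transfer (μ : Measure Ω) [IsProbabilityMeasure μ]
    (X Z : Ω → ℝ) (U : Ω → β)
    (hX : Measurable X) (hZ : Measurable Z) (hU : Measurable U)
    (hindep : IndepFun (fun ω => (X ω, U ω)) Z μ)
    (Φ : (ℝ × β) × ℝ → ℝ) (hΦ : Measurable Φ) :
    ∫ ω, Φ ((X ω, U ω), Z ω) ∂μ = ∫ q, Φ ((X q.1, U q.1), Z q.2) ∂(μ.prod μ) := by
  have hXU : Measurable fun ω => (X ω, U ω) := hX.prodMk hU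
  have h1 := (indepFun_iff_map_prod_eq_prod_map_map hXU.aemeasurable hZ.aemeasurable).1 hindep
  rw [Measure.map_prod_map _ _ hXU hZ] at h1
  have h2 : ∫ ω, Φ ((X ω, U ω), Z ω) ∂μ
      = ∫ p, Φ p ∂(μ.map fun ω => ((X ω, U ω), Z ω)) := by
    rw [integral_map (hXU.prodMk hZ).aemeasurable hΦ.aestronglyMeasurable]
  rw [h2, h1, integral_map (by fun_prop) hΦ.aestronglyMeasurable]
  rfl

set_option maxHeartbeats 2000000 in
lemma two_look_s10 (μ : Measure Ω) [IsProbabilityMeasure μ]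
    (X Z : Ω → ℝ) (U : Ω → β)
    (hX : Measurable X) (hZ : Measurable Z) (hU : Measurable U)
    (hpm : ∀ ω, X ω = -1 ∨ X ω = 1)
    (hindep : IndepFun (fun ω => (X ω, U ω)) Z μ) :
    ∫ ω, hb ((1 + condMean μ X (fun ω' => (X ω' * Z ω', U ω')) ω) / 2) ∂μ
        = ∑' k : ℕ, ck (k + 1) * (1 - qmom (Measure.map Z μ) (k + 1))
            * (1 - ∫ ω, (condMean μ X U ω) ^ (2 * (k + 1)) ∂μ) := by
  have hX1 : ∀ ω, |X ω| ≤ 1 := fun ω => by rcases hpm ω with h | h <;> simp [h]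
  have : IsProbabilityMeasure (Measure.map Z μ) :=
    Measure.isProbabilityMeasure_map hZ.aemeasurable
  obtain ⟨m, hm, hm1, hmE, hmH⟩ := condMean_factor_s10 μ X U hX hU hX1
  obtain ⟨r, hr, hr1, hodd, hq, hG, hne⟩ := channel (Measure.map Z μ)
  have hne' : ∀ᵐ ω ∂μ, r (Z ω) ≠ -1 := ae_of_ae_map hZ.aemeasurable hne
  have habs : ∀ {a b C : ℝ}, |a| ≤ 1 → |b| ≤ C → |a * b| ≤ C := fun {a b C} ha hb => by
    rw [abs_mul]; exact (mul_le_of_le_one_left (abs_nonneg _) ha).trans hb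
  have F2 : ∀ H : ℝ × β → ℝ, Measurable H → (∃ C, ∀ y, |H y| ≤ C) →
      ∫ ω, (X ω - m (U ω)) * H (Z ω, U ω) ∂μ = 0 := by
    rintro H hH ⟨C, hC⟩
    have hC0 : ∀ ω y, |(X ω - m (U ω)) * H y| ≤ 2 * C := fun ω y => by
      rw [abs_mul]
      refine mul_le_mul ?_ (hC y) (abs_nonneg _) (by norm_num)
      exact (abs_sub _ _).trans (by linarith [hX1 ω, hm1 (U ω)])
    rw [transfer μ X Z U hX hZ hU hindep (fun p => (p.1.1 - m p.1.2) * H (p.2, p.1.2))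
      (by fun_prop), integral_prod_symm _ (bint _ (by fun_prop) (2 * C) fun q => hC0 _ _)]
    have : ∀ ω2, ∫ ω, (X ω - m (U ω)) * H (Z ω2, U ω) ∂μ = 0 := by
      intro ω2
      simp only [sub_mul]
      rw [integral_sub, hmH (fun u => H (Z ω2, u)) (by fun_prop) ⟨C, fun u => hC _⟩, sub_self]
      · exact bint _ (by fun_prop) C fun ω => habs (hX1 ω) (hC _)
      · exact bint _ (by fun_prop) C fun ω => habs (hm1 _) (hC _)
    simp [this]
  have hr2 : ∀ z, |1 - r z| ≤ 2 := fun z => by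
    have := abs_le.1 (hr1 z)
    exact abs_le.2 ⟨by linarith, by linarith⟩
  have F3 : ∀ H : ℝ × β → ℝ, Measurable H → (∃ C, ∀ y, |H y| ≤ C) →
      ∫ ω, (1 - r (Z ω)) * (H (Z ω, U ω) - H (-Z ω, U ω)) ∂μ = 0 := by
    rintro H hH ⟨C, hC⟩
    have hC0 : ∀ z y y', |(1 - r z) * (H y - H y')| ≤ 2 * (2 * C) := fun z y y' => by
      rw [abs_mul]
      refine mul_le_mul (hr2 z) ?_ (abs_nonneg _) (by norm_num)
      exact (abs_sub _ _).trans (by linarith [hC y, hC y'])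
    rw [transfer μ X Z U hX hZ hU hindep
      (fun p => (1 - r p.2) * (H (p.2, p.1.2) - H (-p.2, p.1.2)))
      (by fun_prop), integral_prod _ (bint _ (by fun_prop) (2 * (2 * C)) fun q => hC0 _ _ _)]
    have hb1 : ∀ z y, |(1 - r z) * H y| ≤ 2 * C := fun z y => by
      rw [abs_mul]
      exact mul_le_mul (hr2 z) (hC y) (abs_nonneg _) (by norm_num)
    have : ∀ ω1, ∫ ω, (1 - r (Z ω)) * (H (Z ω, U ω1) - H (-Z ω, U ω1)) ∂μ = 0 := by
      intro ω1
      have h := hG (fun z => H (z, U ω1)) (by fun_prop) ⟨C, fun u => hC _⟩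
      rw [integral_map hZ.aemeasurable (by fun_prop), integral_map hZ.aemeasurable
        (by fun_prop)] at h
      simp only [mul_sub]
      rw [integral_sub, h, sub_self]
      · exact bint _ (by fun_prop) (2 * C) fun ω => hb1 _ _
      · exact bint _ (by fun_prop) (2 * C) fun ω => hb1 _ _
    simp [this]
  have F23 : ∀ A B : Ω → ℝ, Integrable A μ → Integrable B μ → ∀ H1 H2 : ℝ × β → ℝ,
      Measurable H1 → (∃ C, ∀ y, |H1 y| ≤ C) → Measurable H2 → (∃ C, ∀ y, |H2 y| ≤ C) →
      (∀ᵐ ω ∂μ, A ω = B ω + (X ω - m (U ω)) * H1 (Z ω, U ω)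
        + (1 - r (Z ω)) * (H2 (Z ω, U ω) - H2 (-Z ω, U ω))) →
      ∫ ω, A ω ∂μ = ∫ ω, B ω ∂μ := by
    rintro A B hA hB H1 H2 hH1 ⟨C1, hC1⟩ hH2 ⟨C2, hC2⟩ hAB
    have i1 : Integrable (fun ω => (X ω - m (U ω)) * H1 (Z ω, U ω)) μ := by
      refine bint _ (by fun_prop) (2 * C1) fun ω => ?_
      rw [abs_mul]
      refine mul_le_mul ?_ (hC1 _) (abs_nonneg _) (by norm_num)
      exact (abs_sub _ _).trans (by linarith [hX1 ω, hm1 (U ω)])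
    have i2 : Integrable (fun ω => (1 - r (Z ω)) * (H2 (Z ω, U ω) - H2 (-Z ω, U ω))) μ := by
      refine bint _ (by fun_prop) (2 * (2 * C2)) fun ω => ?_
      rw [abs_mul]
      refine mul_le_mul (hr2 _) ?_ (abs_nonneg _) (by norm_num)
      exact (abs_sub _ _).trans (by linarith [hC2 (Z ω, U ω), hC2 (-Z ω, U ω)])
    have i3 : Integrable (fun ω => B ω + (X ω - m (U ω)) * H1 (Z ω, U ω)) μ := hB.add i1
    rw [integral_congr_ae hAB, integral_add i3 i2, integral_add hB i1,
      F2 H1 hH1 ⟨C1, hC1⟩, F3 H2 hH2 ⟨C2, hC2⟩]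
    ring
  -- the posterior mean
  have hWm : Measurable fun ω => (X ω * Z ω, U ω) := by fun_prop
  have hcm : Measurable fun w : ℝ × β => comb (m w.2) (r w.1) := by
    unfold comb; fun_prop
  have hc1 : ∀ w : ℝ × β, |comb (m w.2) (r w.1)| ≤ 1 := fun w => comb_abs_le (hm1 _) (hr1 _)
  have post : condMean μ X (fun ω => (X ω * Z ω, U ω))
      =ᵐ[μ] fun ω => comb (m (U ω)) (r (X ω * Z ω)) := by
    refine condMean_unique μ X _ hX hWm hX1 (fun w : ℝ × β => comb (m w.2) (r w.1)) hcm hc1 ?_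
    intro f hf hf1
    have hnm : Measurable fun w : ℝ × β => (-w.1, w.2) := by fun_prop
    refine F23 _ _ (bint _ (by fun_prop) 1 fun ω => habs (hX1 ω) (hf1 _))
      (bint _ ((hcm.comp hWm).mul (hf.comp hWm)) 1 fun ω =>
        habs (hc1 (X ω * Z ω, U ω)) (hf1 _))
      (fun w => (f w + f (-w.1, w.2) - comb (m w.2) (r w.1) * f w
        + comb (m w.2) (r (-w.1)) * f (-w.1, w.2)) / 2)
      (fun w => (1 - m w.2 ^ 2) / (1 + m w.2 * r w.1) * f w / 2) ?_ ⟨2, ?_⟩ ?_ ⟨2, ?_⟩ ?_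
    · exact (((hf.add (hf.comp hnm)).sub (hcm.mul hf)).add
        ((hcm.comp hnm).mul (hf.comp hnm))).div_const 2
    · intro w
      have a := abs_le.1 (hf1 w)
      have b := abs_le.1 (hf1 (-w.1, w.2))
      have c := abs_le.1 (habs (hc1 w) (hf1 w))
      have d := abs_le.1 (habs (hc1 (-w.1, w.2)) (hf1 (-w.1, w.2)))
      simp only at d
      exact abs_le.2 ⟨by linarith, by linarith⟩
    · fun_prop
    · intro w
      have a := comb_bdd (hm1 w.2) (hr1 w.1)
      have b := hf1 w
      rw [abs_div, abs_mul, abs_two]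
      nlinarith [abs_nonneg ((1 - m w.2 ^ 2) / (1 + m w.2 * r w.1)), abs_nonneg (f w)]
    · filter_upwards [hne'] with ω hω
      have e1 := comb_one_sub (hm1 (U ω)) (hr1 (Z ω)) hω
      have e2 := comb_one_add (hm1 (U ω)) (hr1 (Z ω)) hω
      simp only [hodd]
      rcases hpm ω with h | h
      · simp only [h, neg_one_mul, hodd]
        linear_combination (f (Z ω, U ω) / 2) * e1 - (f (-Z ω, U ω) / 2) * e2
      · simp only [h, one_mul]
        linear_combination (f (Z ω, U ω) / 2) * e1 - (f (-Z ω, U ω) / 2) * e2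
  have hms : ∀ ω, |m (U ω) * r (Z ω)| ≤ 1 := fun ω => habs (hm1 _) (hr1 _)
  have hgm : Measurable gent := gent_continuous.measurable
  have hKm : Measurable fun w : ℝ × β => gent (comb (m w.2) (r w.1)) := hgm.comp hcm
  have hK1 : ∀ w : ℝ × β, |gent (comb (m w.2) (r w.1))| ≤ 1 := fun w => gent_abs_le (hc1 w)
  have step : ∫ ω, hb ((1 + condMean μ X (fun ω' => (X ω' * Z ω', U ω')) ω) / 2) ∂μ
      = ∫ ω, (gent (m (U ω)) + gent (r (Z ω)) - gent (m (U ω) * r (Z ω))) ∂μ := by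
    have e0 : ∀ᵐ ω ∂μ, hb ((1 + condMean μ X (fun ω' => (X ω' * Z ω', U ω')) ω) / 2)
        = gent (comb (m (U ω)) (r (X ω * Z ω))) := by
      filter_upwards [post] with ω hω
      rw [hω]; rfl
    rw [integral_congr_ae e0]
    have hnm : Measurable fun w : ℝ × β => (-w.1, w.2) := by fun_prop
    refine F23 _ _ (bint _ (hKm.comp hWm) 1 fun ω => hK1 (X ω * Z ω, U ω))
      (bint _ (by fun_prop) 3 fun ω => ?_)
      (fun w => (gent (comb (m w.2) (r w.1)) - gent (comb (m w.2) (r (-w.1)))) / 2)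
      (fun w => m w.2 * gent (comb (m w.2) (r w.1)) / 2) ?_ ⟨1, ?_⟩ ?_ ⟨1, ?_⟩ ?_
    · have a := abs_le.1 (gent_abs_le (hm1 (U ω)))
      have b := abs_le.1 (gent_abs_le (hr1 (Z ω)))
      have c := abs_le.1 (gent_abs_le (hms ω))
      exact abs_le.2 ⟨by linarith, by linarith⟩
    · exact (hKm.sub (hKm.comp hnm)).div_const 2
    · intro w
      have a := abs_le.1 (hK1 w)
      have b := abs_le.1 (hK1 (-w.1, w.2))
      simp only at b
      exact abs_le.2 ⟨by linarith, by linarith⟩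
    · exact ((hm.comp measurable_snd).mul hKm).div_const 2
    · intro w
      have a := abs_le.1 (habs (hm1 w.2) (hK1 w))
      exact abs_le.2 ⟨by linarith, by linarith⟩
    · refine Filter.Eventually.of_forall fun ω => ?_
      have e := comb_gent (hm1 (U ω)) (hr1 (Z ω))
      simp only [hodd]
      rcases hpm ω with h | h
      · simp only [h, neg_one_mul, hodd]
        linear_combination e
      · simp only [h, one_mul]
        linear_combination e
  rw [step]
  have hterm : ∀ (k : ℕ) (x : ℝ), |x| ≤ 1 → |1 - x ^ (2 * k)| ≤ 1 := fun k x hx => by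
    have h1 : 0 ≤ x ^ (2 * k) := (even_two_mul k).pow_nonneg x
    have h2 : x ^ (2 * k) ≤ 1 := by
      have := pow_le_one₀ (n := 2 * k) (abs_nonneg x) hx
      rwa [(even_two_mul k).pow_abs] at this
    exact abs_le.2 ⟨by linarith, by linarith⟩
  have hFb : ∀ (k : ℕ) (ω : Ω), |ck (k + 1) * ((1 - m (U ω) ^ (2 * (k + 1)))
      * (1 - r (Z ω) ^ (2 * (k + 1))))| ≤ ck (k + 1) := fun k ω => by
    rw [abs_mul, abs_of_nonneg (ck_nonneg k)]
    exact mul_le_of_le_one_right (ck_nonneg k)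
      (habs (hterm _ _ (hm1 _)) (hterm _ _ (hr1 _)))
  have hFi : ∀ k : ℕ, Integrable (fun ω => ck (k + 1) * ((1 - m (U ω) ^ (2 * (k + 1)))
      * (1 - r (Z ω) ^ (2 * (k + 1))))) μ := fun k => bint _ (by fun_prop) _ (hFb k)
  have hsum := hasSum_integral_of_summable_integral_norm hFi (by
    refine Summable.of_nonneg_of_le (fun k => integral_nonneg fun ω => norm_nonneg _)
      (fun k => ?_) ck_summable
    calc _ ≤ ∫ ω, ck (k + 1) ∂μ :=
          integral_mono (hFi k).norm (integrable_const _) (hFb k)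
      _ = ck (k + 1) := by simp)
  have e1 : ∫ ω, (gent (m (U ω)) + gent (r (Z ω)) - gent (m (U ω) * r (Z ω))) ∂μ
      = ∫ ω, ∑' k : ℕ, ck (k + 1) * ((1 - m (U ω) ^ (2 * (k + 1)))
      * (1 - r (Z ω) ^ (2 * (k + 1)))) ∂μ := by
    congr 1; funext ω
    exact gent_comb (hm1 _) (hr1 _)
  rw [e1, ← hsum.tsum_eq]
  congr 1
  funext k
  rw [integral_const_mul, transfer μ X Z U hX hZ hU hindep
    (fun p => (1 - m p.1.2 ^ (2 * (k + 1))) * (1 - r p.2 ^ (2 * (k + 1)))) (by fun_prop)]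
  have e2 := integral_prod_mul (μ := μ) (ν := μ) (fun ω => 1 - m (U ω) ^ (2 * (k + 1)))
    (fun ω => 1 - r (Z ω) ^ (2 * (k + 1)))
  have hpow : ∀ (k : ℕ) (x : ℝ), |x| ≤ 1 → |x ^ k| ≤ 1 := fun k x hx => by
    rw [abs_pow]; exact pow_le_one₀ (abs_nonneg _) hx
  have e3 : ∫ ω, (1 - m (U ω) ^ (2 * (k + 1))) ∂μ
      = 1 - ∫ ω, (condMean μ X U ω) ^ (2 * (k + 1)) ∂μ := by
    rw [integral_sub (integrable_const _) (bint _ (by fun_prop) 1 fun ω => hpow _ _ (hm1 _))]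
    congr 1
    · simp
    · refine integral_congr_ae ?_
      filter_upwards [hmE] with ω hω
      rw [hω]
  have e4 : ∫ ω, (1 - r (Z ω) ^ (2 * (k + 1))) ∂μ
      = 1 - qmom (Measure.map Z μ) (k + 1) := by
    rw [integral_sub (integrable_const _) (bint _ (by fun_prop) 1 fun ω => hpow _ _ (hr1 _)),
      hq, integral_map hZ.aemeasurable (by fun_prop)]
    simp
  rw [e2, e3, e4]
  ring

end Core

/-- Two-look formula: for `X ∈ {±1}` with mean `μ`, `Y = X·Z` an
observation of `X` through the BMS channel with noise law `PZ = law(Z)`, and `U` side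
information with `Z` independent of `(X,U)` (so `U − X − Y` is Markov):
(a) `H(X|Y) = Σ_k c_k (1−q_k)(1−μ^{2k})` and
(b) `H(X|Y,U) = Σ_k c_k (1−q_k)(1−E[(E[X|U])^{2k}])`. -/
theorem stmt_10 {Ω β : Type*} [MeasurableSpace Ω] [MeasurableSpace β]
    (μ : Measure Ω) [IsProbabilityMeasure μ]
    (X Z : Ω → ℝ) (U : Ω → β)
    (hX : Measurable X) (hZ : Measurable Z) (hU : Measurable U)
    (hpm : ∀ ω, X ω = -1 ∨ X ω = 1)
    (hindep : IndepFun (fun ω => (X ω, U ω)) Z μ) :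
    (∫ ω, hb ((1 + condMean μ X (fun ω' => X ω' * Z ω') ω) / 2) ∂μ
        = ∑' k : ℕ, ck (k + 1) * (1 - qmom (Measure.map Z μ) (k + 1))
            * (1 - (∫ ω, X ω ∂μ) ^ (2 * (k + 1))))
    ∧ (∫ ω, hb ((1 + condMean μ X (fun ω' => (X ω' * Z ω', U ω')) ω) / 2) ∂μ
        = ∑' k : ℕ, ck (k + 1) * (1 - qmom (Measure.map Z μ) (k + 1))
            * (1 - ∫ ω, (condMean μ X U ω) ^ (2 * (k + 1)) ∂μ)) := by
  refine ⟨?_, two_look_s10 μ X Z U hX hZ hU hpm hindep⟩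
  have hind : IndepFun (fun ω => (X ω, ())) Z μ :=
    hindep.comp (φ := fun p : ℝ × β => (p.1, ())) (ψ := id) (by fun_prop) measurable_id
  have h := two_look_s10 μ X Z (fun _ => ()) hX hZ measurable_const hpm hind
  have e1 : condMean μ X (fun ω' => (X ω' * Z ω', ())) = condMean μ X (fun ω' => X ω' * Z ω') := by
    unfold condMean
    congr 1
    apply le_antisymm
    · rw [← measurable_iff_comap_le]
      exact (comap_measurable (fun ω' => X ω' * Z ω')).prodMk measurable_const
    · rw [← measurable_iff_comap_le]
      exact measurable_fst.comp (comap_measurable (fun ω' => (X ω' * Z ω', ())))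
  have e2 : condMean μ X (fun _ : Ω => ()) = fun _ => ∫ ω, X ω ∂μ := by
    unfold condMean
    rw [MeasurableSpace.comap_const, condExp_bot]
  rw [e1, e2] at h
  simpa using h
end
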